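/- arXiv:1407.1644 — 3 statements merged into one kernel-verified Lean document; each statement's English description precedes it below -/
import Mathlib

section
/- Let Y_n and Y_m be solid h-harmonics on ℝ^d of degrees n and m respectively, with n ≠ m. Then ∫_{S^{d−1}} ⟨∇₀^κ Y_n(ω), ∇₀^κ Y_m(ω)⟩ h_κ²(ω) dσ(ω) = 0. -/
open MeasureTheory Finset
open scoped ENNReal RealInnerProductSpace

noncomputable section

/-- the reflection σ_ν -/
def reflectV {d : ℕ} (ν x : EuclideanSpace ℝ (Fin d)) : EuclideanSpace ℝ (Fin d) :=
  x - ((2 * ⟪x, ν⟫ / ⟪ν, ν⟫ : ℝ)) • ν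

/-- the Dunkl operator T_j (at function level, away from the walls) -/
def dunklT {d : ℕ} (Rp : Finset (EuclideanSpace ℝ (Fin d))) (κ : EuclideanSpace ℝ (Fin d) → ℝ)
    (j : Fin d) (f : EuclideanSpace ℝ (Fin d) → ℝ) (x : EuclideanSpace ℝ (Fin d)) : ℝ :=
  fderiv ℝ f x (EuclideanSpace.single j 1) +
    ∑ ν ∈ Rp, κ ν * ν j * ((f x - f (reflectV ν x)) / ⟪x, ν⟫)

/-- `Rp` is a positive subsystem of a root system invariant under its reflections -/
def IsPosRootSystem {d : ℕ} (Rp : Finset (EuclideanSpace ℝ (Fin d))) : Prop :=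
  (∀ ν ∈ Rp, ν ≠ 0) ∧ (∀ ν ∈ Rp, -ν ∉ Rp) ∧
    ∀ ν ∈ Rp, ∀ μ ∈ Rp, reflectV ν μ ∈ Rp ∨ -reflectV ν μ ∈ Rp

/-- The multiplicity function is G-invariant -/
def IsGInvMult {d : ℕ} (Rp : Finset (EuclideanSpace ℝ (Fin d)))
    (κ : EuclideanSpace ℝ (Fin d) → ℝ) : Prop :=
  (∀ ν ∈ Rp, 0 ≤ κ ν) ∧
    ∀ ν ∈ Rp, ∀ μ ∈ Rp, ∀ μ' ∈ Rp, (reflectV ν μ = μ' ∨ reflectV ν μ = -μ') → κ μ = κ μ'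

/-- solid h-harmonic of degree n : a homogeneous polynomial of degree n annihilated by the
Dunkl Laplacian (expressed at function level on the complement of the walls) -/
def IsSolidHHarmonic {d : ℕ} (Rp : Finset (EuclideanSpace ℝ (Fin d)))
    (κ : EuclideanSpace ℝ (Fin d) → ℝ) (n : ℕ) (f : EuclideanSpace ℝ (Fin d) → ℝ) : Prop :=
  (∃ P : MvPolynomial (Fin d) ℝ, P.IsHomogeneous n ∧
    ∀ x : EuclideanSpace ℝ (Fin d), f x = MvPolynomial.eval (fun i => x i) P) ∧
  ∀ x : EuclideanSpace ℝ (Fin d), (∀ ν ∈ Rp, ⟪x, ν⟫ ≠ 0) →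
    ∑ j : Fin d, dunklT Rp κ j (dunklT Rp κ j f) x = 0

/-- the weight h_κ² -/
def hk2 {d : ℕ} (Rp : Finset (EuclideanSpace ℝ (Fin d))) (κ : EuclideanSpace ℝ (Fin d) → ℝ)
    (x : EuclideanSpace ℝ (Fin d)) : ℝ :=
  (∏ ν ∈ Rp, |⟪x, ν⟫| ^ (κ ν)) ^ 2

/-- surface measure on the unit sphere S^{d-1} -/
def sphereMeasure (d : ℕ) : Measure (Metric.sphere (0 : EuclideanSpace ℝ (Fin d)) 1) :=
  (volume : Measure (EuclideanSpace ℝ (Fin d))).toSphere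

section Reflections

variable {d : ℕ} {Rp : Finset (EuclideanSpace ℝ (Fin d))} {κ : EuclideanSpace ℝ (Fin d) → ℝ}

/-- `reflectV ν` as a linear isometric equivalence. -/
def reflectEquiv (ν : EuclideanSpace ℝ (Fin d)) :
    EuclideanSpace ℝ (Fin d) ≃ₗᵢ[ℝ] EuclideanSpace ℝ (Fin d) :=
  (Submodule.span ℝ {ν})ᗮ.reflection

lemma reflectEquiv_apply (ν x : EuclideanSpace ℝ (Fin d)) :
    reflectEquiv ν x = reflectV ν x := by
  rw [reflectEquiv, Submodule.reflection_orthogonal_apply, Submodule.reflection_singleton_apply,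
    reflectV, neg_sub, real_inner_self_eq_norm_sq, real_inner_comm]
  rw [← smul_assoc, nsmul_eq_mul, mul_div_assoc]
  simp

lemma reflectV_reflectV (ν x : EuclideanSpace ℝ (Fin d)) :
    reflectV ν (reflectV ν x) = x := by
  rw [← reflectEquiv_apply, ← reflectEquiv_apply]
  exact Submodule.reflection_reflection _ _

lemma inner_reflectV (ν x y : EuclideanSpace ℝ (Fin d)) :
    ⟪reflectV ν x, y⟫ = ⟪x, reflectV ν y⟫ := by
  conv_lhs => rw [← reflectV_reflectV ν y]
  simp only [← reflectEquiv_apply, LinearIsometryEquiv.inner_map_map]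

lemma norm_reflectV (ν x : EuclideanSpace ℝ (Fin d)) : ‖reflectV ν x‖ = ‖x‖ := by
  rw [← reflectEquiv_apply, LinearIsometryEquiv.norm_map]

lemma reflectV_neg (ν x : EuclideanSpace ℝ (Fin d)) : reflectV ν (-x) = -reflectV ν x := by
  simp only [← reflectEquiv_apply, map_neg]

lemma reflectV_smul (ν : EuclideanSpace ℝ (Fin d)) (r : ℝ) (x : EuclideanSpace ℝ (Fin d)) :
    reflectV ν (r • x) = r • reflectV ν x := by
  simp only [← reflectEquiv_apply, map_smul]

lemma neg_reflectV (ν x : EuclideanSpace ℝ (Fin d)) : reflectV (-ν) x = reflectV ν x := by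
  simp [reflectV, neg_div]

lemma reflectV_self {ν : EuclideanSpace ℝ (Fin d)} : reflectV ν ν = -ν := by
  rw [← reflectEquiv_apply]
  exact Submodule.reflection_orthogonalComplement_singleton_eq_neg ν

lemma reflectV_of_inner_eq_zero {ν x : EuclideanSpace ℝ (Fin d)} (h : ⟪x, ν⟫ = 0) :
    reflectV ν x = x := by
  simp [reflectV, h]

lemma inner_reflectV_self (ν x : EuclideanSpace ℝ (Fin d)) :
    ⟪reflectV ν x, ν⟫ = -⟪x, ν⟫ := by
  rw [inner_reflectV, reflectV_self, inner_neg_right]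

/-- Reflections are conjugated by reflections. -/
lemma reflectV_conj (μ ν x : EuclideanSpace ℝ (Fin d)) :
    reflectV μ (reflectV ν x) = reflectV (reflectV μ ν) (reflectV μ x) := by
  change _ = reflectV μ x -
    (2 * ⟪reflectV μ x, reflectV μ ν⟫ / ⟪reflectV μ ν, reflectV μ ν⟫ : ℝ) • reflectV μ ν
  have h : reflectV ν x = x - (2 * ⟪x, ν⟫ / ⟪ν, ν⟫ : ℝ) • ν := rfl
  rw [h, ← reflectEquiv_apply, map_sub, map_smul]
  simp only [reflectEquiv_apply]
  simp only [inner_reflectV, reflectV_reflectV]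

lemma integral_comp_reflectV (ν : EuclideanSpace ℝ (Fin d)) (u : EuclideanSpace ℝ (Fin d) → ℝ) :
    ∫ x, u (reflectV ν x) = ∫ x, u x := by
  simp only [← reflectEquiv_apply]
  exact (reflectEquiv ν).measurePreserving.integral_comp
    (reflectEquiv ν).toHomeomorph.measurableEmbedding u

/-- A product over the positive roots of a sign-invariant expression is unchanged when the roots
are reflected. -/
@[to_additive]
lemma prod_reflectV {M : Type*} [CommMonoid M] (hR : IsPosRootSystem Rp) (hκ : IsGInvMult Rp κ)
    {μ : EuclideanSpace ℝ (Fin d)} (hμ : μ ∈ Rp) (Φ : ℝ → EuclideanSpace ℝ (Fin d) → M)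
    (hΦ : ∀ k ν, Φ k (-ν) = Φ k ν) :
    ∏ ν ∈ Rp, Φ (κ ν) (reflectV μ ν) = ∏ ν ∈ Rp, Φ (κ ν) ν := by
  classical
  let τ : EuclideanSpace ℝ (Fin d) → EuclideanSpace ℝ (Fin d) :=
    fun ν => if reflectV μ ν ∈ Rp then reflectV μ ν else -reflectV μ ν
  have hmem : ∀ ν ∈ Rp, τ ν ∈ Rp := by
    intro ν hν
    by_cases h : reflectV μ ν ∈ Rp
    · simp [τ, h]
    · simpa [τ, h] using (hR.2.2 μ hμ ν hν).resolve_left h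
  have hinv : ∀ ν ∈ Rp, τ (τ ν) = ν := by
    intro ν hν
    by_cases h : reflectV μ ν ∈ Rp
    · simp [τ, h, reflectV_reflectV, hν]
    · simp [τ, h, reflectV_reflectV, reflectV_neg, hR.2.1 ν hν]
  refine Finset.prod_bij' (fun ν _ => τ ν) (fun ν _ => τ ν) hmem hmem hinv hinv fun ν hν => ?_
  have hk : κ ν = κ (τ ν) := by
    refine hκ.2 μ hμ ν hν _ (hmem ν hν) ?_
    by_cases h : reflectV μ ν ∈ Rp <;> simp [τ, h]
  rw [hk]
  by_cases h : reflectV μ ν ∈ Rp <;> simp [τ, h, hΦ]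

/-- The complement of the walls is invariant under the reflections. -/
lemma inner_reflectV_ne_zero (hR : IsPosRootSystem Rp) {μ : EuclideanSpace ℝ (Fin d)}
    (hμ : μ ∈ Rp) {x : EuclideanSpace ℝ (Fin d)} (hx : ∀ ν ∈ Rp, ⟪x, ν⟫ ≠ 0) :
    ∀ ν ∈ Rp, ⟪reflectV μ x, ν⟫ ≠ 0 := by
  intro ν hν
  rw [inner_reflectV]
  rcases hR.2.2 μ hμ ν hν with h | h
  · exact hx _ h
  · simpa using hx _ h

lemma ae_inner_ne_zero (hR : IsPosRootSystem Rp) :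
    ∀ᵐ x : EuclideanSpace ℝ (Fin d), ∀ ν ∈ Rp, ⟪x, ν⟫ ≠ 0 := by
  refine (Finset.eventually_all Rp).2 fun ν hν => ?_
  have h : volume ((Submodule.span ℝ {ν})ᗮ : Set (EuclideanSpace ℝ (Fin d))) = 0 := by
    refine Measure.addHaar_submodule _ _ fun htop => hR.1 ν hν ?_
    have : ν ∈ (Submodule.span ℝ {ν})ᗮ := htop ▸ Submodule.mem_top
    simpa [Submodule.mem_orthogonal_singleton_iff_inner_right] using this
  rw [ae_iff]
  convert h using 2
  ext x
  simp [Submodule.mem_orthogonal_singleton_iff_inner_left]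

lemma isOpen_inner_ne_zero :
    IsOpen {x : EuclideanSpace ℝ (Fin d) | ∀ ν ∈ Rp, ⟪x, ν⟫ ≠ 0} := by
  simp only [Set.ofPred_forall]
  exact isOpen_biInter_finset fun ν _ => isOpen_ne_fun (by fun_prop) continuous_const

end Reflections

section PolynomialFunctions

variable {d : ℕ}

/-- The algebra of polynomial functions on Euclidean space. -/
def polyFun (d : ℕ) : Subalgebra ℝ (EuclideanSpace ℝ (Fin d) → ℝ) :=
  Algebra.adjoin ℝ (Set.range fun (i : Fin d) (x : EuclideanSpace ℝ (Fin d)) => x i)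

lemma coord_mem_polyFun (i : Fin d) :
    (fun x : EuclideanSpace ℝ (Fin d) => x i) ∈ polyFun d :=
  Algebra.subset_adjoin ⟨i, rfl⟩

lemma const_mem_polyFun (c : ℝ) : (fun _ : EuclideanSpace ℝ (Fin d) => c) ∈ polyFun d :=
  (polyFun d).algebraMap_mem c

lemma inner_mem_polyFun (v : EuclideanSpace ℝ (Fin d)) :
    (fun x : EuclideanSpace ℝ (Fin d) => ⟪x, v⟫) ∈ polyFun d := by
  have h : (fun x : EuclideanSpace ℝ (Fin d) => ⟪x, v⟫) =
      ∑ i, (fun _ => v i) * (fun x : EuclideanSpace ℝ (Fin d) => x i) := by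
    ext x
    simp [PiLp.inner_apply]
  rw [h]
  exact sum_mem fun i _ => mul_mem (const_mem_polyFun _) (coord_mem_polyFun i)

lemma mem_polyFun_of_eval {f : EuclideanSpace ℝ (Fin d) → ℝ} {P : MvPolynomial (Fin d) ℝ}
    (h : ∀ x, f x = MvPolynomial.eval (fun i => x i) P) : f ∈ polyFun d := by
  obtain rfl : f = fun x => MvPolynomial.eval (fun i => x i) P := funext h
  clear h
  induction P using MvPolynomial.induction_on with
  | C a => simpa using const_mem_polyFun a
  | add p q hp hq => simpa using! add_mem hp hq
  | mul_X p i hp => simpa using! mul_mem hp (coord_mem_polyFun i)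

variable {u : EuclideanSpace ℝ (Fin d) → ℝ}

lemma differentiable_of_mem_polyFun (hu : u ∈ polyFun d) : Differentiable ℝ u := by
  induction hu using Algebra.adjoin_induction with
  | mem u hu =>
    obtain ⟨i, rfl⟩ := hu
    fun_prop
  | algebraMap r => exact differentiable_const r
  | add u v _ _ hu hv => exact hu.add hv
  | mul u v _ _ hu hv => exact hu.mul hv

lemma continuous_of_mem_polyFun (hu : u ∈ polyFun d) : Continuous u :=
  (differentiable_of_mem_polyFun hu).continuous

lemma fderiv_mem_polyFun (hu : u ∈ polyFun d) (v : EuclideanSpace ℝ (Fin d)) :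
    (fun x => fderiv ℝ u x v) ∈ polyFun d := by
  induction hu using Algebra.adjoin_induction with
  | mem u hu =>
    obtain ⟨i, rfl⟩ := hu
    have h : ∀ x, fderiv ℝ (fun x : EuclideanSpace ℝ (Fin d) => x i) x v = v i := fun x => by
      rw [show (fun x : EuclideanSpace ℝ (Fin d) => x i) = EuclideanSpace.proj (𝕜 := ℝ) i from rfl,
        ContinuousLinearMap.fderiv]
      rfl
    simpa only [h] using const_mem_polyFun (v i)
  | algebraMap r =>
    have h : ∀ x, fderiv ℝ (algebraMap ℝ (EuclideanSpace ℝ (Fin d) → ℝ) r) x v = 0 := fun x => by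
      rw [show algebraMap ℝ (EuclideanSpace ℝ (Fin d) → ℝ) r = fun _ => r from rfl]
      simp
    simpa only [h] using const_mem_polyFun 0
  | add u w hu hw ihu ihw =>
    have h : (fun x => fderiv ℝ (u + w) x v) =
        (fun x => fderiv ℝ u x v) + fun x => fderiv ℝ w x v := by
      ext x
      rw [fderiv_add (differentiable_of_mem_polyFun hu x) (differentiable_of_mem_polyFun hw x)]
      rfl
    exact h ▸ add_mem ihu ihw
  | mul u w hu hw ihu ihw =>
    have h : (fun x => fderiv ℝ (u * w) x v) =
        u * (fun x => fderiv ℝ w x v) + w * fun x => fderiv ℝ u x v := by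
      ext x
      rw [fderiv_mul (differentiable_of_mem_polyFun hu x) (differentiable_of_mem_polyFun hw x)]
      rfl
    exact h ▸ add_mem (mul_mem hu ihw) (mul_mem hw ihu)

lemma comp_reflectV_mem_polyFun (hu : u ∈ polyFun d) (ν : EuclideanSpace ℝ (Fin d)) :
    (fun x => u (reflectV ν x)) ∈ polyFun d := by
  induction hu using Algebra.adjoin_induction with
  | mem u hu =>
    obtain ⟨i, rfl⟩ := hu
    convert sub_mem (coord_mem_polyFun i)
      (mul_mem (inner_mem_polyFun ν) (const_mem_polyFun (2 / ⟪ν, ν⟫ * ν i))) using 1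
    ext x
    simp [reflectV]
    ring
  | algebraMap r => exact const_mem_polyFun r
  | add u w _ _ ihu ihw => exact add_mem ihu ihw
  | mul u w _ _ ihu ihw => exact mul_mem ihu ihw

/-- The difference of a polynomial and its reflection is divisible by the linear form of the
wall. -/
lemma exists_divided_difference (hu : u ∈ polyFun d) (ν : EuclideanSpace ℝ (Fin d)) :
    ∃ D ∈ polyFun d, ∀ x, u x - u (reflectV ν x) = ⟪x, ν⟫ * D x := by
  induction hu using Algebra.adjoin_induction with
  | mem u hu =>
    obtain ⟨i, rfl⟩ := hu
    refine ⟨_, const_mem_polyFun (2 / ⟪ν, ν⟫ * ν i), fun x => ?_⟩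
    simp [reflectV]
    ring
  | algebraMap r => exact ⟨_, const_mem_polyFun 0, fun x => by simp⟩
  | add u w _ _ ihu ihw =>
    obtain ⟨D, hD, hDu⟩ := ihu
    obtain ⟨D', hD', hDw⟩ := ihw
    refine ⟨_, add_mem hD hD', fun x => ?_⟩
    simp only [Pi.add_apply]
    linear_combination hDu x + hDw x
  | mul u w hu hw ihu ihw =>
    obtain ⟨D, hD, hDu⟩ := ihu
    obtain ⟨D', hD', hDw⟩ := ihw
    refine ⟨_, add_mem (mul_mem hu hD') (mul_mem hD (comp_reflectV_mem_polyFun hw ν)),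
      fun x => ?_⟩
    simp only [Pi.add_apply, Pi.mul_apply]
    linear_combination u x * hDw x + w (reflectV ν x) * hDu x

lemma exists_bound_of_mem_polyFun (hu : u ∈ polyFun d) :
    ∃ C : ℝ, ∃ k : ℕ, 0 ≤ C ∧ ∀ x, |u x| ≤ C * (1 + ‖x‖) ^ k := by
  induction hu using Algebra.adjoin_induction with
  | mem u hu =>
    obtain ⟨i, rfl⟩ := hu
    refine ⟨1, 1, zero_le_one, fun x => ?_⟩
    have := PiLp.norm_apply_le x i
    rw [Real.norm_eq_abs] at this
    simp only
    linarith
  | algebraMap r => exact ⟨|r|, 0, abs_nonneg r, fun x => by simp⟩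
  | add u w _ _ ihu ihw =>
    obtain ⟨C, k, hC, hu⟩ := ihu
    obtain ⟨C', k', hC', hw⟩ := ihw
    refine ⟨C + C', k + k', by positivity, fun x => ?_⟩
    have h1 : 1 ≤ 1 + ‖x‖ := by linarith [norm_nonneg x]
    calc |u x + w x| ≤ |u x| + |w x| := abs_add_le _ _
      _ ≤ C * (1 + ‖x‖) ^ k + C' * (1 + ‖x‖) ^ k' := add_le_add (hu x) (hw x)
      _ ≤ C * (1 + ‖x‖) ^ (k + k') + C' * (1 + ‖x‖) ^ (k + k') := by
        gcongr <;> first | exact h1 | omega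
      _ = _ := by ring
  | mul u w _ _ ihu ihw =>
    obtain ⟨C, k, hC, hu⟩ := ihu
    obtain ⟨C', k', hC', hw⟩ := ihw
    refine ⟨C * C', k + k', by positivity, fun x => ?_⟩
    calc |u x * w x| = |u x| * |w x| := abs_mul _ _
      _ ≤ (C * (1 + ‖x‖) ^ k) * (C' * (1 + ‖x‖) ^ k') :=
        mul_le_mul (hu x) (hw x) (abs_nonneg _) (by positivity)
      _ = _ := by ring

lemma integrable_exp_neg_mul_norm_sq {b : ℝ} (hb : 0 < b) :
    Integrable fun x : EuclideanSpace ℝ (Fin d) => Real.exp (-b * ‖x‖ ^ 2) := by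
  have h := (GaussianFourier.integrable_cexp_neg_mul_sq_norm_add (b := b) (by simpa using hb) 0
    (0 : EuclideanSpace ℝ (Fin d))).re
  refine h.congr (Filter.Eventually.of_forall fun x => ?_)
  simp only [zero_mul, add_zero]
  rw [show (-(b : ℂ) * (‖x‖ : ℂ) ^ 2) = ((-b * ‖x‖ ^ 2 : ℝ) : ℂ) by push_cast; ring,
    ← Complex.ofReal_exp]
  exact Complex.ofReal_re _

lemma integrable_mul_gaussian (hu : u ∈ polyFun d) :
    Integrable fun x => u x * Real.exp (-(‖x‖ ^ 2 / 2)) := by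
  obtain ⟨C, k, hC, hb⟩ := exists_bound_of_mem_polyFun hu
  have hc := continuous_of_mem_polyFun hu
  refine ((integrable_exp_neg_mul_norm_sq (d := d) (b := 1 / 4) (by norm_num)).const_mul
    (C * (k.factorial * Real.exp 2))).mono' (by fun_prop) (Filter.Eventually.of_forall fun x => ?_)
  have h1 : (1 + ‖x‖) ^ k ≤ k.factorial * Real.exp (2 + ‖x‖ ^ 2 / 4) := by
    have h2 := Real.pow_div_factorial_le_exp (x := 1 + ‖x‖) (by positivity) k
    rw [div_le_iff₀' (by positivity)] at h2
    refine h2.trans ?_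
    exact mul_le_mul_of_nonneg_left
      (Real.exp_le_exp.2 (by nlinarith [sq_nonneg (‖x‖ - 2)])) (by positivity)
  rw [Real.norm_eq_abs, abs_mul, Real.abs_exp]
  calc |u x| * Real.exp (-(‖x‖ ^ 2 / 2))
      ≤ (C * (k.factorial * Real.exp (2 + ‖x‖ ^ 2 / 4))) * Real.exp (-(‖x‖ ^ 2 / 2)) := by
        gcongr
        exact (hb x).trans (by gcongr)
    _ = C * (k.factorial * Real.exp 2) * Real.exp (-(1 / 4) * ‖x‖ ^ 2) := by
        rw [Real.exp_add, show -(‖x‖ ^ 2 / 2) = -(1 / 4) * ‖x‖ ^ 2 + -(‖x‖ ^ 2 / 4) by ring,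
          Real.exp_add, Real.exp_neg (‖x‖ ^ 2 / 4)]
        field_simp

end PolynomialFunctions

section Weight

variable {d : ℕ} {Rp : Finset (EuclideanSpace ℝ (Fin d))} {κ : EuclideanSpace ℝ (Fin d) → ℝ}

/-- The Gaussian density times the regularisation `∏ (⟨x,ν⟩² + ε)^κ(ν)` of the weight `h_κ²`. -/
def gaussWeight (Rp : Finset (EuclideanSpace ℝ (Fin d))) (κ : EuclideanSpace ℝ (Fin d) → ℝ)
    (ε : ℝ) (x : EuclideanSpace ℝ (Fin d)) : ℝ :=
  (∏ ν ∈ Rp, (⟪x, ν⟫ ^ 2 + ε) ^ (κ ν)) * Real.exp (-(‖x‖ ^ 2 / 2))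

lemma gaussWeight_zero (x : EuclideanSpace ℝ (Fin d)) :
    gaussWeight Rp κ 0 x = hk2 Rp κ x * Real.exp (-(‖x‖ ^ 2 / 2)) := by
  rw [gaussWeight, hk2, ← Finset.prod_pow]
  congr 1
  refine Finset.prod_congr rfl fun ν _ => ?_
  rw [add_zero, ← sq_abs, Real.rpow_pow_comm (abs_nonneg _)]

lemma gaussWeight_reflectV (hR : IsPosRootSystem Rp) (hκ : IsGInvMult Rp κ)
    {μ : EuclideanSpace ℝ (Fin d)} (hμ : μ ∈ Rp) (ε : ℝ) (x : EuclideanSpace ℝ (Fin d)) :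
    gaussWeight Rp κ ε (reflectV μ x) = gaussWeight Rp κ ε x := by
  simp only [gaussWeight, norm_reflectV, inner_reflectV]
  rw [prod_reflectV hR hκ hμ (fun k ν => (⟪x, ν⟫ ^ 2 + ε) ^ k) (by simp)]

lemma gaussWeight_nonneg {ε : ℝ} (hε : 0 ≤ ε) (x : EuclideanSpace ℝ (Fin d)) :
    0 ≤ gaussWeight Rp κ ε x :=
  mul_nonneg (Finset.prod_nonneg fun _ _ => by positivity) (Real.exp_pos _).le

lemma gaussWeight_le_one (hκ : IsGInvMult Rp κ) {ε : ℝ} (hε : 0 ≤ ε) (hε1 : ε ≤ 1)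
    (x : EuclideanSpace ℝ (Fin d)) : gaussWeight Rp κ ε x ≤ gaussWeight Rp κ 1 x := by
  refine mul_le_mul_of_nonneg_right ?_ (Real.exp_pos _).le
  refine Finset.prod_le_prod (fun _ _ => by positivity) fun ν hν => ?_
  exact Real.rpow_le_rpow (by positivity) (by linarith) (hκ.1 ν hν)

lemma continuous_gaussWeight (hκ : IsGInvMult Rp κ) (ε : ℝ) :
    Continuous (gaussWeight Rp κ ε) := by
  refine (continuous_finsetProd _ fun ν hν => ?_).mul (by fun_prop)
  exact Continuous.rpow_const (by fun_prop) fun _ => Or.inr (hκ.1 ν hν)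

lemma tendsto_gaussWeight (hκ : IsGInvMult Rp κ) (x : EuclideanSpace ℝ (Fin d)) :
    Filter.Tendsto (fun ε => gaussWeight Rp κ ε x) (nhdsWithin 0 (Set.Ioi 0))
      (nhds (gaussWeight Rp κ 0 x)) := by
  have h : Continuous fun ε => gaussWeight Rp κ ε x := by
    refine (continuous_finsetProd _ fun ν hν => ?_).mul continuous_const
    exact Continuous.rpow_const (by fun_prop) fun _ => Or.inr (hκ.1 ν hν)
  exact (h.tendsto 0).mono_left nhdsWithin_le_nhds

variable {u : EuclideanSpace ℝ (Fin d) → ℝ}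

lemma integrable_mul_gaussWeight_one (hu : u ∈ polyFun d) :
    Integrable fun x => u x * gaussWeight Rp κ 1 x := by
  have hQ : (∏ ν ∈ Rp, ((fun x => ⟪x, ν⟫) ^ 2 + fun _ => (1 : ℝ)) ^ ⌈κ ν⌉₊) ∈ polyFun d :=
    prod_mem fun ν _ => pow_mem (add_mem (pow_mem (inner_mem_polyFun ν) 2)
      (const_mem_polyFun 1)) _
  have hc := continuous_of_mem_polyFun hu
  have hcw : Continuous (gaussWeight Rp κ 1) := by
    refine (continuous_finsetProd _ fun ν hν => ?_).mul (by fun_prop)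
    exact Continuous.rpow_const (by fun_prop) fun _ => Or.inl (by positivity)
  refine (integrable_mul_gaussian (mul_mem hu hQ)).mono (by fun_prop)
    (Filter.Eventually.of_forall fun x => ?_)
  simp only [Pi.mul_apply, mul_assoc, norm_mul, gaussWeight]
  refine mul_le_mul_of_nonneg_left (mul_le_mul_of_nonneg_right ?_ (norm_nonneg _)) (norm_nonneg _)
  simp only [Finset.prod_apply, norm_prod, Pi.pow_apply, Pi.add_apply]
  refine Finset.prod_le_prod (fun _ _ => norm_nonneg _) fun ν _ => ?_
  have h1 : 1 ≤ ⟪x, ν⟫ ^ 2 + 1 := by nlinarith [sq_nonneg ⟪x, ν⟫]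
  rw [Real.norm_of_nonneg (by positivity), Real.norm_of_nonneg (by positivity),
    ← Real.rpow_natCast _ ⌈κ ν⌉₊]
  exact Real.rpow_le_rpow_of_exponent_le h1 (Nat.le_ceil _)

lemma integrable_mul_gaussWeight (hκ : IsGInvMult Rp κ) (hu : u ∈ polyFun d) {ε : ℝ}
    (hε : 0 ≤ ε) (hε1 : ε ≤ 1) : Integrable fun x => u x * gaussWeight Rp κ ε x := by
  have hc := continuous_of_mem_polyFun hu
  have hcw := continuous_gaussWeight hκ ε
  refine (integrable_mul_gaussWeight_one (Rp := Rp) (κ := κ) hu).mono (by fun_prop)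
    (Filter.Eventually.of_forall fun x => ?_)
  simp only [norm_mul]
  refine mul_le_mul_of_nonneg_left ?_ (norm_nonneg _)
  rw [Real.norm_of_nonneg (gaussWeight_nonneg hε x),
    Real.norm_of_nonneg (gaussWeight_nonneg zero_le_one x)]
  exact gaussWeight_le_one hκ hε hε1 x

lemma hasFDerivAt_gaussWeight {ε : ℝ} (hε : 0 < ε) (x : EuclideanSpace ℝ (Fin d)) :
    HasFDerivAt (gaussWeight Rp κ ε)
      (gaussWeight Rp κ ε x •
        (∑ ν ∈ Rp, (κ ν * (2 * ⟪x, ν⟫ / (⟪x, ν⟫ ^ 2 + ε))) • innerSL ℝ ν - innerSL ℝ x)) x := by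
  have hexp : gaussWeight Rp κ ε = fun x =>
      Real.exp (∑ ν ∈ Rp, κ ν * Real.log (⟪x, ν⟫ ^ 2 + ε) - ‖x‖ ^ 2 / 2) := by
    ext x
    rw [gaussWeight, sub_eq_add_neg, Real.exp_add, Real.exp_sum]
    congr 1
    refine Finset.prod_congr rfl fun ν _ => ?_
    rw [Real.rpow_def_of_pos (by positivity), mul_comm]
  have hlin : ∀ ν, HasFDerivAt (fun x : EuclideanSpace ℝ (Fin d) => ⟪x, ν⟫) (innerSL ℝ ν) x := by
    intro ν
    simp only [real_inner_comm ν]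
    exact (innerSL ℝ ν).hasFDerivAt
  have hlog : ∀ ν ∈ Rp, HasFDerivAt (fun x => κ ν * Real.log (⟪x, ν⟫ ^ 2 + ε))
      ((κ ν * (2 * ⟪x, ν⟫ / (⟪x, ν⟫ ^ 2 + ε))) • innerSL ℝ ν) x := by
    intro ν _
    have h := ((((hlin ν).pow 2).add_const ε).log (by positivity)).const_mul (κ ν)
    refine h.congr_fderiv ?_
    ext y
    simp
    ring
  have hnorm : HasFDerivAt (fun x : EuclideanSpace ℝ (Fin d) => ‖x‖ ^ 2 / 2) (innerSL ℝ x) x := by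
    have h := (hasStrictFDerivAt_norm_sq x).hasFDerivAt.mul_const (2⁻¹ : ℝ)
    simp only [div_eq_mul_inv]
    refine h.congr_fderiv ?_
    ext y
    simp
  have h := ((HasFDerivAt.fun_sum hlog).sub hnorm).exp
  rw [hexp]
  exact h

end Weight

section Divergence

variable {d : ℕ} {Rp : Finset (EuclideanSpace ℝ (Fin d))} {κ : EuclideanSpace ℝ (Fin d) → ℝ}
  {u : EuclideanSpace ℝ (Fin d) → ℝ} {D : EuclideanSpace ℝ (Fin d) → EuclideanSpace ℝ (Fin d) → ℝ}

lemma integrable_inv_mul_gaussWeight (hκ : IsGInvMult Rp κ) (hu : u ∈ polyFun d) {ε : ℝ}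
    (hε : 0 < ε) (hε1 : ε ≤ 1) (ν : EuclideanSpace ℝ (Fin d)) :
    Integrable fun x => (⟪x, ν⟫ ^ 2 + ε)⁻¹ * (u x * gaussWeight Rp κ ε x) := by
  have hc : Continuous fun x : EuclideanSpace ℝ (Fin d) => (⟪x, ν⟫ ^ 2 + ε)⁻¹ :=
    Continuous.inv₀ (by fun_prop) fun x => by positivity
  refine (integrable_mul_gaussWeight hκ hu hε.le hε1).bdd_mul (c := ε⁻¹)
    hc.aestronglyMeasurable (Filter.Eventually.of_forall fun x => ?_)
  rw [Real.norm_of_nonneg (by positivity)]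
  gcongr
  nlinarith [sq_nonneg ⟪x, ν⟫]

/-- Antisymmetrisation of the singular part of the logarithmic derivative of the weight. -/
lemma integral_antisymm (hR : IsPosRootSystem Rp) (hκ : IsGInvMult Rp κ) (hu : u ∈ polyFun d)
    {D : EuclideanSpace ℝ (Fin d) → ℝ} {ν : EuclideanSpace ℝ (Fin d)} (hν : ν ∈ Rp)
    (hDu : ∀ x, u x - u (reflectV ν x) = ⟪x, ν⟫ * D x) {ε : ℝ} (hε : 0 < ε) (hε1 : ε ≤ 1) :
    ∫ x, u x * (2 * ⟪x, ν⟫ / (⟪x, ν⟫ ^ 2 + ε)) * gaussWeight Rp κ ε x =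
      ∫ x, ⟪x, ν⟫ ^ 2 / (⟪x, ν⟫ ^ 2 + ε) * D x * gaussWeight Rp κ ε x := by
  have hint : ∀ w ∈ polyFun d,
      Integrable fun x => w x * (⟪x, ν⟫ / (⟪x, ν⟫ ^ 2 + ε)) * gaussWeight Rp κ ε x := by
    intro w hw
    refine (integrable_inv_mul_gaussWeight hκ (mul_mem hw (inner_mem_polyFun ν)) hε hε1 ν).congr
      (Filter.Eventually.of_forall fun x => ?_)
    simp only [Pi.mul_apply]
    ring
  have hodd : ∫ x, u x * (⟪x, ν⟫ / (⟪x, ν⟫ ^ 2 + ε)) * gaussWeight Rp κ ε x =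
      -∫ x, u (reflectV ν x) * (⟪x, ν⟫ / (⟪x, ν⟫ ^ 2 + ε)) * gaussWeight Rp κ ε x := by
    rw [← integral_comp_reflectV ν, ← integral_neg]
    refine integral_congr_ae (Filter.Eventually.of_forall fun x => ?_)
    simp only [inner_reflectV_self, gaussWeight_reflectV hR hκ hν]
    ring
  calc _ = (∫ x, u x * (⟪x, ν⟫ / (⟪x, ν⟫ ^ 2 + ε)) * gaussWeight Rp κ ε x) +
        ∫ x, u x * (⟪x, ν⟫ / (⟪x, ν⟫ ^ 2 + ε)) * gaussWeight Rp κ ε x := by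
        rw [← integral_add (hint u hu) (hint u hu)]
        exact integral_congr_ae (Filter.Eventually.of_forall fun x => by ring)
    _ = (∫ x, u x * (⟪x, ν⟫ / (⟪x, ν⟫ ^ 2 + ε)) * gaussWeight Rp κ ε x) -
        ∫ x, u (reflectV ν x) * (⟪x, ν⟫ / (⟪x, ν⟫ ^ 2 + ε)) * gaussWeight Rp κ ε x := by
        conv_lhs => enter [2]; rw [hodd]
        ring
    _ = _ := by
        rw [← integral_sub (hint u hu) (hint _ (comp_reflectV_mem_polyFun hu ν))]
        refine integral_congr_ae (Filter.Eventually.of_forall fun x => ?_)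
        simp only
        rw [← sub_mul, ← sub_mul, hDu]
        ring

lemma integral_divergence_regularised (hR : IsPosRootSystem Rp) (hκ : IsGInvMult Rp κ)
    (hu : u ∈ polyFun d) (hD : ∀ ν, D ν ∈ polyFun d)
    (hDu : ∀ ν x, u x - u (reflectV ν x) = ⟪x, ν⟫ * D ν x) (j : Fin d)
    {ε : ℝ} (hε : 0 < ε) (hε1 : ε ≤ 1) :
    ∫ x, (fderiv ℝ u x (EuclideanSpace.single j 1) +
      ∑ ν ∈ Rp, κ ν * ν j * (⟪x, ν⟫ ^ 2 / (⟪x, ν⟫ ^ 2 + ε) * D ν x) - x j * u x) *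
        gaussWeight Rp κ ε x = 0 := by
  set W := gaussWeight Rp κ ε with hW
  have hI : ∀ w ∈ polyFun d, Integrable fun x => w x * W x := fun w hw =>
    integrable_mul_gaussWeight hκ hw hε.le hε1
  have hI' : ∀ w ∈ polyFun d, ∀ ν, Integrable fun x => (⟪x, ν⟫ ^ 2 + ε)⁻¹ * (w x * W x) :=
    fun w hw => integrable_inv_mul_gaussWeight hκ hw hε hε1
  have hder : ∀ x, fderiv ℝ W x (EuclideanSpace.single j 1) =
      (∑ ν ∈ Rp, κ ν * ν j * (2 * ⟪x, ν⟫ / (⟪x, ν⟫ ^ 2 + ε)) - x j) * W x := by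
    intro x
    rw [(hasFDerivAt_gaussWeight hε x).fderiv]
    simp only [smul_apply, sub_apply,
      _root_.sum_apply, innerSL_apply_apply, smul_eq_mul,
      EuclideanSpace.inner_single_right]
    simp only [one_mul, conj_trivial]
    rw [mul_comm]
    congr 2
    exact Finset.sum_congr rfl fun ν _ => by ring
  have hxu := hI _ (mul_mem (coord_mem_polyFun j) hu)
  have hA : ∀ ν, Integrable fun x => u x * (2 * ⟪x, ν⟫ / (⟪x, ν⟫ ^ 2 + ε)) * W x := by
    intro ν
    refine ((hI' _ (mul_mem hu (inner_mem_polyFun ν)) ν).const_mul 2).congr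
      (Filter.Eventually.of_forall fun x => ?_)
    simp only [Pi.mul_apply]
    ring
  have hB : ∀ ν, Integrable fun x => ⟪x, ν⟫ ^ 2 / (⟪x, ν⟫ ^ 2 + ε) * D ν x * W x := by
    intro ν
    refine (hI' _ (mul_mem (hD ν) (pow_mem (inner_mem_polyFun ν) 2)) ν).congr
      (Filter.Eventually.of_forall fun x => ?_)
    simp only [Pi.mul_apply, Pi.pow_apply]
    ring
  have hAs : Integrable fun x =>
      ∑ ν ∈ Rp, κ ν * ν j * (u x * (2 * ⟪x, ν⟫ / (⟪x, ν⟫ ^ 2 + ε)) * W x) :=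
    integrable_finsetSum _ fun ν _ => (hA ν).const_mul _
  have hBs : Integrable fun x =>
      ∑ ν ∈ Rp, κ ν * ν j * (⟪x, ν⟫ ^ 2 / (⟪x, ν⟫ ^ 2 + ε) * D ν x * W x) :=
    integrable_finsetSum _ fun ν _ => (hB ν).const_mul _
  have hsum : ∫ x, ∑ ν ∈ Rp, κ ν * ν j * (u x * (2 * ⟪x, ν⟫ / (⟪x, ν⟫ ^ 2 + ε)) * W x) =
      ∫ x, ∑ ν ∈ Rp, κ ν * ν j * (⟪x, ν⟫ ^ 2 / (⟪x, ν⟫ ^ 2 + ε) * D ν x * W x) := by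
    rw [integral_finsetSum _ fun ν _ => (hA ν).const_mul _,
      integral_finsetSum _ fun ν _ => (hB ν).const_mul _]
    refine Finset.sum_congr rfl fun ν hν => ?_
    rw [integral_const_mul, integral_const_mul,
      integral_antisymm hR hκ hu hν (hDu ν) hε hε1]
  have hsplit : ∀ x, u x * fderiv ℝ W x (EuclideanSpace.single j 1) =
      ∑ ν ∈ Rp, κ ν * ν j * (u x * (2 * ⟪x, ν⟫ / (⟪x, ν⟫ ^ 2 + ε)) * W x) -
        ((fun x : EuclideanSpace ℝ (Fin d) => x j) * u) x * W x := by
    intro x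
    rw [hder, sub_mul, mul_sub, Finset.sum_mul, Finset.mul_sum]
    simp only [Pi.mul_apply]
    congr 1
    · exact Finset.sum_congr rfl fun ν _ => by ring
    · ring
  have hparts := integral_mul_fderiv_eq_neg_fderiv_mul_of_integrable (μ := volume)
    (v := EuclideanSpace.single j (1 : ℝ))
    (hI _ (fderiv_mem_polyFun hu (EuclideanSpace.single j 1)))
    (by simp only [hsplit]; exact hAs.sub hxu) (hI u hu)
    (fun x _ => differentiable_of_mem_polyFun hu x)
    (fun x _ => (hasFDerivAt_gaussWeight hε x).differentiableAt)
  simp only [hsplit] at hparts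
  rw [integral_sub hAs hxu, hsum] at hparts
  calc _ = ∫ x, (fderiv ℝ u x (EuclideanSpace.single j 1) * W x +
        ∑ ν ∈ Rp, κ ν * ν j * (⟪x, ν⟫ ^ 2 / (⟪x, ν⟫ ^ 2 + ε) * D ν x * W x)) -
        ((fun x : EuclideanSpace ℝ (Fin d) => x j) * u) x * W x := by
        refine integral_congr_ae (Filter.Eventually.of_forall fun x => ?_)
        simp only [Pi.mul_apply, sub_mul, add_mul, Finset.sum_mul, mul_assoc]
    _ = 0 := by
        have hF := hI _ (fderiv_mem_polyFun hu (EuclideanSpace.single j 1))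
        rw [integral_sub (hF.fun_add hBs) hxu, integral_add hF hBs]
        linarith

lemma dunklT_eq (hDu : ∀ ν x, u x - u (reflectV ν x) = ⟪x, ν⟫ * D ν x) (j : Fin d)
    {x : EuclideanSpace ℝ (Fin d)} (hx : ∀ ν ∈ Rp, ⟪x, ν⟫ ≠ 0) :
    dunklT Rp κ j u x =
      fderiv ℝ u x (EuclideanSpace.single j 1) + ∑ ν ∈ Rp, κ ν * ν j * D ν x := by
  rw [dunklT]
  congr 1
  refine Finset.sum_congr rfl fun ν hν => ?_
  rw [hDu, mul_div_cancel_left₀ _ (hx ν hν)]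

/-- Away from the walls, Dunkl operators map polynomials to polynomials. -/
lemma exists_dunklT_eq (Rp : Finset (EuclideanSpace ℝ (Fin d)))
    (κ : EuclideanSpace ℝ (Fin d) → ℝ) (hu : u ∈ polyFun d) (j : Fin d) :
    ∃ q ∈ polyFun d, ∀ x, (∀ ν ∈ Rp, ⟪x, ν⟫ ≠ 0) → dunklT Rp κ j u x = q x := by
  choose D hD hDu using exists_divided_difference hu
  refine ⟨_, add_mem (fderiv_mem_polyFun hu (EuclideanSpace.single j 1))
    (sum_mem (t := Rp) fun ν _ => mul_mem (const_mem_polyFun (κ ν * ν j)) (hD ν)), fun x hx => ?_⟩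
  rw [dunklT_eq hDu j hx]
  simp

/-- The Dunkl operators are antisymmetric up to the Gaussian factor. -/
lemma integral_dunklT_sub (hR : IsPosRootSystem Rp) (hκ : IsGInvMult Rp κ)
    (hu : u ∈ polyFun d) (j : Fin d) :
    ∫ x, (dunklT Rp κ j u x - x j * u x) * gaussWeight Rp κ 0 x = 0 := by
  choose D hD hDu using exists_divided_difference hu
  have hmem : Set.Ioc (0 : ℝ) 1 ∈ nhdsWithin 0 (Set.Ioi 0) := Ioc_mem_nhdsGT one_pos
  let F : ℝ → EuclideanSpace ℝ (Fin d) → ℝ := fun ε x =>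
    (fderiv ℝ u x (EuclideanSpace.single j 1) +
      ∑ ν ∈ Rp, κ ν * ν j * (⟪x, ν⟫ ^ 2 / (⟪x, ν⟫ ^ 2 + ε) * D ν x) - x j * u x) *
        gaussWeight Rp κ ε x
  have hlim : Filter.Tendsto (fun ε => ∫ x, F ε x) (nhdsWithin 0 (Set.Ioi 0))
      (nhds (∫ x, (dunklT Rp κ j u x - x j * u x) * gaussWeight Rp κ 0 x)) := by
    refine tendsto_integral_filter_of_dominated_convergence
      (fun x => |fderiv ℝ u x (EuclideanSpace.single j 1) * gaussWeight Rp κ 1 x| +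
        ∑ ν ∈ Rp, |κ ν * ν j| * |D ν x * gaussWeight Rp κ 1 x| +
        |((fun x : EuclideanSpace ℝ (Fin d) => x j) * u) x * gaussWeight Rp κ 1 x|) ?_ ?_ ?_ ?_
    · filter_upwards [hmem] with ε hε
      have h1 := continuous_of_mem_polyFun (fderiv_mem_polyFun hu (EuclideanSpace.single j 1))
      have h2 := continuous_of_mem_polyFun hu
      have h3 := fun ν => continuous_of_mem_polyFun (hD ν)
      have h4 := continuous_gaussWeight hκ ε
      refine Continuous.aestronglyMeasurable ?_
      refine Continuous.mul ((h1.add (continuous_finsetSum _ fun ν _ => ?_)).sub (by fun_prop)) h4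
      refine continuous_const.mul (Continuous.mul (Continuous.div (by fun_prop) (by fun_prop) ?_)
        (h3 ν))
      have := hε.1
      exact fun x => by positivity
    · filter_upwards [hmem] with ε hε
      refine Filter.Eventually.of_forall fun x => ?_
      have hW := gaussWeight_nonneg (Rp := Rp) (κ := κ) hε.1.le x
      have hW1 := gaussWeight_le_one hκ hε.1.le hε.2 x
      simp only [F, norm_mul, abs_mul, Pi.mul_apply, Real.norm_eq_abs,
        abs_of_nonneg (hW.trans hW1), abs_of_nonneg hW, ← mul_assoc]
      rw [← Finset.sum_mul, ← add_mul, ← add_mul]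
      refine mul_le_mul ?_ hW1 hW (by positivity)
      refine (abs_sub _ _).trans (add_le_add ((abs_add_le _ _).trans (add_le_add le_rfl ?_))
        (abs_mul _ _).le)
      refine (Finset.abs_sum_le_sum_abs _ _).trans (Finset.sum_le_sum fun ν _ => ?_)
      rw [abs_mul, abs_mul, abs_mul, mul_assoc _ |⟪x, ν⟫ ^ 2 / (⟪x, ν⟫ ^ 2 + ε)|]
      refine mul_le_mul_of_nonneg_left (mul_le_of_le_one_left (abs_nonneg _) ?_) (by positivity)
      have := hε.1
      rw [abs_of_nonneg (by positivity), div_le_one (by positivity)]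
      linarith
    · have hI : ∀ w ∈ polyFun d, Integrable fun x => |w x * gaussWeight Rp κ 1 x| :=
        fun w hw => (integrable_mul_gaussWeight_one hw).abs
      exact ((hI _ (fderiv_mem_polyFun hu _)).add
        (integrable_finsetSum _ fun ν _ => (hI _ (hD ν)).const_mul _)).add
        (hI _ (mul_mem (coord_mem_polyFun j) hu))
    · filter_upwards [ae_inner_ne_zero hR] with x hx
      rw [dunklT_eq hDu j hx]
      refine Filter.Tendsto.mul (Filter.Tendsto.sub_const (Filter.Tendsto.const_add _ ?_) _)
        (tendsto_gaussWeight hκ x)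
      refine tendsto_finsetSum _ fun ν hν => Filter.Tendsto.const_mul _ ?_
      have hne : ⟪x, ν⟫ ^ 2 + 0 ≠ 0 := by simpa using hx ν hν
      have hc : ContinuousAt (fun ε => ⟪x, ν⟫ ^ 2 / (⟪x, ν⟫ ^ 2 + ε) * D ν x) 0 := by
        fun_prop (disch := exact hne)
      have h := hc.tendsto.mono_left (nhdsWithin_le_nhds (s := Set.Ioi 0))
      rwa [add_zero, div_self (by simpa using hx ν hν), one_mul] at h
  refine tendsto_nhds_unique hlim (tendsto_const_nhds.congr' ?_)
  filter_upwards [hmem] with ε hε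
  exact (integral_divergence_regularised hR hκ hu hD hDu j hε.1 hε.2).symm

end Divergence

section GaussianOrthogonality

variable {d : ℕ} {Rp : Finset (EuclideanSpace ℝ (Fin d))} {κ : EuclideanSpace ℝ (Fin d) → ℝ}
  {u q f g : EuclideanSpace ℝ (Fin d) → ℝ}

lemma dunklT_mul (hu : u ∈ polyFun d) (hq : q ∈ polyFun d) (j : Fin d)
    (x : EuclideanSpace ℝ (Fin d)) :
    dunklT Rp κ j (u * q) x = dunklT Rp κ j u x * q x + u x * dunklT Rp κ j q x -
      ∑ ν ∈ Rp, κ ν * ν j *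
        ((u x - u (reflectV ν x)) * (q x - q (reflectV ν x)) / ⟪x, ν⟫) := by
  simp only [dunklT]
  rw [fderiv_mul (differentiable_of_mem_polyFun hu x) (differentiable_of_mem_polyFun hq x),
    add_mul, mul_add, Finset.sum_mul, Finset.mul_sum]
  have h : ∑ ν ∈ Rp, κ ν * ν j * (((u * q) x - (u * q) (reflectV ν x)) / ⟪x, ν⟫) =
      ∑ ν ∈ Rp, κ ν * ν j * ((u x - u (reflectV ν x)) / ⟪x, ν⟫) * q x +
      ∑ ν ∈ Rp, u x * (κ ν * ν j * ((q x - q (reflectV ν x)) / ⟪x, ν⟫)) -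
      ∑ ν ∈ Rp, κ ν * ν j *
        ((u x - u (reflectV ν x)) * (q x - q (reflectV ν x)) / ⟪x, ν⟫) := by
    rw [← Finset.sum_add_distrib, ← Finset.sum_sub_distrib]
    refine Finset.sum_congr rfl fun ν _ => ?_
    simp only [Pi.mul_apply]
    ring
  rw [h]
  simp only [_root_.add_apply, smul_apply, smul_eq_mul]
  ring

lemma integral_symmetric_quotient_eq_zero (hR : IsPosRootSystem Rp) (hκ : IsGInvMult Rp κ)
    {ν : EuclideanSpace ℝ (Fin d)} (hν : ν ∈ Rp) :
    ∫ x, (u x - u (reflectV ν x)) * (q x - q (reflectV ν x)) / ⟪x, ν⟫ *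
      gaussWeight Rp κ 0 x = 0 := by
  rw [← self_eq_neg, ← integral_neg]
  conv_lhs => rw [← integral_comp_reflectV ν]
  refine integral_congr_ae (Filter.Eventually.of_forall fun x => ?_)
  simp only [inner_reflectV_self, gaussWeight_reflectV hR hκ hν, reflectV_reflectV]
  ring

lemma integrable_gaussWeight_of_eq (hR : IsPosRootSystem Rp) (hκ : IsGInvMult Rp κ)
    (hq : q ∈ polyFun d) (h : ∀ x, (∀ ν ∈ Rp, ⟪x, ν⟫ ≠ 0) → u x = q x) :
    Integrable fun x => u x * gaussWeight Rp κ 0 x := by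
  refine (integrable_mul_gaussWeight hκ hq le_rfl zero_le_one).congr ?_
  filter_upwards [ae_inner_ne_zero hR] with x hx
  rw [h x hx]

/-- Integration by parts for the Dunkl operators. -/
lemma integral_dunklT_mul (hR : IsPosRootSystem Rp) (hκ : IsGInvMult Rp κ)
    (hu : u ∈ polyFun d) (hq : q ∈ polyFun d) (j : Fin d) :
    ∫ x, dunklT Rp κ j u x * q x * gaussWeight Rp κ 0 x =
      ∫ x, u x * (x j * q x - dunklT Rp κ j q x) * gaussWeight Rp κ 0 x := by
  obtain ⟨p, hp, hpu⟩ := exists_dunklT_eq Rp κ hu j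
  obtain ⟨t, ht, htq⟩ := exists_dunklT_eq Rp κ hq j
  choose D hD hDu using exists_divided_difference hu
  have h1 : Integrable fun x => dunklT Rp κ j u x * q x * gaussWeight Rp κ 0 x :=
    integrable_gaussWeight_of_eq hR hκ (mul_mem hp hq) fun x hx => by
      rw [hpu x hx]; rfl
  have h2 : Integrable fun x =>
      u x * (x j * q x - dunklT Rp κ j q x) * gaussWeight Rp κ 0 x :=
    integrable_gaussWeight_of_eq hR hκ
      (mul_mem hu (sub_mem (mul_mem (coord_mem_polyFun j) hq) ht)) fun x hx => by
      rw [htq x hx]; rfl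
  have h3 : ∀ ν ∈ Rp, Integrable fun x => κ ν * ν j *
      ((u x - u (reflectV ν x)) * (q x - q (reflectV ν x)) / ⟪x, ν⟫ *
        gaussWeight Rp κ 0 x) := fun ν hν => by
    refine Integrable.const_mul (integrable_gaussWeight_of_eq hR hκ
      (mul_mem (hD ν) (sub_mem hq (comp_reflectV_mem_polyFun hq ν))) fun x hx => ?_) _
    have := hx ν hν
    rw [hDu]
    simp only [Pi.mul_apply, Pi.sub_apply]
    field_simp
  have h := integral_dunklT_sub hR hκ (mul_mem hu hq) j
  have hsplit : ∀ x, (dunklT Rp κ j (u * q) x - x j * (u * q) x) * gaussWeight Rp κ 0 x =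
      dunklT Rp κ j u x * q x * gaussWeight Rp κ 0 x -
      u x * (x j * q x - dunklT Rp κ j q x) * gaussWeight Rp κ 0 x -
      ∑ ν ∈ Rp, κ ν * ν j *
        ((u x - u (reflectV ν x)) * (q x - q (reflectV ν x)) / ⟪x, ν⟫ *
          gaussWeight Rp κ 0 x) := fun x => by
    rw [dunklT_mul hu hq]
    simp only [← mul_assoc _ _ (gaussWeight Rp κ 0 x), ← Finset.sum_mul, Pi.mul_apply]
    ring
  simp only [hsplit] at h
  have h12 : Integrable fun x => dunklT Rp κ j u x * q x * gaussWeight Rp κ 0 x -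
      u x * (x j * q x - dunklT Rp κ j q x) * gaussWeight Rp κ 0 x := h1.sub h2
  rw [integral_sub h12 (integrable_finsetSum _ h3), integral_sub h1 h2,
    integral_finsetSum _ h3] at h
  have h0 : ∀ ν ∈ Rp, ∫ x, κ ν * ν j *
      ((u x - u (reflectV ν x)) * (q x - q (reflectV ν x)) / ⟪x, ν⟫ *
        gaussWeight Rp κ 0 x) = 0 := fun ν hν => by
    rw [integral_const_mul, integral_symmetric_quotient_eq_zero hR hκ hν, mul_zero]
  rw [Finset.sum_eq_zero h0] at h
  linarith

lemma dunklT_congr (hR : IsPosRootSystem Rp) (j : Fin d) {v w : EuclideanSpace ℝ (Fin d) → ℝ}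
    (h : ∀ x, (∀ ν ∈ Rp, ⟪x, ν⟫ ≠ 0) → v x = w x) {x : EuclideanSpace ℝ (Fin d)}
    (hx : ∀ ν ∈ Rp, ⟪x, ν⟫ ≠ 0) : dunklT Rp κ j v x = dunklT Rp κ j w x := by
  have he : v =ᶠ[nhds x] w := by
    filter_upwards [isOpen_inner_ne_zero.mem_nhds hx] with y hy using h y hy
  rw [dunklT, dunklT, he.fderiv_eq, h x hx]
  congr 1
  refine Finset.sum_congr rfl fun ν hν => ?_
  rw [h _ (inner_reflectV_ne_zero hR hν hx)]

/-- The weak form of the equation `Δ_κ g = 0` with respect to the Gaussian measure. -/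
lemma integral_dunklT_mul_dunklT (hR : IsPosRootSystem Rp) (hκ : IsGInvMult Rp κ)
    (hu : u ∈ polyFun d) (hg : g ∈ polyFun d)
    (hΔ : ∀ x, (∀ ν ∈ Rp, ⟪x, ν⟫ ≠ 0) → ∑ j, dunklT Rp κ j (dunklT Rp κ j g) x = 0) :
    ∫ x, (∑ j, dunklT Rp κ j u x * dunklT Rp κ j g x) * gaussWeight Rp κ 0 x =
      ∫ x, u x * (∑ j, x j * dunklT Rp κ j g x) * gaussWeight Rp κ 0 x := by
  choose p hp hpu using exists_dunklT_eq Rp κ hu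
  choose q hq hqg using exists_dunklT_eq Rp κ hg
  have hqq := fun j => exists_dunklT_eq Rp κ (hq j) j
  choose t ht htq using hqq
  have h1 : ∀ j, Integrable fun x => dunklT Rp κ j u x * q j x * gaussWeight Rp κ 0 x :=
    fun j => integrable_gaussWeight_of_eq hR hκ (mul_mem (hp j) (hq j)) fun x hx => by
      rw [hpu j x hx]; rfl
  have h2 : ∀ j, Integrable fun x =>
      u x * (x j * q j x - dunklT Rp κ j (q j) x) * gaussWeight Rp κ 0 x :=
    fun j => integrable_gaussWeight_of_eq hR hκ
      (mul_mem hu (sub_mem (mul_mem (coord_mem_polyFun j) (hq j)) (ht j))) fun x hx => by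
      rw [htq j x hx]; rfl
  calc _ = ∫ x, ∑ j, dunklT Rp κ j u x * q j x * gaussWeight Rp κ 0 x := by
        refine integral_congr_ae ?_
        filter_upwards [ae_inner_ne_zero hR] with x hx
        rw [Finset.sum_mul]
        exact Finset.sum_congr rfl fun j _ => by rw [hqg j x hx]
    _ = ∫ x, ∑ j, u x * (x j * q j x - dunklT Rp κ j (q j) x) * gaussWeight Rp κ 0 x := by
        rw [integral_finsetSum _ fun j _ => h1 j, integral_finsetSum _ fun j _ => h2 j]
        exact Finset.sum_congr rfl fun j _ => integral_dunklT_mul hR hκ hu (hq j) j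
    _ = _ := by
        refine integral_congr_ae ?_
        filter_upwards [ae_inner_ne_zero hR] with x hx
        have h0 : ∑ j, dunklT Rp κ j (q j) x = 0 := by
          rw [← hΔ x hx]
          exact Finset.sum_congr rfl fun j _ => (dunklT_congr hR j (hqg j) hx).symm
        rw [← Finset.sum_mul, ← Finset.mul_sum, Finset.sum_sub_distrib, h0, sub_zero]
        simp only [hqg _ x hx]

/-- Euler's identity for the Dunkl gradient. -/
lemma sum_coord_mul_dunklT {n : ℕ} (hg : g ∈ polyFun d)
    (hhom : ∀ r : ℝ, ∀ x, g (r • x) = r ^ n * g x) (x : EuclideanSpace ℝ (Fin d)) :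
    ∑ j, x j * dunklT Rp κ j g x =
      (n + ∑ ν ∈ Rp, κ ν) * g x - ∑ ν ∈ Rp, κ ν * g (reflectV ν x) := by
  have heuler : ∑ j, x j * fderiv ℝ g x (EuclideanSpace.single j 1) = n * g x := by
    have hx : ∑ j, x j * fderiv ℝ g x (EuclideanSpace.single j 1) = fderiv ℝ g x x := by
      conv_rhs => enter [2]; rw [← (EuclideanSpace.basisFun (Fin d) ℝ).sum_repr x]
      simp
    have h1 : HasDerivAt (fun r : ℝ => g (r • x)) (fderiv ℝ g x x) 1 := by
      have hd : HasFDerivAt g (fderiv ℝ g x) ((1 : ℝ) • x) := by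
        rw [one_smul]
        exact (differentiable_of_mem_polyFun hg x).hasFDerivAt
      have h := hd.comp_hasDerivAt (1 : ℝ) ((hasDerivAt_id (1 : ℝ)).smul_const x)
      rw [one_smul] at h
      exact h
    have h2 : HasDerivAt (fun r : ℝ => g (r • x)) (n * g x) 1 := by
      simp only [hhom]
      simpa using (hasDerivAt_pow n (1 : ℝ)).mul_const (g x)
    rw [hx, h1.unique h2]
  have hdiff : ∑ j, x j * ∑ ν ∈ Rp, κ ν * ν j * ((g x - g (reflectV ν x)) / ⟪x, ν⟫) =
      ∑ ν ∈ Rp, κ ν * (g x - g (reflectV ν x)) := by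
    simp only [Finset.mul_sum]
    rw [Finset.sum_comm]
    refine Finset.sum_congr rfl fun ν _ => ?_
    have hin : ∑ j, x j * ν j = ⟪x, ν⟫ := by simp [PiLp.inner_apply, mul_comm]
    calc _ = κ ν * ((∑ j, x j * ν j) * ((g x - g (reflectV ν x)) / ⟪x, ν⟫)) := by
          rw [Finset.sum_mul, Finset.mul_sum]
          exact Finset.sum_congr rfl fun j _ => by ring
      _ = _ := by
          rw [hin]
          by_cases h : ⟪x, ν⟫ = 0
          · simp [reflectV_of_inner_eq_zero h]
          · rw [mul_div_cancel₀ _ h]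
  simp only [dunklT, mul_add, Finset.sum_add_distrib]
  rw [heuler, hdiff]
  simp only [mul_sub, Finset.sum_sub_distrib, ← Finset.sum_mul]
  ring

/-- The Dunkl gradient. -/
def dunklGrad (Rp : Finset (EuclideanSpace ℝ (Fin d))) (κ : EuclideanSpace ℝ (Fin d) → ℝ)
    (f : EuclideanSpace ℝ (Fin d) → ℝ) (x : EuclideanSpace ℝ (Fin d)) :
    EuclideanSpace ℝ (Fin d) :=
  gradient f x + ∑ ν ∈ Rp, (κ ν * ((f x - f (reflectV ν x)) / ⟪x, ν⟫)) • ν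

lemma dunklGrad_apply (j : Fin d) (x : EuclideanSpace ℝ (Fin d)) :
    dunklGrad Rp κ f x j = dunklT Rp κ j f x := by
  have h : gradient f x j = fderiv ℝ f x (EuclideanSpace.single j 1) := by
    rw [gradient, ← InnerProductSpace.toDual_symm_apply, EuclideanSpace.inner_single_right]
    simp
  simp only [dunklGrad, dunklT, PiLp.add_apply, h, WithLp.ofLp_sum, Finset.sum_apply,
    PiLp.smul_apply, smul_eq_mul]
  congr 1
  exact Finset.sum_congr rfl fun ν _ => by ring

lemma inner_dunklGrad (x : EuclideanSpace ℝ (Fin d)) :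
    ⟪dunklGrad Rp κ f x, dunklGrad Rp κ g x⟫ =
      ∑ j, dunklT Rp κ j f x * dunklT Rp κ j g x := by
  simp [PiLp.inner_apply, dunklGrad_apply, mul_comm]

lemma dunklGrad_comp_reflectV (hR : IsPosRootSystem Rp) (hκ : IsGInvMult Rp κ)
    (hf : f ∈ polyFun d) {μ : EuclideanSpace ℝ (Fin d)} (hμ : μ ∈ Rp)
    (x : EuclideanSpace ℝ (Fin d)) :
    dunklGrad Rp κ (fun y => f (reflectV μ y)) x =
      reflectV μ (dunklGrad Rp κ f (reflectV μ x)) := by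
  have hgrad : gradient (fun y => f (reflectV μ y)) x =
      reflectV μ (gradient f (reflectV μ x)) := by
    refine ext_inner_right ℝ fun v => ?_
    rw [inner_reflectV, gradient, gradient, InnerProductSpace.toDual_symm_apply,
      InnerProductSpace.toDual_symm_apply]
    have h := (differentiable_of_mem_polyFun hf (reflectV μ x)).hasFDerivAt
    simp only [← reflectEquiv_apply] at h ⊢
    have hc := (h.comp x (reflectEquiv μ).toContinuousLinearEquiv.hasFDerivAt).fderiv
    change fderiv ℝ (f ∘ reflectEquiv μ) x v = _
    exact congrArg (fun L => L v) hc
  have hsum := sum_reflectV hR hκ hμ (fun k ν =>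
    (k * ((f (reflectV μ x) - f (reflectV ν (reflectV μ x))) / ⟪reflectV μ x, ν⟫)) • ν)
    (fun k ν => by simp [neg_reflectV, div_neg])
  rw [dunklGrad, dunklGrad, hgrad, ← hsum]
  simp only [← reflectEquiv_apply, map_add, map_sum, map_smul]
  simp only [reflectEquiv_apply, ← reflectV_conj, reflectV_reflectV, inner_reflectV]

lemma integral_dunklT_comp_reflectV (hR : IsPosRootSystem Rp) (hκ : IsGInvMult Rp κ)
    (hf : f ∈ polyFun d) (hg : g ∈ polyFun d) {μ : EuclideanSpace ℝ (Fin d)} (hμ : μ ∈ Rp) :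
    ∫ x, (∑ j, dunklT Rp κ j (fun y => f (reflectV μ y)) x * dunklT Rp κ j g x) *
        gaussWeight Rp κ 0 x =
      ∫ x, (∑ j, dunklT Rp κ j f x * dunklT Rp κ j (fun y => g (reflectV μ y)) x) *
        gaussWeight Rp κ 0 x := by
  simp only [← inner_dunklGrad, dunklGrad_comp_reflectV hR hκ hf hμ,
    dunklGrad_comp_reflectV hR hκ hg hμ]
  conv_lhs => rw [← integral_comp_reflectV μ]
  simp only [reflectV_reflectV, gaussWeight_reflectV hR hκ hμ, inner_reflectV]

end GaussianOrthogonality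

section Orthogonality

variable {d n m : ℕ} {Rp : Finset (EuclideanSpace ℝ (Fin d))} {κ : EuclideanSpace ℝ (Fin d) → ℝ}
  {u v f g : EuclideanSpace ℝ (Fin d) → ℝ}

lemma integral_mul_comp_reflectV (hR : IsPosRootSystem Rp) (hκ : IsGInvMult Rp κ)
    {ν : EuclideanSpace ℝ (Fin d)} (hν : ν ∈ Rp) :
    ∫ x, u x * v (reflectV ν x) * gaussWeight Rp κ 0 x =
      ∫ x, u (reflectV ν x) * v x * gaussWeight Rp κ 0 x := by
  rw [← integral_comp_reflectV ν]
  simp only [reflectV_reflectV, gaussWeight_reflectV hR hκ hν]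

lemma integral_mul_sum_reflectV (hκ : IsGInvMult Rp κ) (hu : u ∈ polyFun d)
    (hv : v ∈ polyFun d) :
    ∫ x, u x * (∑ ν ∈ Rp, κ ν * v (reflectV ν x)) * gaussWeight Rp κ 0 x =
      ∑ ν ∈ Rp, κ ν * ∫ x, u x * v (reflectV ν x) * gaussWeight Rp κ 0 x := by
  simp only [← integral_const_mul]
  have h : ∀ ν ∈ Rp, Integrable fun x =>
      κ ν * (u x * v (reflectV ν x) * gaussWeight Rp κ 0 x) := fun ν _ =>
    (integrable_mul_gaussWeight hκ
      (mul_mem hu (comp_reflectV_mem_polyFun hv ν)) le_rfl zero_le_one).const_mul (κ ν)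
  rw [← integral_finsetSum _ h]
  congr 1 with x
  rw [Finset.mul_sum, Finset.sum_mul]
  exact Finset.sum_congr rfl fun ν _ => by ring

lemma sum_reflectV_mem_polyFun (hv : v ∈ polyFun d) :
    (fun x => ∑ ν ∈ Rp, κ ν * v (reflectV ν x)) ∈ polyFun d := by
  have h : ∑ ν ∈ Rp, (fun _ => κ ν) * (fun x => v (reflectV ν x)) ∈ polyFun d :=
    sum_mem fun ν _ => mul_mem (const_mem_polyFun _) (comp_reflectV_mem_polyFun hv ν)
  convert h using 1
  ext x
  simp

lemma integral_dunklT_mul_dunklT_homogeneous (hR : IsPosRootSystem Rp) (hκ : IsGInvMult Rp κ)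
    (hu : u ∈ polyFun d) (hg : g ∈ polyFun d)
    (hhom : ∀ r : ℝ, ∀ x, g (r • x) = r ^ m * g x)
    (hΔ : ∀ x, (∀ ν ∈ Rp, ⟪x, ν⟫ ≠ 0) → ∑ j, dunklT Rp κ j (dunklT Rp κ j g) x = 0) :
    ∫ x, (∑ j, dunklT Rp κ j u x * dunklT Rp κ j g x) * gaussWeight Rp κ 0 x =
      (m + ∑ ν ∈ Rp, κ ν) * (∫ x, u x * g x * gaussWeight Rp κ 0 x) -
      ∑ ν ∈ Rp, κ ν * ∫ x, u x * g (reflectV ν x) * gaussWeight Rp κ 0 x := by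
  rw [integral_dunklT_mul_dunklT hR hκ hu hg hΔ, ← integral_mul_sum_reflectV hκ hu hg,
    ← integral_const_mul]
  have h1 := (integrable_mul_gaussWeight hκ (mul_mem hu hg) le_rfl zero_le_one).const_mul
    (m + ∑ ν ∈ Rp, κ ν)
  have h2 := integrable_mul_gaussWeight hκ
    (mul_mem hu (sum_reflectV_mem_polyFun (Rp := Rp) (κ := κ) hg)) le_rfl zero_le_one
  refine Eq.trans ?_ (integral_sub h1 h2)
  congr 1 with x
  rw [sum_coord_mul_dunklT hg hhom]
  change _ = _ * (u x * g x * _) - (u x * _) * _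
  ring

/-- The Gaussian orthogonality relations of two h-harmonics of different degrees. -/
lemma gaussian_orthogonality (hR : IsPosRootSystem Rp) (hκ : IsGInvMult Rp κ) (hnm : n ≠ m)
    (hf : f ∈ polyFun d) (hg : g ∈ polyFun d)
    (hfhom : ∀ r : ℝ, ∀ x, f (r • x) = r ^ n * f x)
    (hghom : ∀ r : ℝ, ∀ x, g (r • x) = r ^ m * g x)
    (hfΔ : ∀ x, (∀ ν ∈ Rp, ⟪x, ν⟫ ≠ 0) → ∑ j, dunklT Rp κ j (dunklT Rp κ j f) x = 0)
    (hgΔ : ∀ x, (∀ ν ∈ Rp, ⟪x, ν⟫ ≠ 0) → ∑ j, dunklT Rp κ j (dunklT Rp κ j g) x = 0) :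
    ∫ x, f x * g x * gaussWeight Rp κ 0 x = 0 ∧
    ∫ x, f x * (∑ ν ∈ Rp, κ ν * g (reflectV ν x)) * gaussWeight Rp κ 0 x = 0 ∧
    ∫ x, g x * (∑ ν ∈ Rp, κ ν * f (reflectV ν x)) * gaussWeight Rp κ 0 x = 0 ∧
    ∫ x, (∑ j, dunklT Rp κ j f x * dunklT Rp κ j g x) * gaussWeight Rp κ 0 x = 0 := by
  have hne : (n : ℝ) - m ≠ 0 := sub_ne_zero.2 (by exact_mod_cast hnm)
  set I : (EuclideanSpace ℝ (Fin d) → ℝ) → (EuclideanSpace ℝ (Fin d) → ℝ) → ℝ :=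
    fun u v => ∫ x, u x * v x * gaussWeight Rp κ 0 x with hI
  set A : (EuclideanSpace ℝ (Fin d) → ℝ) → (EuclideanSpace ℝ (Fin d) → ℝ) → ℝ :=
    fun u v => ∫ x, (∑ j, dunklT Rp κ j u x * dunklT Rp κ j v x) * gaussWeight Rp κ 0 x with hA
  have hIcomm : ∀ u v, I u v = I v u := fun u v => by simp only [hI, mul_comm (u _)]
  have hAcomm : ∀ u v, A u v = A v u := fun u v => by
    simp only [hA, mul_comm (dunklT Rp κ _ u _)]
  have hIrefl : ∀ u v, ∀ ν ∈ Rp, I u (fun x => v (reflectV ν x)) =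
      I (fun x => u (reflectV ν x)) v := fun u v ν hν => integral_mul_comp_reflectV hR hκ hν
  have hAg : ∀ u ∈ polyFun d, A u g = (m + ∑ ν ∈ Rp, κ ν) * I u g -
      ∑ ν ∈ Rp, κ ν * I u (fun x => g (reflectV ν x)) := fun u hu =>
    integral_dunklT_mul_dunklT_homogeneous hR hκ hu hg hghom hgΔ
  have hAf : ∀ u ∈ polyFun d, A u f = (n + ∑ ν ∈ Rp, κ ν) * I u f -
      ∑ ν ∈ Rp, κ ν * I u (fun x => f (reflectV ν x)) := fun u hu =>
    integral_dunklT_mul_dunklT_homogeneous hR hκ hu hf hfhom hfΔ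
  have hS : ∑ ν ∈ Rp, κ ν * I g (fun x => f (reflectV ν x)) =
      ∑ ν ∈ Rp, κ ν * I f (fun x => g (reflectV ν x)) :=
    Finset.sum_congr rfl fun ν hν => by rw [hIrefl g f ν hν, hIcomm]
  have hfg : I f g = 0 := by
    have h1 := hAg f hf
    rw [hAcomm, hAf g hg, hS, hIcomm g f] at h1
    have h2 : ((n : ℝ) - m) * I f g = 0 := by linear_combination h1
    exact (mul_eq_zero.1 h2).resolve_left hne
  have hSfg : ∑ ν ∈ Rp, κ ν * I f (fun x => g (reflectV ν x)) = 0 := by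
    have hμ : ∀ μ ∈ Rp, κ μ * ((m + ∑ ν ∈ Rp, κ ν) * I f (fun x => g (reflectV μ x)) -
        ∑ ν ∈ Rp, κ ν * I (fun x => f (reflectV μ x)) (fun x => g (reflectV ν x))) =
        κ μ * ((n + ∑ ν ∈ Rp, κ ν) * I f (fun x => g (reflectV μ x)) -
        ∑ ν ∈ Rp, κ ν * I (fun x => f (reflectV ν x)) (fun x => g (reflectV μ x))) := by
      intro μ hμ
      have h1 := hAg _ (comp_reflectV_mem_polyFun hf μ)
      have h2 := hAf _ (comp_reflectV_mem_polyFun hg μ)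
      have h3 : A (fun x => f (reflectV μ x)) g = A f (fun x => g (reflectV μ x)) :=
        integral_dunklT_comp_reflectV hR hκ hf hg hμ
      rw [h3, hAcomm, h2, hIcomm, ← hIrefl f g μ hμ] at h1
      simp only [hIcomm (fun x => g (reflectV μ x))] at h1
      rw [h1]
    have hsum := Finset.sum_congr rfl hμ
    simp only [mul_sub, Finset.sum_sub_distrib, Finset.mul_sum] at hsum
    rw [Finset.sum_comm (s := Rp) (t := Rp)
      (f := fun μ ν => κ μ * (κ ν * I (fun x => f (reflectV ν x)) fun x => g (reflectV μ x)))]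
      at hsum
    simp only [mul_left_comm (κ _) (κ _), mul_left_comm (κ _) (_ + _), ← Finset.mul_sum] at hsum
    have h0 : ((n : ℝ) - m) * ∑ ν ∈ Rp, κ ν * I f (fun x => g (reflectV ν x)) = 0 := by
      linear_combination -hsum
    exact (mul_eq_zero.1 h0).resolve_left hne
  refine ⟨hfg, ?_, ?_, ?_⟩
  · rw [integral_mul_sum_reflectV hκ hf hg]
    exact hSfg
  · rw [integral_mul_sum_reflectV hκ hg hf]
    exact hS.trans hSfg
  · have := hAg f hf
    rwa [hfg, hSfg, mul_zero, sub_zero] at this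

end Orthogonality

section Sphere

variable {d : ℕ}

/-- Polar coordinates for positively homogeneous functions against a Gaussian. -/
lemma exists_integral_homogeneous_mul_gaussian {a : ℝ} (hd : 1 ≤ d) (ha : -(d : ℝ) < a) :
    ∃ K : ℝ, K ≠ 0 ∧ ∀ u : EuclideanSpace ℝ (Fin d) → ℝ,
      (∀ r : ℝ, 0 < r → ∀ x, u (r • x) = r ^ a * u x) →
      ∫ x, u x * Real.exp (-(‖x‖ ^ 2 / 2)) = K * ∫ ω, u ω ∂(sphereMeasure d) := by
  have hdim : Module.finrank ℝ (EuclideanSpace ℝ (Fin d)) = d := by simp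
  have : Nonempty (Fin d) := ⟨⟨0, hd⟩⟩
  refine ⟨∫ r : Set.Ioi (0 : ℝ), (r : ℝ) ^ a * Real.exp (-((r : ℝ) ^ 2 / 2))
    ∂(Measure.volumeIoiPow (d - 1)), ?_, fun u hu => ?_⟩
  · have h : ∫ r : Set.Ioi (0 : ℝ), (r : ℝ) ^ a * Real.exp (-((r : ℝ) ^ 2 / 2))
        ∂(Measure.volumeIoiPow (d - 1)) =
        ∫ r in Set.Ioi (0 : ℝ), r ^ (d - 1 + a) * Real.exp (-(1 / 2) * r ^ (2 : ℝ)) := by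
      simp only [Measure.volumeIoiPow, ENNReal.ofReal]
      rw [integral_withDensity_eq_integral_smul
          ((measurable_subtype_coe.pow_const _).real_toNNReal),
        integral_subtype_comap measurableSet_Ioi fun r : ℝ =>
          Real.toNNReal (r ^ (d - 1)) • (r ^ a * Real.exp (-(r ^ 2 / 2)))]
      refine setIntegral_congr_fun measurableSet_Ioi fun r hr => ?_
      have hr' : 0 < r := hr
      simp only [NNReal.smul_def, Real.coe_toNNReal _ (pow_nonneg hr'.le _), smul_eq_mul,
        Real.rpow_two]
      rw [Real.rpow_add hr', ← Nat.cast_pred hd, Real.rpow_natCast, ← mul_assoc]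
      ring_nf
    rw [h, integral_rpow_mul_exp_neg_mul_rpow two_pos (by linarith) (by norm_num)]
    have := Real.Gamma_pos_of_pos (s := (d - 1 + a + 1) / 2) (by linarith)
    positivity
  · calc ∫ x, u x * Real.exp (-(‖x‖ ^ 2 / 2))
        = ∫ x : ({(0)}ᶜ : Set (EuclideanSpace ℝ (Fin d))),
            u x.1 * Real.exp (-(‖x.1‖ ^ 2 / 2)) ∂(volume.comap Subtype.val) := by
          rw [integral_subtype_comap (measurableSet_singleton _).compl
            fun x => u x * Real.exp (-(‖x‖ ^ 2 / 2)), restrict_compl_singleton]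
      _ = ∫ y : Metric.sphere (0 : EuclideanSpace ℝ (Fin d)) 1 × Set.Ioi (0 : ℝ),
            u y.1 * ((y.2 : ℝ) ^ a * Real.exp (-((y.2 : ℝ) ^ 2 / 2)))
            ∂((sphereMeasure d).prod (Measure.volumeIoiPow (d - 1))) := by
          have h := (volume : Measure (EuclideanSpace ℝ (Fin d))
            ).measurePreserving_homeomorphUnitSphereProd.integral_comp
            (Homeomorph.measurableEmbedding _) (fun y =>
              u y.1 * ((y.2 : ℝ) ^ a * Real.exp (-((y.2 : ℝ) ^ 2 / 2))))
          rw [hdim] at h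
          rw [sphereMeasure, ← h]
          refine integral_congr_ae (Filter.Eventually.of_forall fun x => ?_)
          have hx : 0 < ‖x.1‖ := norm_pos_iff.2 x.2
          have hux := hu ‖x.1‖ hx (‖x.1‖⁻¹ • x.1)
          rw [smul_smul, mul_inv_cancel₀ hx.ne', one_smul] at hux
          simp only [homeomorphUnitSphereProd_apply_fst_coe,
            homeomorphUnitSphereProd_apply_snd_coe]
          rw [hux]
          ring
      _ = _ := by
          rw [sphereMeasure, integral_prod_mul
            (fun ω : Metric.sphere (0 : EuclideanSpace ℝ (Fin d)) 1 => u ω)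
            (fun r : Set.Ioi (0 : ℝ) => (r : ℝ) ^ a * Real.exp (-((r : ℝ) ^ 2 / 2))), mul_comm]

end Sphere

section Homogeneity

variable {d n : ℕ} {Rp : Finset (EuclideanSpace ℝ (Fin d))} {κ : EuclideanSpace ℝ (Fin d) → ℝ}
  {f : EuclideanSpace ℝ (Fin d) → ℝ}

lemma hk2_smul {r : ℝ} (hr : 0 < r) (x : EuclideanSpace ℝ (Fin d)) :
    hk2 Rp κ (r • x) = r ^ (2 * ∑ ν ∈ Rp, κ ν) * hk2 Rp κ x := by
  simp only [hk2, real_inner_smul_left, abs_mul, abs_of_pos hr,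
    Real.mul_rpow hr.le (abs_nonneg _), Finset.prod_mul_distrib, mul_pow]
  rw [← Real.rpow_sum_of_pos hr, mul_comm 2, Real.rpow_mul hr.le, Real.rpow_two]

lemma dunklT_smul (hhom : ∀ r : ℝ, ∀ x, f (r • x) = r ^ n * f x) (j : Fin d) {r : ℝ}
    (hr : r ≠ 0) (x : EuclideanSpace ℝ (Fin d)) :
    dunklT Rp κ j f (r • x) = r ^ n / r * dunklT Rp κ j f x := by
  have h1 : r • fderiv ℝ f (r • x) = r ^ n • fderiv ℝ f x := by
    rw [← fderiv_comp_smul, ← Pi.smul_apply, ← fderiv_const_smul_field]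
    simp only [hhom]
    rfl
  have h2 := congrArg (fun L => L (EuclideanSpace.single j 1)) h1
  simp only [smul_apply, smul_eq_mul] at h2
  rw [dunklT, dunklT, mul_add, Finset.mul_sum]
  congr 1
  · field_simp
    rw [mul_comm, h2]
  · refine Finset.sum_congr rfl fun ν _ => ?_
    rw [reflectV_smul, hhom, hhom, real_inner_smul_left, ← mul_sub, mul_div_mul_comm]
    ring

lemma IsSolidHHarmonic.mem_polyFun (hf : IsSolidHHarmonic Rp κ n f) : f ∈ polyFun d := by
  obtain ⟨P, -, hP⟩ := hf.1
  exact mem_polyFun_of_eval hP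

lemma IsSolidHHarmonic.map_smul (hf : IsSolidHHarmonic Rp κ n f) (r : ℝ)
    (x : EuclideanSpace ℝ (Fin d)) : f (r • x) = r ^ n * f x := by
  obtain ⟨P, hPn, hP⟩ := hf.1
  rw [hP, hP, MvPolynomial.eval_eq, MvPolynomial.eval_eq, Finset.mul_sum]
  refine Finset.sum_congr rfl fun s hs => ?_
  have hdeg : ∑ i ∈ s.support, s i = n := by
    have := hPn (MvPolynomial.mem_support_iff.1 hs)
    rwa [Pi.one_def, ← Finsupp.degree_eq_weight_one, Finsupp.degree_apply] at this
  simp only [PiLp.smul_apply, smul_eq_mul, mul_pow, Finset.prod_mul_distrib]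
  rw [Finset.prod_pow_eq_pow_sum, hdeg]
  ring

end Homogeneity

theorem stmt5 (d n m : ℕ) (hd : 2 ≤ d) (hnm : n ≠ m)
    (Rp : Finset (EuclideanSpace ℝ (Fin d)))
    (κ : EuclideanSpace ℝ (Fin d) → ℝ) (hR : IsPosRootSystem Rp) (hκ : IsGInvMult Rp κ)
    (Yn Ym : EuclideanSpace ℝ (Fin d) → ℝ)
    (hYn : IsSolidHHarmonic Rp κ n Yn) (hYm : IsSolidHHarmonic Rp κ m Ym) :
    ∫ ω : Metric.sphere (0 : EuclideanSpace ℝ (Fin d)) 1,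
        (∑ j : Fin d,
          (dunklT Rp κ j Yn ω - (n : ℝ) * Yn ω * (ω : EuclideanSpace ℝ (Fin d)) j) *
          (dunklT Rp κ j Ym ω - (m : ℝ) * Ym ω * (ω : EuclideanSpace ℝ (Fin d)) j)) *
          hk2 Rp κ ω ∂(sphereMeasure d) = 0 := by
  have hf := hYn.mem_polyFun
  have hg := hYm.mem_polyFun
  set B : EuclideanSpace ℝ (Fin d) → ℝ :=
    fun x => ∑ j, dunklT Rp κ j Yn x * dunklT Rp κ j Ym x with hB
  set γ := ∑ ν ∈ Rp, κ ν
  have hγ0 : 0 ≤ γ := Finset.sum_nonneg hκ.1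
  set ρf : EuclideanSpace ℝ (Fin d) → ℝ := fun x => ∑ ν ∈ Rp, κ ν * Yn (reflectV ν x) with hρf
  set ρg : EuclideanSpace ℝ (Fin d) → ℝ := fun x => ∑ ν ∈ Rp, κ ν * Ym (reflectV ν x) with hρg
  obtain ⟨h1, h2, h3, h4⟩ := gaussian_orthogonality hR hκ hnm hf hg hYn.map_smul hYm.map_smul
    hYn.2 hYm.2
  have hdeg : (1 : ℝ) ≤ n + m := by
    have : 1 ≤ n + m := by lia
    exact_mod_cast this
  have hd' : (2 : ℝ) ≤ d := by exact_mod_cast hd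
  obtain ⟨K, hK, hKu⟩ := exists_integral_homogeneous_mul_gaussian (d := d)
    (a := n + m - 2 + 2 * γ) (by lia) (by linarith)
  obtain ⟨L, hL, hLu⟩ := exists_integral_homogeneous_mul_gaussian (d := d)
    (a := n + m + 2 * γ) (by lia) (by linarith)
  have hpow : ∀ r : ℝ, 0 < r → r ^ ((n : ℝ) + m + 2 * γ) = r ^ n * r ^ m * r ^ (2 * γ) := by
    intro r hr
    rw [Real.rpow_add hr, Real.rpow_add hr, Real.rpow_natCast, Real.rpow_natCast]
  have hkhom : ∀ r : ℝ, 0 < r → ∀ x, hk2 Rp κ (r • x) = r ^ (2 * γ) * hk2 Rp κ x :=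
    fun r hr x => hk2_smul hr x
  have hBhom : ∀ r : ℝ, 0 < r → ∀ x, B (r • x) = r ^ n / r * (r ^ m / r) * B x := by
    intro r hr x
    simp only [hB, dunklT_smul hYn.map_smul _ hr.ne', dunklT_smul hYm.map_smul _ hr.ne',
      Finset.mul_sum]
    exact Finset.sum_congr rfl fun j _ => by ring
  have hρfhom : ∀ r x, ρf (r • x) = r ^ n * ρf x := fun r x => by
    simp only [hρf, reflectV_smul, hYn.map_smul, Finset.mul_sum, mul_left_comm]
  have hρghom : ∀ r x, ρg (r • x) = r ^ m * ρg x := fun r x => by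
    simp only [hρg, reflectV_smul, hYm.map_smul, Finset.mul_sum, mul_left_comm]
  have hBsphere : ∫ ω : Metric.sphere (0 : EuclideanSpace ℝ (Fin d)) 1,
      B ω * hk2 Rp κ ω ∂(sphereMeasure d) = 0 := by
    have h := hKu (fun x => B x * hk2 Rp κ x) fun r hr x => by
      rw [hBhom r hr, hkhom r hr, Real.rpow_add hr, Real.rpow_sub hr, Real.rpow_add hr,
        Real.rpow_natCast, Real.rpow_natCast, Real.rpow_two]
      field_simp
    simp only [mul_assoc, ← gaussWeight_zero] at h
    rw [h4] at h
    exact (mul_eq_zero.1 h.symm).resolve_left hK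
  have hBnorm : ∫ x, ‖x‖ ^ 2 * B x * gaussWeight Rp κ 0 x = 0 := by
    have h := hLu (fun x => ‖x‖ ^ 2 * B x * hk2 Rp κ x) fun r hr x => by
      rw [hBhom r hr, hkhom r hr, hpow r hr, norm_smul, Real.norm_of_nonneg hr.le]
      field_simp
    simp only [mul_assoc _ (hk2 _ _ _), ← gaussWeight_zero, norm_eq_of_mem_sphere, one_pow,
      one_mul] at h
    rw [h, hBsphere, mul_zero]
  have hUint : ∫ x, (‖x‖ ^ 2 * B x - (n * m + (n + m) * γ) * (Yn x * Ym x) +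
      m * (Ym x * ρf x) + n * (Yn x * ρg x)) * hk2 Rp κ x * Real.exp (-(‖x‖ ^ 2 / 2)) = 0 := by
    choose p hp hpf using exists_dunklT_eq Rp κ hf
    choose q hq hqg using exists_dunklT_eq Rp κ hg
    have hnormsq : (fun x : EuclideanSpace ℝ (Fin d) => ‖x‖ ^ 2) ∈ polyFun d := by
      have h : ∑ i : Fin d, (fun x : EuclideanSpace ℝ (Fin d) => x i) ^ 2 ∈ polyFun d :=
        sum_mem fun i _ => pow_mem (coord_mem_polyFun i) 2
      convert h using 1
      ext x
      simp [EuclideanSpace.norm_sq_eq]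
    have i1 : Integrable fun x => ‖x‖ ^ 2 * B x * gaussWeight Rp κ 0 x :=
      integrable_gaussWeight_of_eq hR hκ
        (mul_mem hnormsq (sum_mem fun j (_ : j ∈ univ) => mul_mem (hp j) (hq j))) fun x hx => by
          simp [hB, hpf _ x hx, hqg _ x hx]
    have i2 := (integrable_mul_gaussWeight hκ (mul_mem hf hg) le_rfl zero_le_one).const_mul
      (n * m + (n + m) * γ)
    have i3 := (integrable_mul_gaussWeight hκ (mul_mem hg
      (sum_reflectV_mem_polyFun (Rp := Rp) (κ := κ) hf)) le_rfl zero_le_one).const_mul (m : ℝ)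
    have i4 := (integrable_mul_gaussWeight hκ (mul_mem hf
      (sum_reflectV_mem_polyFun (Rp := Rp) (κ := κ) hg)) le_rfl zero_le_one).const_mul (n : ℝ)
    have h := integral_add ((i1.sub i2).add i3) i4
    rw [integral_add' (i1.sub i2) i3, integral_sub' i1 i2] at h
    simp only [integral_const_mul, Pi.mul_apply] at h
    rw [hBnorm, h1, h2, h3] at h
    simp only [mul_zero, sub_zero, add_zero] at h
    rw [← h]
    congr 1 with x
    simp only [Pi.add_apply, Pi.sub_apply, mul_assoc _ (hk2 _ _ _), ← gaussWeight_zero]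
    ring
  have hU := hLu (fun x => (‖x‖ ^ 2 * B x - (n * m + (n + m) * γ) * (Yn x * Ym x) +
      m * (Ym x * ρf x) + n * (Yn x * ρg x)) * hk2 Rp κ x) fun r hr x => by
    simp only [hBhom r hr, hkhom r hr, hpow r hr, norm_smul, Real.norm_of_nonneg hr.le,
      hρfhom, hρghom, hYn.map_smul, hYm.map_smul]
    field_simp
  rw [hUint] at hU
  refine Eq.trans ?_ ((mul_eq_zero.1 hU.symm).resolve_left hL)
  congr 1 with ω
  have hω : ∑ j, (ω : EuclideanSpace ℝ (Fin d)) j ^ 2 = 1 := by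
    rw [← EuclideanSpace.real_norm_sq_eq, norm_eq_of_mem_sphere, one_pow]
  have hEf := sum_coord_mul_dunklT (Rp := Rp) (κ := κ) hf hYn.map_smul ω
  have hEg := sum_coord_mul_dunklT (Rp := Rp) (κ := κ) hg hYm.map_smul ω
  rw [norm_eq_of_mem_sphere]
  congr 1
  have hexp : ∑ j, (dunklT Rp κ j Yn ω - (n : ℝ) * Yn ω * (ω : EuclideanSpace ℝ (Fin d)) j) *
      (dunklT Rp κ j Ym ω - (m : ℝ) * Ym ω * (ω : EuclideanSpace ℝ (Fin d)) j) =
      B ω - m * Ym ω * ∑ j, (ω : EuclideanSpace ℝ (Fin d)) j * dunklT Rp κ j Yn ω -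
      n * Yn ω * ∑ j, (ω : EuclideanSpace ℝ (Fin d)) j * dunklT Rp κ j Ym ω +
      n * m * (Yn ω * Ym ω) * ∑ j, (ω : EuclideanSpace ℝ (Fin d)) j ^ 2 := by
    simp only [hB, Finset.mul_sum]
    rw [← Finset.sum_sub_distrib, ← Finset.sum_sub_distrib, ← Finset.sum_add_distrib]
    exact Finset.sum_congr rfl fun j _ => by ring
  rw [hexp, hω, hEf, hEg]
  ring

end
end

section
/- Let (G,μ) and (H,ν) be σ-finite measure spaces, and let 1 ≤ p, q < ∞ satisfy p ≤ q ≤ 2 or 2 ≤ q ≤ p. Let T : L^p(G,μ) → L^p(G,μ) be a bounded linear operator (complex scalars). Then there exists a bounded linear operator T̃ : L^p(G,μ; L^q(H,ν)) → L^p(G,μ; L^q(H,ν)) on the Bochner space with operator norm ‖T̃‖ ≤ ‖T‖ such that for every f ∈ L^p(G,μ) and u ∈ L^q(H,ν), T̃ applied to the elementary tensor g(ξ,x) = f(ξ)u(x) equals (ξ,x) ↦ (Tf)(ξ) u(x). -/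
open MeasureTheory
open scoped ENNReal

noncomputable section

theorem sum_norm_twist_rpow {J : Type*} [Fintype J] (c : J → ℂ) {q r : ℝ} (hq : 0 < q) (hr : 0 < r)
    {b : ℂ} (hb : b.re = 1 / r) :
    ∑ j, ‖c j * Complex.exp ((q * b - 1) *
      Real.log (‖c j‖ / (∑ k, ‖c k‖ ^ q) ^ (1 / q)))‖ ^ r = ((∑ j, ‖c j‖ ^ q) ^ (1 / q)) ^ r := by
  set s := ∑ k, ‖c k‖ ^ q with hs
  have hs0 : 0 ≤ s := Finset.sum_nonneg fun k _ => by positivity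
  rcases hs0.eq_or_lt with h0 | h0
  · have hc : ∀ j, c j = 0 := by
      intro j
      have := (Finset.sum_eq_zero_iff_of_nonneg
        (fun k _ => Real.rpow_nonneg (norm_nonneg (c k)) q)).1 h0.symm j (Finset.mem_univ j)
      simpa [Real.rpow_eq_zero (norm_nonneg _) hq.ne'] using this
    simp [hc, ← h0, Real.zero_rpow hr.ne', Real.zero_rpow (inv_pos.2 hq).ne']
  set n := s ^ (1 / q) with hn
  have hn0 : 0 < n := by positivity
  have hnq : n ^ q = s := by
    rw [hn, ← Real.rpow_mul hs0, one_div_mul_cancel hq.ne', Real.rpow_one]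
  have key : ∀ j, ‖c j * Complex.exp ((q * b - 1) * Real.log (‖c j‖ / n))‖ ^ r
      = ‖c j‖ ^ q * (n ^ r / s) := by
    intro j
    rcases eq_or_ne (c j) 0 with h | h
    · simp [h, Real.zero_rpow hr.ne', Real.zero_rpow hq.ne']
    have hc : 0 < ‖c j‖ := norm_pos_iff.2 h
    have h1 : ((q * b - 1) * Real.log (‖c j‖ / n) : ℂ).re
        = Real.log (‖c j‖ / n) * (q / r - 1) := by
      simp [hb]; ring
    have h2 : r * (q / r - 1) = q - r := by field_simp
    rw [norm_mul, Complex.norm_exp, h1, ← Real.rpow_def_of_pos (by positivity),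
      Real.mul_rpow hc.le (by positivity), ← Real.rpow_mul (by positivity), mul_comm _ r, h2,
      Real.div_rpow hc.le hn0.le, Real.rpow_sub hc, Real.rpow_sub hn0, hnq]
    field_simp
  rw [Finset.sum_congr rfl fun j _ => key j, ← Finset.sum_mul, ← hs]
  field_simp

theorem norm_sum_mul_le_mixed {I J : Type*} [Fintype I] [Fintype J] {p p' r r' : ℝ}
    (hp : p.HolderConjugate p') (hr : r.HolderConjugate r') (y d : I → J → ℂ) :
    ‖∑ i, ∑ j, y i j * d i j‖ ≤ (∑ i, (∑ j, ‖y i j‖ ^ r) ^ (p / r)) ^ (1 / p) *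
      (∑ i, (∑ j, ‖d i j‖ ^ r') ^ (p' / r')) ^ (1 / p') := by
  have hpow : ∀ {a r p : ℝ}, 0 ≤ a → (a ^ (1 / r)) ^ p = a ^ (p / r) := fun ha => by
    rw [← Real.rpow_mul ha]; congr 1; ring
  calc ‖∑ i, ∑ j, y i j * d i j‖
      ≤ ∑ i, (∑ j, ‖y i j‖ ^ r) ^ (1 / r) * (∑ j, ‖d i j‖ ^ r') ^ (1 / r') := by
        refine (norm_sum_le _ _).trans (Finset.sum_le_sum fun i _ => (norm_sum_le _ _).trans ?_)
        simpa using Real.inner_le_Lp_mul_Lq Finset.univ (fun j => ‖y i j‖) (fun j => ‖d i j‖) hr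
    _ ≤ _ := by
        have := Real.inner_le_Lp_mul_Lq Finset.univ (fun i => (∑ j, ‖y i j‖ ^ r) ^ (1 / r))
          (fun i => (∑ j, ‖d i j‖ ^ r') ^ (1 / r')) hp
        refine this.trans (le_of_eq ?_)
        congr 2 <;> refine Finset.sum_congr rfl fun i _ => ?_
        · rw [abs_of_nonneg (by positivity), hpow (by positivity)]
        · rw [abs_of_nonneg (by positivity), hpow (by positivity)]

/-- The matrix `M` acts on `ℓ^p(A; ℓ^q(J)) → ℓ^p(I; ℓ^q(J))` with norm at most `C`. -/
def MixedBound {I A J : Type*} [Fintype I] [Fintype A] [Fintype J] (p q C : ℝ) (M : I → A → ℂ)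
    (c : A → J → ℂ) : Prop :=
  ∑ i, (∑ j, ‖∑ a, M i a * c a j‖ ^ q) ^ (p / q) ≤ C ^ p * ∑ a, (∑ j, ‖c a j‖ ^ q) ^ (p / q)

theorem mixedBound_self {I A J : Type*} [Fintype I] [Fintype A] [Fintype J] {p C : ℝ} (hp : 0 < p)
    {M : I → A → ℂ} (hM : ∀ x : A → ℂ, ∑ i, ‖∑ a, M i a * x a‖ ^ p ≤ C ^ p * ∑ a, ‖x a‖ ^ p)
    (c : A → J → ℂ) : MixedBound p p C M c := by
  simp only [MixedBound, div_self hp.ne', Real.rpow_one]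
  rw [Finset.sum_comm, Finset.sum_comm (s := (Finset.univ : Finset A)), Finset.mul_sum]
  exact Finset.sum_le_sum fun j _ => hM fun a => c a j

theorem norm_bilinear_le_of_interpolation {I A J : Type*} [Fintype I] [Fintype A] [Fintype J]
    {p p' q q' r₀ r₀' r₁ r₁' θ C : ℝ} (hp : p.HolderConjugate p') (hq : q.HolderConjugate q')
    (hr₀ : r₀.HolderConjugate r₀') (hr₁ : r₁.HolderConjugate r₁') (hC : 0 ≤ C)
    (hθ : θ ∈ Set.Icc (0 : ℝ) 1) (hqθ : 1 / q = (1 - θ) / r₀ + θ / r₁) {M : I → A → ℂ}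
    (h₀ : ∀ c : A → J → ℂ, MixedBound p r₀ C M c) (h₁ : ∀ c : A → J → ℂ, MixedBound p r₁ C M c)
    (c : A → J → ℂ) (d : I → J → ℂ) :
    ‖∑ i, ∑ j, (∑ a, M i a * c a j) * d i j‖ ≤
      C * (∑ a, (∑ j, ‖c a j‖ ^ q) ^ (p / q)) ^ (1 / p) *
        (∑ i, (∑ j, ‖d i j‖ ^ q') ^ (p' / q')) ^ (1 / p') := by
  have hpow : ∀ {a r p : ℝ}, 0 ≤ a → (a ^ (1 / r)) ^ p = a ^ (p / r) := fun ha => by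
    rw [← Real.rpow_mul ha]; congr 1; ring
  let α : ℂ → ℂ := fun z => (1 - z) / r₀ + z / r₁
  let α' : ℂ → ℂ := fun z => (1 - z) / r₀' + z / r₁'
  let cz : ℂ → A → J → ℂ := fun z a j => c a j * Complex.exp ((q * α z - 1) *
      Real.log (‖c a j‖ / (∑ k, ‖c a k‖ ^ q) ^ (1 / q)))
  let dz : ℂ → I → J → ℂ := fun z i j => d i j * Complex.exp ((q' * α' z - 1) *
      Real.log (‖d i j‖ / (∑ k, ‖d i k‖ ^ q') ^ (1 / q')))
  let Φ : ℂ → ℂ := fun z => ∑ i, ∑ j, (∑ a, M i a * cz z a j) * dz z i j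
  set K := C * (∑ a, (∑ j, ‖c a j‖ ^ q) ^ (p / q)) ^ (1 / p) *
        (∑ i, (∑ j, ‖d i j‖ ^ q') ^ (p' / q')) ^ (1 / p') with hK
  have hK0 : 0 ≤ K := by positivity
  have hαre : ∀ z, (α z).re = (1 - z.re) / r₀ + z.re / r₁ := fun z => by simp [α]
  have hα're : ∀ z, (α' z).re = (1 - z.re) / r₀' + z.re / r₁' := fun z => by simp [α']
  have line : ∀ {r r' : ℝ}, r.HolderConjugate r' → (∀ c : A → J → ℂ, MixedBound p r C M c) →
      ∀ z, (α z).re = 1 / r → (α' z).re = 1 / r' → ‖Φ z‖ ≤ K := by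
    intro r r' hr h z hz hz'
    refine (norm_sum_mul_le_mixed hp hr _ _).trans ?_
    have e1 : ∀ a, (∑ j, ‖cz z a j‖ ^ r) ^ (p / r) = (∑ j, ‖c a j‖ ^ q) ^ (p / q) := by
      intro a
      rw [sum_norm_twist_rpow (c a) hq.pos hr.pos hz, hpow (by positivity),
        ← Real.rpow_mul (by positivity)]
      congr 1
      have := hr.pos.ne'
      field_simp
    have e2 : ∀ i, (∑ j, ‖dz z i j‖ ^ r') ^ (p' / r') = (∑ j, ‖d i j‖ ^ q') ^ (p' / q') := by
      intro i
      rw [sum_norm_twist_rpow (d i) hq.symm.pos hr.symm.pos hz', hpow (by positivity),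
        ← Real.rpow_mul (by positivity)]
      congr 1
      have := hr.symm.pos.ne'
      field_simp
    simp only [e2]
    rw [hK]
    refine mul_le_mul_of_nonneg_right ?_ (by positivity)
    have := h (cz z)
    simp only [MixedBound, e1] at this
    refine (Real.rpow_le_rpow (by positivity) this (by have := hp.pos; positivity)).trans
      (le_of_eq ?_)
    rw [Real.mul_rpow (by positivity) (by positivity), ← Real.rpow_mul hC,
      mul_one_div_cancel hp.pos.ne', Real.rpow_one]
  have hbdd : BddAbove ((norm ∘ Φ) '' Complex.HadamardThreeLines.verticalClosedStrip 0 1) := by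
    let Ψ : ℝ → ℝ := fun x => ∑ i, ∑ j, (∑ a, ‖M i a‖ * (‖c a j‖ *
      Real.exp ((q * ((1 - x) / r₀ + x / r₁) - 1) *
        Real.log (‖c a j‖ / (∑ k, ‖c a k‖ ^ q) ^ (1 / q))))) *
      (‖d i j‖ * Real.exp ((q' * ((1 - x) / r₀' + x / r₁') - 1) *
        Real.log (‖d i j‖ / (∑ k, ‖d i k‖ ^ q') ^ (1 / q'))))
    have hΨ : Continuous Ψ := by fun_prop
    obtain ⟨B, hB⟩ := (isCompact_Icc (a := (0 : ℝ)) (b := 1)).bddAbove_image hΨ.continuousOn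
    refine ⟨B, ?_⟩
    rintro _ ⟨z, hz, rfl⟩
    refine le_trans ?_ (hB ⟨z.re, hz, rfl⟩)
    refine (norm_sum_le _ _).trans (Finset.sum_le_sum fun i _ => (norm_sum_le _ _).trans
      (Finset.sum_le_sum fun j _ => ?_))
    rw [norm_mul]
    refine mul_le_mul ((norm_sum_le _ _).trans (Finset.sum_le_sum fun a _ => ?_)) ?_
      (norm_nonneg _) (by positivity)
    · rw [norm_mul]
      refine mul_le_mul_of_nonneg_left (le_of_eq ?_) (norm_nonneg _)
      simp only [cz, norm_mul, Complex.norm_exp, Complex.re_mul_ofReal, Complex.sub_re,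
        Complex.re_ofReal_mul, Complex.one_re, hαre]
    · simp only [dz, norm_mul, Complex.norm_exp, Complex.re_mul_ofReal, Complex.sub_re,
        Complex.re_ofReal_mul, Complex.one_re, hα're, le_refl]
  have hdiff : DiffContOnCl ℂ Φ (Complex.HadamardThreeLines.verticalStrip 0 1) := by
    have : Differentiable ℂ Φ := by fun_prop
    exact this.diffContOnCl
  have hfin := Complex.HadamardThreeLines.norm_le_interp_of_mem_verticalClosedStrip₀₁' Φ
    (z := (θ : ℂ)) (a := K) (b := K) (by simpa [Complex.HadamardThreeLines.verticalClosedStrip]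
      using hθ) hdiff hbdd
    (fun z hz => line hr₀ h₀ z (by rw [hαre, show z.re = 0 from hz]; simp)
      (by rw [hα're, show z.re = 0 from hz]; simp))
    (fun z hz => line hr₁ h₁ z (by rw [hαre, show z.re = 1 from hz]; simp)
      (by rw [hα're, show z.re = 1 from hz]; simp))
  have hKK : K ^ (1 - (θ : ℂ).re) * K ^ (θ : ℂ).re = K := by
    rw [← Real.rpow_add_of_nonneg hK0 (by simpa using hθ.2) (by simpa using hθ.1)]
    simp
  rw [hKK] at hfin
  have hα1 : (q : ℂ) * α θ = 1 := by
    have : q * ((1 - θ) / r₀ + θ / r₁) = 1 := by rw [← hqθ, mul_one_div_cancel hq.pos.ne']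
    simp only [α]; exact_mod_cast this
  have hα'1 : (q' : ℂ) * α' θ = 1 := by
    have : q' * ((1 - θ) / r₀' + θ / r₁') = 1 := by
      have e : (1 - θ) / r₀' + θ / r₁' = 1 / q' := by
        have a1 := hr₀.inv_add_inv_eq_one
        have a2 := hr₁.inv_add_inv_eq_one
        have a3 := hq.inv_add_inv_eq_one
        simp only [div_eq_mul_inv, one_mul] at hqθ ⊢
        linear_combination (1 - θ) * a1 + θ * a2 - a3 + hqθ
      rw [e, mul_one_div_cancel hq.symm.pos.ne']
    simp only [α']; exact_mod_cast this
  simpa [Φ, cz, dz, hα1, hα'1] using hfin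

/-- A dual array for a row `y`, realising equality in the Hölder inequality for `‖y‖_q` and having
the matching mixed power. -/
theorem exists_dual_row {J : Type*} [Fintype J] {p p' q q' : ℝ} (hpc : p.HolderConjugate p')
    (hqc : q.HolderConjugate q') (y : J → ℂ) :
    ∃ d : J → ℂ, ∑ j, y j * d j = (((∑ j, ‖y j‖ ^ q) ^ (p / q) : ℝ) : ℂ) ∧
      (∑ j, ‖d j‖ ^ q') ^ (p' / q') = (∑ j, ‖y j‖ ^ q) ^ (p / q) := by
  set N : ℝ := (∑ j, ‖y j‖ ^ q) ^ (1 / q) with hN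
  have hN0 : 0 ≤ N := by positivity
  have hNq : N ^ q = ∑ j, ‖y j‖ ^ q := by
    rw [hN, ← Real.rpow_mul (by positivity), one_div_mul_cancel hqc.pos.ne', Real.rpow_one]
  have hNp : (∑ j, ‖y j‖ ^ q) ^ (p / q) = N ^ p := by
    rw [hN, ← Real.rpow_mul (by positivity)]; congr 1; ring
  rw [hNp]
  refine ⟨fun j => (starRingEnd ℂ (y j)) * ((‖y j‖ ^ (q - 2) * N ^ (p - q) : ℝ) : ℂ), ?_, ?_⟩
  · have e : ∀ j, y j * ((starRingEnd ℂ (y j)) * ((‖y j‖ ^ (q - 2) * N ^ (p - q) : ℝ) : ℂ)) =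
        ((‖y j‖ ^ q * N ^ (p - q) : ℝ) : ℂ) := by
      intro j
      rcases eq_or_ne (y j) 0 with h | h
      · simp [h, Real.zero_rpow hqc.pos.ne']
      · have h2 : ‖y j‖ ^ q = ‖y j‖ ^ 2 * ‖y j‖ ^ (q - 2) := by
          rw [← Real.rpow_two, ← Real.rpow_add (norm_pos_iff.2 h)]; ring_nf
        rw [← mul_assoc, Complex.mul_conj, Complex.normSq_eq_norm_sq, h2]
        push_cast; ring
    rw [Finset.sum_congr rfl fun j _ => e j, ← Complex.ofReal_sum, ← Finset.sum_mul, ← hNq]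
    congr 1
    rcases hN0.eq_or_lt with h | h
    · simp [← h, Real.zero_rpow hqc.pos.ne', Real.zero_rpow hpc.pos.ne']
    · rw [← Real.rpow_add h]; ring_nf
  · have hqq : (q - 1) * q' = q := hqc.sub_one_mul_conj
    have hpp : (p - 1) * p' = p := hpc.sub_one_mul_conj
    have e : ∀ j, ‖(starRingEnd ℂ (y j)) * ((‖y j‖ ^ (q - 2) * N ^ (p - q) : ℝ) : ℂ)‖ ^ q' =
        ‖y j‖ ^ q * (N ^ (p - q)) ^ q' := by
      intro j
      rcases eq_or_ne (y j) 0 with h | h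
      · simp [h, Real.zero_rpow hqc.pos.ne', Real.zero_rpow hqc.symm.pos.ne']
      · have h2 : ‖y j‖ ^ (q - 1) = ‖y j‖ * ‖y j‖ ^ (q - 2) := by
          nth_rewrite 2 [← Real.rpow_one ‖y j‖]
          rw [← Real.rpow_add (norm_pos_iff.2 h)]; ring_nf
        rw [norm_mul, RCLike.norm_conj, Complex.norm_real, Real.norm_of_nonneg (by positivity),
          ← mul_assoc, ← h2, Real.mul_rpow (by positivity) (by positivity),
          ← Real.rpow_mul (norm_nonneg _), hqq]
    rw [Finset.sum_congr rfl fun j _ => e j, ← Finset.sum_mul, ← hNq]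
    rcases hN0.eq_or_lt with h | h
    · have : p' / q' ≠ 0 := (div_pos hpc.symm.pos hqc.symm.pos).ne'
      simp [← h, Real.zero_rpow hqc.pos.ne', Real.zero_rpow hpc.pos.ne', Real.zero_rpow this]
    · rw [← Real.rpow_mul h.le, ← Real.rpow_add h, ← Real.rpow_mul h.le]
      congr 1
      have := hqc.symm.pos.ne'
      field_simp
      linear_combination q' * hpp - p' * hqq

theorem mixedBound_of_interpolation {I A J : Type*} [Fintype I] [Fintype A] [Fintype J]
    {p q r₀ r₁ θ C : ℝ} (hp : 1 < p) (hq : 1 < q) (hr₀ : 1 < r₀) (hr₁ : 1 < r₁) (hC : 0 ≤ C)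
    (hθ : θ ∈ Set.Icc (0 : ℝ) 1) (hqθ : 1 / q = (1 - θ) / r₀ + θ / r₁) {M : I → A → ℂ}
    (h₀ : ∀ c : A → J → ℂ, MixedBound p r₀ C M c) (h₁ : ∀ c : A → J → ℂ, MixedBound p r₁ C M c)
    (c : A → J → ℂ) : MixedBound p q C M c := by
  have hpc := Real.HolderConjugate.conjExponent hp
  have hqc := Real.HolderConjugate.conjExponent hq
  choose d hyd hd using fun i => exists_dual_row hpc hqc fun j => ∑ a, M i a * c a j
  have key := norm_bilinear_le_of_interpolation hpc hqc
    (Real.HolderConjugate.conjExponent hr₀) (Real.HolderConjugate.conjExponent hr₁) hC hθ hqθ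
    h₀ h₁ c d
  simp only [hyd, hd] at key
  rw [← Complex.ofReal_sum, Complex.norm_real, Real.norm_of_nonneg (by positivity)] at key
  unfold MixedBound
  set Y := ∑ i, (∑ j, ‖∑ a, M i a * c a j‖ ^ q) ^ (p / q) with hY
  set X := ∑ a, (∑ j, ‖c a j‖ ^ q) ^ (p / q) with hX
  have hY0 : 0 ≤ Y := by positivity
  have hX0 : 0 ≤ X := by positivity
  rcases hY0.eq_or_lt with h | h
  · rw [← h]; positivity
  have hYs : Y = Y ^ (1 / p) * Y ^ (1 / p.conjExponent) := by
    rw [← Real.rpow_add h, one_div, one_div, hpc.inv_add_inv_eq_one, Real.rpow_one]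
  have h3 : Y ^ (1 / p) ≤ C * X ^ (1 / p) := by
    refine le_of_mul_le_mul_right ?_ (Real.rpow_pos_of_pos h (1 / p.conjExponent))
    rwa [← hYs]
  have := Real.rpow_le_rpow (by positivity) h3 hpc.pos.le
  rwa [Real.mul_rpow hC (by positivity), ← Real.rpow_mul hX0, ← Real.rpow_mul hY0,
    one_div_mul_cancel hpc.pos.ne', Real.rpow_one, Real.rpow_one] at this


theorem exists_linearIsometryEquiv_apply_eq {V : Type*} [NormedAddCommGroup V]
    [InnerProductSpace ℂ V] [FiniteDimensional ℂ V] {x y : V} (h : ‖x‖ = ‖y‖) :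
    ∃ U : V ≃ₗᵢ[ℂ] V, U x = y := by
  rcases eq_or_ne x 0 with rfl | hx
  · refine ⟨LinearIsometryEquiv.refl ℂ V, ?_⟩
    have : y = 0 := by simpa using h.symm
    simp [this]
  let f : V →ₗ[ℂ] V := (LinearMap.toSpanSingleton ℂ V y) ∘ₗ
    (((‖x‖ : ℂ) ^ 2)⁻¹ • (innerSL ℂ x).toLinearMap)
  have hx' : (‖x‖ : ℂ) ≠ 0 := by simpa using hx
  have hfx : f x = y := by
    simp [f, inner_self_eq_norm_sq_to_K, hx']
  let L : (ℂ ∙ x) →ₗᵢ[ℂ] V :=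
    { toLinearMap := f ∘ₗ (ℂ ∙ x).subtype
      norm_map' := by
        rintro ⟨z, hz⟩
        obtain ⟨c, rfl⟩ := Submodule.mem_span_singleton.1 hz
        simp only [LinearMap.comp_apply, Submodule.subtype_apply, map_smul, hfx, norm_smul, h,
          Submodule.coe_norm] }
  refine ⟨L.extend.toLinearIsometryEquiv rfl, ?_⟩
  have := L.extend_apply ⟨x, Submodule.mem_span_singleton_self x⟩
  simpa [L, hfx] using this

/-- Unitary invariance of the ball turns the Hilbert norm into an average of linear functionals. -/
theorem exists_integral_ball_norm_inner_rpow {V : Type*} [NormedAddCommGroup V]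
    [InnerProductSpace ℂ V] [FiniteDimensional ℂ V] [MeasurableSpace V] [BorelSpace V]
    {p : ℝ} (hp : 0 < p) :
    ∃ (m : Measure V) (κ : ℝ), 0 < κ ∧ (∀ x : V, Integrable (fun w => ‖inner ℂ w x‖ ^ p) m) ∧
      ∀ x : V, ∫ w, ‖inner ℂ w x‖ ^ p ∂m = κ * ‖x‖ ^ p := by
  rcases subsingleton_or_nontrivial V with hV | hV
  · exact ⟨0, 1, one_pos, by simp, fun x => by simp [Subsingleton.elim x 0, Real.zero_rpow hp.ne']⟩
  let _ : InnerProductSpace ℝ V := InnerProductSpace.complexToReal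
  have : FiniteDimensional ℝ V := FiniteDimensional.complexToReal V
  have hcont : ∀ x : V, Continuous fun w => ‖inner ℂ w x‖ ^ p := fun x =>
    (continuous_id.inner continuous_const).norm.rpow_const fun _ => Or.inr hp.le
  have hint : ∀ x : V, IntegrableOn (fun w => ‖inner ℂ w x‖ ^ p) (Metric.ball 0 1) volume :=
    fun x => ((hcont x).continuousOn.integrableOn_compact
      (isCompact_closedBall (0 : V) 1)).mono_set Metric.ball_subset_closedBall
  obtain ⟨e, he⟩ := exists_norm_eq V zero_le_one
  refine ⟨volume.restrict (Metric.ball 0 1), ∫ w in Metric.ball 0 1, ‖inner ℂ w e‖ ^ p,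
    ?_, hint, fun x => ?_⟩
  · rw [setIntegral_pos_iff_support_of_nonneg_ae
      (Filter.Eventually.of_forall fun w => by positivity) (hint e)]
    refine IsOpen.measure_pos _ ((hcont e).isOpen_support.inter Metric.isOpen_ball)
      ⟨(2⁻¹ : ℂ) • e, ?_, ?_⟩
    · simp [inner_self_eq_norm_sq_to_K, he, Real.rpow_eq_zero_iff_of_nonneg]
    · norm_num [norm_smul, he]
  · obtain ⟨U, hU⟩ := exists_linearIsometryEquiv_apply_eq (x := (‖x‖ : ℂ) • e) (y := x)
      (by simp [norm_smul, he])
    let U' : V ≃ₗᵢ[ℝ] V := ⟨U.toLinearEquiv.restrictScalars ℝ, U.norm_map⟩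
    have hmp : MeasurePreserving U' volume volume := U'.measurePreserving
    have hpre : U' ⁻¹' Metric.ball 0 1 = Metric.ball 0 1 := by
      ext w
      simp
    have hme : MeasurableEmbedding U' := U'.toHomeomorph.measurableEmbedding
    rw [← hmp.setIntegral_preimage_emb hme, hpre, mul_comm, ← integral_const_mul]
    refine integral_congr_ae (Filter.Eventually.of_forall fun w => ?_)
    have h1 : inner ℂ (U' w) x = ‖x‖ * inner ℂ w e := by
      change inner ℂ (U w) x = _
      rw [← hU, U.inner_map_map, inner_smul_right, hU]
    simp only [h1, norm_mul, Complex.norm_real, norm_norm]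
    rw [Real.mul_rpow (norm_nonneg _) (norm_nonneg _)]

theorem mixedBound_two {I A J : Type*} [Fintype I] [Fintype A] [Fintype J] {p C : ℝ} (hp : 0 < p)
    {M : I → A → ℂ} (hM : ∀ x : A → ℂ, ∑ i, ‖∑ a, M i a * x a‖ ^ p ≤ C ^ p * ∑ a, ‖x a‖ ^ p)
    (c : A → J → ℂ) : MixedBound p 2 C M c := by
  obtain ⟨m, κ, hκ, hint, hm⟩ :=
    exists_integral_ball_norm_inner_rpow (V := EuclideanSpace ℂ J) hp
  have hnorm : ∀ x : J → ℂ, (∑ j, ‖x j‖ ^ (2 : ℝ)) ^ (p / 2) = ‖WithLp.toLp 2 x‖ ^ p := by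
    intro x
    rw [EuclideanSpace.norm_eq, Real.sqrt_eq_rpow, ← Real.rpow_mul (by positivity)]
    simp only [Real.rpow_two]
    congr 1; ring
  simp only [MixedBound, hnorm]
  have hlin : ∀ i, WithLp.toLp 2 (fun j => ∑ a, M i a * c a j) =
      ∑ a, M i a • (WithLp.toLp 2 (c a) : EuclideanSpace ℂ J) := by
    intro i
    ext j
    simp
  refine le_of_mul_le_mul_left ?_ hκ
  rw [mul_left_comm, Finset.mul_sum, Finset.mul_sum]
  simp only [← hm]
  rw [← integral_finsetSum _ fun i _ => hint _, ← integral_finsetSum _ fun a _ => hint _,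
    ← integral_const_mul]
  refine integral_mono (integrable_finsetSum _ fun i _ => hint _)
    ((integrable_finsetSum _ fun a _ => hint _).const_mul _) fun w => ?_
  simp only [hlin, inner_sum, inner_smul_right]
  exact hM fun a => inner ℂ w (WithLp.toLp 2 (c a))

theorem mixedBound_one {I A J : Type*} [Fintype I] [Fintype A] [Fintype J] {q C : ℝ} (hq : 1 ≤ q)
    {M : I → A → ℂ}
    (hM : ∀ x : A → ℂ, ∑ i, ‖∑ a, M i a * x a‖ ^ (1 : ℝ) ≤ C ^ (1 : ℝ) * ∑ a, ‖x a‖ ^ (1 : ℝ))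
    (c : A → J → ℂ) : MixedBound 1 q C M c := by
  have hq0 : 0 < q := by linarith
  have : Fact (1 ≤ ENNReal.ofReal q) := ⟨by simpa using hq⟩
  have hnorm : ∀ x : J → ℂ, (∑ j, ‖x j‖ ^ q) ^ (1 / q) = ‖WithLp.toLp (ENNReal.ofReal q) x‖ := by
    intro x
    rw [PiLp.norm_eq_sum (by rwa [ENNReal.toReal_ofReal hq0.le]), ENNReal.toReal_ofReal hq0.le]
  simp only [MixedBound, hnorm, Real.rpow_one] at hM ⊢
  have hlin : ∀ i, WithLp.toLp (ENNReal.ofReal q) (fun j => ∑ a, M i a * c a j) =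
      ∑ a, M i a • (WithLp.toLp (ENNReal.ofReal q) (c a) : PiLp _ fun _ : J => ℂ) := by
    intro i
    ext j
    simp
  have hcol : ∀ a, ∑ i, ‖M i a‖ ≤ C := by
    classical
    intro a
    simpa [Pi.single_apply, apply_ite] using hM (Pi.single a 1)
  calc _ ≤ ∑ i, ∑ a, ‖M i a‖ * ‖WithLp.toLp (ENNReal.ofReal q) (c a)‖ :=
        Finset.sum_le_sum fun i _ => by
          rw [hlin]
          exact (norm_sum_le _ _).trans (Finset.sum_le_sum fun a _ => (norm_smul _ _).le)
    _ = ∑ a, (∑ i, ‖M i a‖) * ‖WithLp.toLp (ENNReal.ofReal q) (c a)‖ := by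
        rw [Finset.sum_comm]; simp only [Finset.sum_mul]
    _ ≤ ∑ a, C * ‖WithLp.toLp (ENNReal.ofReal q) (c a)‖ := Finset.sum_le_sum fun a _ =>
        mul_le_mul_of_nonneg_right (hcol a) (norm_nonneg _)
    _ = _ := by rw [Finset.mul_sum]

/-- The Marcinkiewicz–Zygmund inequality with constant one, for matrices. -/
theorem mixedBound_of_exponents {I A J : Type*} [Fintype I] [Fintype A] [Fintype J] {p q C : ℝ}
    (hp : 1 ≤ p) (hq : 1 ≤ q) (hpq : (p ≤ q ∧ q ≤ 2) ∨ (2 ≤ q ∧ q ≤ p)) (hC : 0 ≤ C)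
    {M : I → A → ℂ} (hM : ∀ x : A → ℂ, ∑ i, ‖∑ a, M i a * x a‖ ^ p ≤ C ^ p * ∑ a, ‖x a‖ ^ p)
    (c : A → J → ℂ) : MixedBound p q C M c := by
  rcases hp.eq_or_lt with rfl | hp1
  · exact mixedBound_one hq hM c
  have hp0 : 0 < p := by linarith
  have hq0 : 0 < q := by linarith
  rcases eq_or_ne p 2 with rfl | hp2
  · have : q = 2 := by rcases hpq with h | h <;> linarith [h.1, h.2]
    exact this ▸ mixedBound_two hp0 hM c
  have hq1 : 1 < q := by rcases hpq with h | h <;> linarith [h.1, h.2]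
  have hp2' : 2 - p ≠ 0 := sub_ne_zero.2 hp2.symm
  refine mixedBound_of_interpolation (θ := 2 * (q - p) / (q * (2 - p))) hp1 hq1 hp1 one_lt_two hC
    ?_ ?_ (mixedBound_self hp0 hM) (mixedBound_two hp0 hM) c
  · rcases hpq with ⟨h1, h2⟩ | ⟨h1, h2⟩
    · have h3 : 0 < 2 - p := lt_of_le_of_ne (by linarith) hp2'.symm
      refine ⟨div_nonneg (by linarith) (by positivity), ?_⟩
      rw [div_le_one (by positivity)]
      nlinarith
    · have h3 : 0 < p - 2 := lt_of_le_of_ne (by linarith) (sub_ne_zero.2 hp2).symm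
      rw [show 2 * (q - p) / (q * (2 - p)) = 2 * (p - q) / (q * (p - 2)) by
        rw [← neg_sub p q, ← neg_sub p 2, mul_neg, mul_neg, neg_div_neg_eq]]
      refine ⟨div_nonneg (by linarith) (by positivity), ?_⟩
      rw [div_le_one (by positivity)]
      nlinarith
  · field_simp
    ring

theorem Lp_norm_rpow_eq_integral {α E : Type*} [MeasurableSpace α] {μ : Measure α}
    [NormedAddCommGroup E] {p : ℝ≥0∞} (hp0 : p ≠ 0) (hp : p ≠ ∞) (f : Lp E p μ) :
    ‖f‖ ^ p.toReal = ∫ x, ‖f x‖ ^ p.toReal ∂μ := by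
  have hP : 0 < p.toReal := ENNReal.toReal_pos hp0 hp
  have hi : 0 ≤ ∫ x, ‖f x‖ ^ p.toReal ∂μ := integral_nonneg fun x => by positivity
  rw [Lp.norm_def, (Lp.memLp f).eLpNorm_eq_integral_rpow_norm hp0 hp,
    ENNReal.toReal_ofReal (by positivity), ← Real.rpow_mul hi, inv_mul_cancel₀ hP.ne',
    Real.rpow_one]

theorem tendsto_continuousLinearMap_apply₂ {V W X : Type*} [NormedAddCommGroup V]
    [NormedSpace ℂ V] [NormedAddCommGroup W] [NormedSpace ℂ W] [NormedAddCommGroup X]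
    [NormedSpace ℂ X] (B : V →L[ℂ] W →L[ℂ] X) {ι : Type*} {l : Filter ι} {x : ι → V} {x₀ : V}
    {f : ι → W} {f₀ : W} (hx : Filter.Tendsto x l (nhds x₀)) (hf : Filter.Tendsto f l (nhds f₀)) :
    Filter.Tendsto (fun n => B (x n) (f n)) l (nhds (B x₀ f₀)) :=
  (B.continuous₂.tendsto (x₀, f₀)).comp (hx.prodMk_nhds hf)

section Tensor

variable {α E : Type*} [MeasurableSpace α] [NormedAddCommGroup E] [NormedSpace ℂ E]

/-- The elementary tensor `f ⊗ x`, as a continuous bilinear map of `x` and `f`. -/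
def elemTensor (p : ℝ≥0∞) [Fact (1 ≤ p)] (μ : Measure α) :
    E →L[ℂ] Lp ℂ p μ →L[ℂ] Lp E p μ :=
  ContinuousLinearMap.compLpL₂ p μ (ContinuousLinearMap.lsmul ℂ ℂ).flip

variable {p : ℝ≥0∞} [Fact (1 ≤ p)] {μ : Measure α}

theorem coeFn_elemTensor (x : E) (f : Lp ℂ p μ) :
    ⇑(elemTensor p μ x f) =ᵐ[μ] fun ξ => f ξ • x :=
  ContinuousLinearMap.coeFn_compLp _ f

theorem elemTensor_complex (c : ℂ) (f : Lp ℂ p μ) : elemTensor p μ c f = c • f := by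
  refine Lp.ext ?_
  filter_upwards [coeFn_elemTensor c f, Lp.coeFn_smul c f] with ξ h1 h2
  rw [h1, h2, Pi.smul_apply, smul_eq_mul, smul_eq_mul, mul_comm]

theorem tendsto_elemTensor {ι : Type*} {l : Filter ι} {x : ι → E} {x₀ : E} {f : ι → Lp ℂ p μ}
    {f₀ : Lp ℂ p μ} (hx : Filter.Tendsto x l (nhds x₀)) (hf : Filter.Tendsto f l (nhds f₀)) :
    Filter.Tendsto (fun n => elemTensor p μ (x n) (f n)) l (nhds (elemTensor p μ x₀ f₀)) := by
  generalize elemTensor (E := E) p μ = B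
  exact tendsto_continuousLinearMap_apply₂ B hx hf

theorem mem_closure_span_elemTensor (hp : p ≠ ∞) (g : Lp E p μ) :
    g ∈ (Submodule.span ℂ {h | ∃ x f, h = elemTensor p μ (x : E) f}).topologicalClosure := by
  refine Lp.induction hp (fun g => g ∈ (Submodule.span ℂ
    {h | ∃ x f, h = elemTensor p μ (x : E) f}).topologicalClosure) ?_ ?_ ?_ g
  · intro c s hs hμs
    refine Submodule.le_topologicalClosure _ (Submodule.subset_span
      ⟨c, indicatorConstLp p hs hμs.ne 1, ?_⟩)
    rw [Lp.simpleFunc.coe_indicatorConst]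
    refine Lp.ext ?_
    filter_upwards [coeFn_elemTensor c (indicatorConstLp p hs hμs.ne (1 : ℂ)),
      indicatorConstLp_coeFn (p := p) (hs := hs) (hμs := hμs.ne) (c := (1 : ℂ)),
      indicatorConstLp_coeFn (p := p) (hs := hs) (hμs := hμs.ne) (c := c)] with ξ h1 h2 h3
    rw [h1, h2, h3]
    by_cases h : ξ ∈ s <;> simp [h]
  · intro f g hf hg _ h1 h2
    exact Submodule.add_mem _ h1 h2
  · exact Submodule.isClosed_topologicalClosure _

end Tensor

/-- A finite family of disjoint measurable sets with positive finite measure. -/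
structure StepSystem {α : Type*} [MeasurableSpace α] (μ : Measure α) where
  ι : Type
  [fintype : Fintype ι]
  set : ι → Set α
  measurable : ∀ i, MeasurableSet (set i)
  ne_zero : ∀ i, μ (set i) ≠ 0
  ne_top : ∀ i, μ (set i) ≠ ∞
  eq_of_mem : ∀ {i j x}, x ∈ set i → x ∈ set j → i = j

namespace StepSystem

attribute [instance] StepSystem.fintype

variable {α E : Type*} [MeasurableSpace α] [NormedAddCommGroup E] [NormedSpace ℂ E]
  {μ : Measure α} (S : StepSystem μ) (p : ℝ≥0∞)

theorem real_pos (i : S.ι) : 0 < μ.real (S.set i) :=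
  ENNReal.toReal_pos (S.ne_zero i) (S.ne_top i)

/-- The indicator function of a set of the system, normalised in `L^p`. -/
def basis (i : S.ι) : Lp ℂ p μ :=
  indicatorConstLp p (S.measurable i) (S.ne_top i) ((μ.real (S.set i) ^ (-(1 / p.toReal)) : ℝ) : ℂ)

theorem coeFn_basis (i : S.ι) : ⇑(S.basis p i) =ᵐ[μ]
    (S.set i).indicator fun _ => ((μ.real (S.set i) ^ (-(1 / p.toReal)) : ℝ) : ℂ) :=
  indicatorConstLp_coeFn

variable [hp1 : Fact (1 ≤ p)]

/-- The coordinate functionals of the averaging projection onto a step system. -/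
def coord (i : S.ι) : Lp ℂ p μ →ₗ[ℂ] ℂ where
  toFun h := ((μ.real (S.set i) ^ (1 / p.toReal) : ℝ) : ℂ) * ⨍ x in S.set i, h x ∂μ
  map_add' f g := by
    have hi : ∀ h : Lp ℂ p μ, IntegrableOn h (S.set i) μ := fun h =>
      integrableOn_Lp_of_measure_ne_top h hp1.out (S.ne_top i)
    rw [setAverage_congr_fun (S.measurable i) ((Lp.coeFn_add f g).mono fun x hx _ => hx)]
    simp only [setAverage_eq, Pi.add_apply]
    rw [integral_add (hi f) (hi g), smul_add, mul_add]
  map_smul' c f := by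
    rw [setAverage_congr_fun (S.measurable i) ((Lp.coeFn_smul c f).mono fun x hx _ => hx)]
    simp only [setAverage_eq, Pi.smul_apply]
    rw [integral_smul, smul_comm, RingHom.id_apply, smul_eq_mul c, smul_eq_mul c, mul_left_comm]

theorem coord_apply (i : S.ι) (h : Lp ℂ p μ) :
    S.coord p i h = ((μ.real (S.set i) ^ (1 / p.toReal) : ℝ) : ℂ) * ⨍ x in S.set i, h x ∂μ := rfl

/-- The averaging projection onto the span of a step system. -/
def proj : Lp ℂ p μ →ₗ[ℂ] Lp ℂ p μ :=
  ∑ i, (S.coord p i).smulRight (S.basis p i)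

theorem proj_apply (h : Lp ℂ p μ) : S.proj p h = ∑ i, S.coord p i h • S.basis p i := by
  simp [proj]

theorem coord_basis_self (i : S.ι) : S.coord p i (S.basis p i) = 1 := by
  have h0 := S.real_pos i
  rw [coord_apply, setAverage_congr_fun (S.measurable i)
    (g := fun _ => ((μ.real (S.set i) ^ (-(1 / p.toReal)) : ℝ) : ℂ))
    ((S.coeFn_basis p i).mono fun x hx hxi => by rw [hx, Set.indicator_of_mem hxi]),
    setAverage_const (S.ne_zero i) (S.ne_top i), ← Complex.ofReal_mul, ← Real.rpow_add h0]
  simp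

theorem coord_basis_of_ne {i k : S.ι} (hik : i ≠ k) : S.coord p i (S.basis p k) = 0 := by
  rw [coord_apply, setAverage_congr_fun (S.measurable i) (g := fun _ => (0 : ℂ))
    ((S.coeFn_basis p k).mono fun x hx hxi => by
      rw [hx, Set.indicator_of_notMem fun hxk => hik (S.eq_of_mem hxi hxk)])]
  simp

theorem proj_sum_smul_basis (c : S.ι → ℂ) :
    S.proj p (∑ i, c i • S.basis p i) = ∑ i, c i • S.basis p i := by
  classical
  have h : ∀ k, S.proj p (S.basis p k) = S.basis p k := by
    intro k
    rw [proj_apply, Finset.sum_eq_single k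
      (fun i _ hik => by rw [S.coord_basis_of_ne p hik, zero_smul]) (by simp),
      coord_basis_self, one_smul]
  simp [map_sum, h]

variable {p}

theorem norm_sum_elemTensor_basis_rpow (hp : p ≠ ∞) (x : S.ι → E) :
    ‖∑ i, elemTensor p μ (x i) (S.basis p i)‖ ^ p.toReal = ∑ i, ‖x i‖ ^ p.toReal := by
  have hp0 : p ≠ 0 := (zero_lt_one.trans_le hp1.out).ne'
  have hP : 0 < p.toReal := ENNReal.toReal_pos hp0 hp
  rw [Lp_norm_rpow_eq_integral hp0 hp]
  have hae : ∀ᵐ ξ ∂μ, ‖(∑ i, elemTensor p μ (x i) (S.basis p i) : Lp E p μ) ξ‖ ^ p.toReal =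
      ∑ i, (S.set i).indicator (fun _ => (μ.real (S.set i))⁻¹ * ‖x i‖ ^ p.toReal) ξ := by
    have h1 : ∀ᵐ ξ ∂μ, ∀ i, elemTensor p μ (x i) (S.basis p i) ξ = S.basis p i ξ • x i :=
      ae_all_iff.2 fun i => coeFn_elemTensor _ _
    have h2 := ae_all_iff.2 fun i => S.coeFn_basis p i
    filter_upwards [h1, h2, Lp.coeFn_fun_finsetSum Finset.univ
      fun i => elemTensor p μ (x i) (S.basis p i)] with ξ h1 h2 h3
    simp only [h3, h1, h2]
    by_cases hξ : ∃ k, ξ ∈ S.set k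
    · obtain ⟨k, hk⟩ := hξ
      have hne : ∀ i, i ≠ k → ξ ∉ S.set i := fun i hik hi => hik (S.eq_of_mem hi hk)
      have h0 := S.real_pos k
      rw [Finset.sum_eq_single k (fun i _ hi => by simp [hne i hi]) (by simp),
        Finset.sum_eq_single k (fun i _ hi => by simp [hne i hi]) (by simp),
        Set.indicator_of_mem hk, Set.indicator_of_mem hk, norm_smul, Complex.norm_real,
        Real.norm_of_nonneg (by positivity), Real.mul_rpow (by positivity) (norm_nonneg _),
        ← Real.rpow_mul h0.le, neg_mul, one_div_mul_cancel hP.ne', Real.rpow_neg_one]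
    · push Not at hξ
      simp [hξ, Real.zero_rpow hP.ne']
  rw [integral_congr_ae hae, integral_finsetSum _ fun i _ =>
    (integrable_indicator_iff (S.measurable i)).2 (integrableOn_const (S.ne_top i))]
  refine Finset.sum_congr rfl fun i _ => ?_
  have h0 := S.real_pos i
  rw [integral_indicator (S.measurable i), setIntegral_const, smul_eq_mul,
    mul_inv_cancel_left₀ h0.ne']

theorem norm_sum_smul_basis_rpow (hp : p ≠ ∞) (c : S.ι → ℂ) :
    ‖∑ i, c i • S.basis p i‖ ^ p.toReal = ∑ i, ‖c i‖ ^ p.toReal := by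
  simpa only [elemTensor_complex] using S.norm_sum_elemTensor_basis_rpow hp c

theorem sum_norm_coord_rpow_le (hp : p ≠ ∞) (h : Lp ℂ p μ) :
    ∑ i, ‖S.coord p i h‖ ^ p.toReal ≤ ‖h‖ ^ p.toReal := by
  have hp0 : p ≠ 0 := (zero_lt_one.trans_le hp1.out).ne'
  have hP : 0 < p.toReal := ENNReal.toReal_pos hp0 hp
  have hP1 : 1 ≤ p.toReal := by simpa using ENNReal.toReal_mono hp hp1.out
  have hint : Integrable (fun x => ‖h x‖ ^ p.toReal) μ :=
    (Lp.memLp h).integrable_norm_rpow hp0 hp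
  have hi : ∀ i, IntegrableOn h (S.set i) μ := fun i =>
    integrableOn_Lp_of_measure_ne_top h hp1.out (S.ne_top i)
  have key : ∀ i, ‖S.coord p i h‖ ^ p.toReal ≤ ∫ x in S.set i, ‖h x‖ ^ p.toReal ∂μ := by
    intro i
    have h0 := S.real_pos i
    have hJ := (convexOn_rpow hP1).map_set_average_le
      (continuousOn_id.rpow_const fun _ _ => Or.inr hP.le) isClosed_Ici (S.ne_zero i) (S.ne_top i)
      (f := fun x => ‖h x‖) (Filter.Eventually.of_forall fun x => norm_nonneg _) (hi i).norm
      hint.integrableOn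
    have hN : ‖⨍ x in S.set i, h x ∂μ‖ ≤ ⨍ x in S.set i, ‖h x‖ ∂μ := by
      rw [setAverage_eq, setAverage_eq, norm_smul, smul_eq_mul, Real.norm_of_nonneg (by positivity)]
      exact mul_le_mul_of_nonneg_left (norm_integral_le_integral_norm _) (by positivity)
    rw [coord_apply, norm_mul, Complex.norm_real, Real.norm_of_nonneg (by positivity),
      Real.mul_rpow (by positivity) (norm_nonneg _), ← Real.rpow_mul h0.le,
      one_div_mul_cancel hP.ne', Real.rpow_one]
    refine (mul_le_mul_of_nonneg_left ((Real.rpow_le_rpow (norm_nonneg _) hN hP.le).trans hJ)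
      h0.le).trans (le_of_eq ?_)
    rw [setAverage_eq, smul_eq_mul, mul_inv_cancel_left₀ h0.ne']
  refine (Finset.sum_le_sum fun i _ => key i).trans ?_
  rw [← integral_iUnion_fintype S.measurable (fun i j hij => Set.disjoint_left.2
    fun x hi hj => hij (S.eq_of_mem hi hj)) fun i => hint.integrableOn,
    Lp_norm_rpow_eq_integral hp0 hp]
  exact setIntegral_le_integral hint (Filter.Eventually.of_forall fun x => by positivity)

theorem norm_proj_le (hp : p ≠ ∞) (h : Lp ℂ p μ) : ‖S.proj p h‖ ≤ ‖h‖ := by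
  have hP : 0 < p.toReal := ENNReal.toReal_pos (zero_lt_one.trans_le hp1.out).ne' hp
  rw [← Real.rpow_le_rpow_iff (norm_nonneg _) (norm_nonneg _) hP, proj_apply,
    norm_sum_smul_basis_rpow S hp]
  exact S.sum_norm_coord_rpow_le hp h

end StepSystem

/-- Finitely many simple functions in `L^p` lie in the span of a common step system. -/
theorem exists_stepSystem_of_simpleFunc {α : Type*} [MeasurableSpace α] {μ : Measure α}
    {p : ℝ≥0∞} [hp1 : Fact (1 ≤ p)] (hp : p ≠ ∞) {K : Type} [Fintype K] (s : K → SimpleFunc α ℂ)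
    (hs : ∀ k, MemLp (s k) p μ) :
    ∃ S : StepSystem μ, ∀ k, ∃ c : S.ι → ℂ, (hs k).toLp (s k) = ∑ i, c i • S.basis p i := by
  classical
  have hp0 : p ≠ 0 := (zero_lt_one.trans_le hp1.out).ne'
  let U : α → K → ℂ := fun y k => s k y
  have hU : Measurable U := measurable_pi_lambda _ fun k => (s k).measurable
  have hfin : (Set.range U).Finite := (Set.Finite.pi' fun k => (s k).finite_range).subset <| by
    rintro _ ⟨y, rfl⟩ k
    exact ⟨y, rfl⟩
  let V : Set (K → ℂ) := {v | v ∈ Set.range U ∧ v ≠ 0 ∧ μ (U ⁻¹' {v}) ≠ 0}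
  have hV : V.Finite := hfin.subset fun v hv => hv.1
  let _ : Fintype V := hV.fintype
  let r : V ≃ Fin (Fintype.card V) := Fintype.equivFin V
  let S : StepSystem μ :=
    { ι := Fin (Fintype.card V)
      set := fun i => U ⁻¹' {(r.symm i : K → ℂ)}
      measurable := fun i => hU (measurableSet_singleton _)
      ne_zero := fun i => (r.symm i).2.2.2
      ne_top := fun i => by
        obtain ⟨k, hk⟩ := Function.ne_iff.1 (r.symm i).2.2.1
        refine ne_top_of_le_ne_top ((s k).measure_preimage_lt_top_of_memLp hp0 hp (hs k)
          ((r.symm i : K → ℂ) k) hk).ne (measure_mono fun y hy => ?_)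
        exact congrFun (show U y = _ from hy) k
      eq_of_mem := fun {i j x} hi hj => r.symm.injective (Subtype.ext
        ((show U x = _ from hi).symm.trans (show U x = _ from hj))) }
  refine ⟨S, fun k => ⟨fun i => (r.symm i : K → ℂ) k *
    ((μ.real (S.set i) ^ (1 / p.toReal) : ℝ) : ℂ), ?_⟩⟩
  refine Lp.ext ?_
  have hnull : ∀ᵐ y ∂μ, ∀ v ∈ Set.range U, μ (U ⁻¹' {v}) = 0 → U y ≠ v := by
    rw [ae_ball_iff hfin.countable]
    intro v _
    by_cases h : μ (U ⁻¹' {v}) = 0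
    · filter_upwards [compl_mem_ae_iff.2 h] with y hy _ hyv using hy hyv
    · exact Filter.Eventually.of_forall fun y h' => absurd h' h
  filter_upwards [hnull, (hs k).coeFn_toLp, ae_all_iff.2 fun i => S.coeFn_basis p i,
    Lp.coeFn_fun_finsetSum Finset.univ fun i : S.ι => ((r.symm i : K → ℂ) k *
      ((μ.real (S.set i) ^ (1 / p.toReal) : ℝ) : ℂ)) • S.basis p i,
    ae_all_iff.2 fun i : S.ι => Lp.coeFn_smul ((r.symm i : K → ℂ) k *
      ((μ.real (S.set i) ^ (1 / p.toReal) : ℝ) : ℂ)) (S.basis p i)] with y h1 h2 h3 h4 h5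
  simp only [h2, h4, h5, Pi.smul_apply, h3]
  by_cases hy : U y ∈ V
  · have hmem : y ∈ S.set (r ⟨U y, hy⟩) := by simp [S]
    have h0 := S.real_pos (r ⟨U y, hy⟩)
    rw [Finset.sum_eq_single (r ⟨U y, hy⟩) (fun i _ hi => by
      rw [Set.indicator_of_notMem fun hyi => hi (S.eq_of_mem hyi hmem), smul_zero]) (by simp),
      Set.indicator_of_mem hmem, smul_eq_mul, mul_assoc, ← Complex.ofReal_mul,
      ← Real.rpow_add h0]
    simp [U]
  · have hz : U y = 0 := by
      by_contra h
      exact hy ⟨⟨y, rfl⟩, h, fun h' => h1 _ ⟨y, rfl⟩ h' rfl⟩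
    have hyi : ∀ i, y ∉ S.set i := by
      intro i hyi
      have h : U y = r.symm i := hyi
      exact hy (h ▸ (r.symm i).2)
    rw [Finset.sum_eq_zero fun i _ => by rw [Set.indicator_of_notMem (hyi i), smul_zero]]
    exact congrFun hz k

theorem exists_stepSystem_norm_proj_sub_lt {α : Type*} [MeasurableSpace α] {μ : Measure α}
    {p : ℝ≥0∞} [hp1 : Fact (1 ≤ p)] (hp : p ≠ ∞) {K : Type} [Fintype K] (f : K → Lp ℂ p μ)
    {ε : ℝ} (hε : 0 < ε) : ∃ S : StepSystem μ, ∀ k, ‖S.proj p (f k) - f k‖ < ε := by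
  choose s hs hmem using fun k => (Lp.memLp (f k)).exists_simpleFunc_eLpNorm_sub_lt hp
    (ε := ENNReal.ofReal (ε / 2)) (by simpa using hε)
  obtain ⟨S, hS⟩ := exists_stepSystem_of_simpleFunc hp s hmem
  refine ⟨S, fun k => ?_⟩
  obtain ⟨c, hc⟩ := hS k
  set g := (hmem k).toLp (s k) with hg
  have hPg : S.proj p g = g := by rw [hc, S.proj_sum_smul_basis]
  have hfg : ‖f k - g‖ < ε / 2 := by
    rw [Lp.norm_def, ← ENNReal.toReal_ofReal (half_pos hε).le,
      ENNReal.toReal_lt_toReal (Lp.eLpNorm_ne_top _) ENNReal.ofReal_ne_top]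
    refine lt_of_eq_of_lt (eLpNorm_congr_ae ?_) (hs k)
    filter_upwards [Lp.coeFn_sub (f k) g, (hmem k).coeFn_toLp] with x h1 h2
    rw [h1, Pi.sub_apply, Pi.sub_apply, h2]
  calc ‖S.proj p (f k) - f k‖ = ‖S.proj p (f k - g) - (f k - g)‖ := by
        rw [map_sub, hPg]; congr 1; abel
    _ ≤ ‖f k - g‖ + ‖f k - g‖ := (norm_sub_le _ _).trans (by gcongr; exact S.norm_proj_le hp _)
    _ < ε := by linarith

theorem exists_seq_stepSystem_tendsto {α : Type*} [MeasurableSpace α] {μ : Measure α}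
    {p : ℝ≥0∞} [hp1 : Fact (1 ≤ p)] (hp : p ≠ ∞) {K : Type} [Fintype K] (f : K → Lp ℂ p μ) :
    ∃ S : ℕ → StepSystem μ, ∀ k, Filter.Tendsto (fun n => (S n).proj p (f k)) Filter.atTop
      (nhds (f k)) := by
  choose S hS using fun n : ℕ =>
    exists_stepSystem_norm_proj_sub_lt hp f (ε := 1 / ((n : ℝ) + 1)) (by positivity)
  refine ⟨S, fun k => tendsto_iff_norm_sub_tendsto_zero.2 ?_⟩
  exact squeeze_zero (fun _ => norm_nonneg _) (fun n => (hS n k).le)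
    tendsto_one_div_add_atTop_nhds_zero_nat

section Main

variable {G : Type*} [MeasurableSpace G] {μ : Measure G} {H : Type*} [MeasurableSpace H]
  {ν : Measure H} {p q : ℝ≥0∞} [hp1 : Fact (1 ≤ p)] [hq1 : Fact (1 ≤ q)]

theorem norm_sum_elemTensor_step_le (hp : p ≠ ∞) (hq : q ≠ ∞)
    (hpq : (p ≤ q ∧ q ≤ 2) ∨ (2 ≤ q ∧ q ≤ p)) (T : Lp ℂ p μ →L[ℂ] Lp ℂ p μ) {K : Type} [Fintype K]
    (S R : StepSystem μ) (Q : StepSystem ν) (f : K → Lp ℂ p μ) (u : K → Lp ℂ q ν) :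
    ‖∑ k, elemTensor p μ (Q.proj q (u k)) (R.proj p (T (S.proj p (f k))))‖ ≤
      ‖T‖ * ‖∑ k, elemTensor p μ (Q.proj q (u k)) (S.proj p (f k))‖ := by
  have hP1 : 1 ≤ p.toReal := by simpa using ENNReal.toReal_mono hp hp1.out
  have hQ1 : 1 ≤ q.toReal := by simpa using ENNReal.toReal_mono hq hq1.out
  have hP : 0 < p.toReal := by linarith
  have hQ : 0 < q.toReal := by linarith
  have hpq' : (p.toReal ≤ q.toReal ∧ q.toReal ≤ 2) ∨ (2 ≤ q.toReal ∧ q.toReal ≤ p.toReal) := by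
    refine hpq.imp (fun h => ⟨ENNReal.toReal_mono hq h.1, ?_⟩)
      fun h => ⟨?_, ENNReal.toReal_mono hp h.2⟩
    · simpa using ENNReal.toReal_mono ENNReal.ofNat_ne_top h.2
    · simpa using ENNReal.toReal_mono hq h.1
  let M : R.ι → S.ι → ℂ := fun i a => R.coord p i (T (S.basis p a))
  let c : S.ι → Q.ι → ℂ := fun a j => ∑ k, S.coord p a (f k) * Q.coord q j (u k)
  have hM : ∀ x : S.ι → ℂ, ∑ i, ‖∑ a, M i a * x a‖ ^ p.toReal ≤
      ‖T‖ ^ p.toReal * ∑ a, ‖x a‖ ^ p.toReal := by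
    intro x
    have e : ∀ i, ∑ a, M i a * x a = R.coord p i (T (∑ a, x a • S.basis p a)) := fun i => by
      simp [M, map_sum, mul_comm]
    simp only [e]
    refine (R.sum_norm_coord_rpow_le hp _).trans ?_
    rw [← S.norm_sum_smul_basis_rpow hp x, ← Real.mul_rpow (norm_nonneg _) (norm_nonneg _)]
    exact Real.rpow_le_rpow (norm_nonneg _) (T.le_opNorm _) hP.le
  have hv : ∀ y : Q.ι → ℂ, ‖∑ j, y j • Q.basis q j‖ ^ p.toReal =
      (∑ j, ‖y j‖ ^ q.toReal) ^ (p.toReal / q.toReal) := by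
    intro y
    rw [← Q.norm_sum_smul_basis_rpow hq, ← Real.rpow_mul (norm_nonneg _),
      mul_div_cancel₀ _ hQ.ne']
  have hsrc : ∑ k, elemTensor p μ (Q.proj q (u k)) (S.proj p (f k)) =
      ∑ a, elemTensor p μ (∑ j, c a j • Q.basis q j) (S.basis p a) := by
    have : ∀ a, ∑ j, c a j • Q.basis q j = ∑ k, S.coord p a (f k) • Q.proj q (u k) := by
      intro a
      simp only [c, Finset.sum_smul, StepSystem.proj_apply, Finset.smul_sum, smul_smul]
      exact Finset.sum_comm
    simp only [this, S.proj_apply p, map_sum, map_smul, sum_apply,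
      smul_apply]
    exact Finset.sum_comm
  have htgt : ∑ k, elemTensor p μ (Q.proj q (u k)) (R.proj p (T (S.proj p (f k)))) =
      ∑ i, elemTensor p μ (∑ j, (∑ a, M i a * c a j) • Q.basis q j) (R.basis p i) := by
    have h1 : ∀ i k, R.coord p i (T (S.proj p (f k))) = ∑ a, M i a * S.coord p a (f k) := by
      intro i k
      simp [M, S.proj_apply p, map_sum, mul_comm]
    have h2 : ∀ i, ∑ j, (∑ a, M i a * c a j) • Q.basis q j =
        ∑ k, R.coord p i (T (S.proj p (f k))) • Q.proj q (u k) := by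
      intro i
      simp only [h1, Q.proj_apply q, Finset.smul_sum, smul_smul]
      rw [Finset.sum_comm]
      refine Finset.sum_congr rfl fun j _ => ?_
      rw [← Finset.sum_smul]
      congr 1
      simp only [c, Finset.mul_sum, Finset.sum_mul, mul_assoc]
      exact Finset.sum_comm
    simp only [h2, R.proj_apply p, map_sum, map_smul, sum_apply,
      smul_apply]
    exact Finset.sum_comm
  rw [← Real.rpow_le_rpow_iff (norm_nonneg _) (by positivity) hP,
    Real.mul_rpow (norm_nonneg _) (norm_nonneg _), hsrc, htgt,
    R.norm_sum_elemTensor_basis_rpow hp, S.norm_sum_elemTensor_basis_rpow hp]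
  simp only [hv]
  exact mixedBound_of_exponents hP1 hQ1 hpq' (norm_nonneg T) hM c

theorem norm_sum_elemTensor_le (hp : p ≠ ∞) (hq : q ≠ ∞)
    (hpq : (p ≤ q ∧ q ≤ 2) ∨ (2 ≤ q ∧ q ≤ p)) (T : Lp ℂ p μ →L[ℂ] Lp ℂ p μ) {K : Type} [Fintype K]
    (f : K → Lp ℂ p μ) (u : K → Lp ℂ q ν) :
    ‖∑ k, elemTensor p μ (u k) (T (f k))‖ ≤ ‖T‖ * ‖∑ k, elemTensor p μ (u k) (f k)‖ := by
  obtain ⟨S, hS⟩ := exists_seq_stepSystem_tendsto hp f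
  obtain ⟨R, hR⟩ := exists_seq_stepSystem_tendsto hp fun k => T (f k)
  obtain ⟨Q, hQ⟩ := exists_seq_stepSystem_tendsto hq u
  have hRT : ∀ k, Filter.Tendsto (fun n => (R n).proj p (T ((S n).proj p (f k)))) Filter.atTop
      (nhds (T (f k))) := by
    intro k
    have h1 : Filter.Tendsto (fun n => (R n).proj p (T ((S n).proj p (f k)) - T (f k)))
        Filter.atTop (nhds 0) := by
      refine squeeze_zero_norm (fun n => (R n).norm_proj_le hp _) ?_
      exact tendsto_iff_norm_sub_tendsto_zero.1 ((T.continuous.tendsto _).comp (hS k))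
    simpa using h1.add (hR k)
  have hB : ∀ {h : ℕ → K → Lp ℂ p μ} {h' : K → Lp ℂ p μ},
      (∀ k, Filter.Tendsto (fun n => h n k) Filter.atTop (nhds (h' k))) →
      Filter.Tendsto (fun n => ‖∑ k, elemTensor p μ ((Q n).proj q (u k)) (h n k)‖) Filter.atTop
        (nhds ‖∑ k, elemTensor p μ (u k) (h' k)‖) := by
    intro h h' hh
    refine (tendsto_finsetSum _ fun k _ => ?_).norm
    exact tendsto_elemTensor (hQ k) (hh k)
  exact le_of_tendsto_of_tendsto' (hB hRT) ((hB hS).const_mul _) fun n =>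
    norm_sum_elemTensor_step_le hp hq hpq T (S n) (R n) (Q n) f u

end Main

theorem stmt13 (G : Type) [MeasurableSpace G] (μ : Measure G) [SigmaFinite μ]
    (H : Type) [MeasurableSpace H] (ν : Measure H) [SigmaFinite ν]
    (p q : ℝ≥0∞) [Fact (1 ≤ p)] [Fact (1 ≤ q)] (hp : p ≠ ∞) (hq : q ≠ ∞)
    (hpq : (p ≤ q ∧ q ≤ 2) ∨ (2 ≤ q ∧ q ≤ p))
    (T : Lp ℂ p μ →L[ℂ] Lp ℂ p μ) :
    ∃ Ttil : Lp (Lp ℂ q ν) p μ →L[ℂ] Lp (Lp ℂ q ν) p μ,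
      ‖Ttil‖ ≤ ‖T‖ ∧
      ∀ (f : Lp ℂ p μ) (u : Lp ℂ q ν) (g : Lp (Lp ℂ q ν) p μ),
        (⇑g =ᵐ[μ] fun ξ => f ξ • u) →
          ⇑(Ttil g) =ᵐ[μ] fun ξ => (T f) ξ • u := by
  let e : (Lp ℂ p μ × Lp ℂ q ν →₀ ℂ) →ₗ[ℂ] Lp (Lp ℂ q ν) p μ :=
    Finsupp.linearCombination ℂ fun z => elemTensor p μ z.2 z.1
  let e' : (Lp ℂ p μ × Lp ℂ q ν →₀ ℂ) →ₗ[ℂ] Lp (Lp ℂ q ν) p μ :=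
    Finsupp.linearCombination ℂ fun z => elemTensor p μ z.2 (T z.1)
  have hdense : DenseRange e := by
    intro g
    have hle : Submodule.span ℂ {h | ∃ x f, h = elemTensor p μ x f} ≤ LinearMap.range e := by
      refine Submodule.span_le.2 ?_
      rintro _ ⟨x, f, rfl⟩
      exact ⟨Finsupp.single (f, x) 1, by simp [e]⟩
    exact closure_mono (fun h hh => hle hh) (mem_closure_span_elemTensor hp g)
  have hbound : ∀ x, ‖e' x‖ ≤ ‖T‖ * ‖e x‖ := by
    intro x
    have := norm_sum_elemTensor_le hp hq hpq T (fun z : x.support => z.1.1)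
      fun z : x.support => x z.1 • z.1.2
    simp only [map_smul, smul_apply] at this
    simp only [e, e', Finsupp.linearCombination_apply, Finsupp.sum]
    rwa [← Finset.sum_coe_sort x.support, ← Finset.sum_coe_sort x.support]
  refine ⟨e'.extendOfNorm e, LinearMap.opNorm_extendOfNorm_le hdense (norm_nonneg T) hbound,
    fun f u g hg => ?_⟩
  have hge : g = e (Finsupp.single (f, u) 1) := by
    have : e (Finsupp.single (f, u) 1) = elemTensor p μ u f := by simp [e]
    rw [this]
    exact Lp.ext (hg.trans (coeFn_elemTensor u f).symm)
  have hTg : e'.extendOfNorm e g = elemTensor p μ u (T f) := by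
    rw [hge, LinearMap.extendOfNorm_eq hdense ⟨_, hbound⟩]
    simp [e']
  rw [hTg]
  exact coeFn_elemTensor u (T f)

end
end

section
/- Let d ≥ 2, 1 < p < ∞ and w ∈ A_p^{d/2−1}(ℝ⁺). Then the linear span V of the Hermite functions is dense in the mixed norm space L^{p,2}(ℝ^d, w(r)r^{d−1}dr dσ(ω)): for every measurable f : ℝ^d → ℂ with ‖f‖_{p,2} := (∫₀^∞ (∫_{S^{d−1}} |f(rω)|² dσ(ω))^{p/2} w(r) r^{d−1} dr)^{1/p} < ∞ and every ε > 0, there exists g ∈ V with ‖f − g‖_{p,2} < ε. -/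
open MeasureTheory Finset
open scoped ENNReal

noncomputable section

def physHermite : ℕ → Polynomial ℝ
  | 0 => 1
  | n + 1 => Polynomial.C 2 * Polynomial.X * physHermite n - Polynomial.derivative (physHermite n)

/-- normalized 1D Hermite function -/
def hermiteFun (k : ℕ) (t : ℝ) : ℝ :=
  ((2 : ℝ) ^ k * (Nat.factorial k) * Real.sqrt Real.pi) ^ (-(1/2) : ℝ) *
    (physHermite k).eval t * Real.exp (-t ^ 2 / 2)

/-- Hermite functions on ℝ^d -/
def hermitePhi {d : ℕ} (α : Fin d → ℕ) (x : EuclideanSpace ℝ (Fin d)) : ℝ :=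
  ∏ i, hermiteFun (α i) (x i)

def hermitePhiC {d : ℕ} (α : Fin d → ℕ) (x : EuclideanSpace ℝ (Fin d)) : ℂ :=
  (hermitePhi α x : ℂ)

/-- eigenvalue factor (2|α|+d)^{-1/2} -/
def lamH (d : ℕ) (α : Fin d → ℕ) : ℝ :=
  (Real.sqrt (2 * (∑ i, α i) + d))⁻¹

/-- f = ∑ c_α Φ_α -/
def hermComb {d : ℕ} (c : (Fin d → ℕ) →₀ ℂ) (x : EuclideanSpace ℝ (Fin d)) : ℂ :=
  ∑ α ∈ c.support, c α * hermitePhiC α x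

/-- R_j f = (∂_j + x_j) H^{-1/2} f for f = ∑ c_α Φ_α -/
def hermRiesz {d : ℕ} (c : (Fin d → ℕ) →₀ ℂ) (j : Fin d) (x : EuclideanSpace ℝ (Fin d)) : ℂ :=
  ∑ α ∈ c.support, c α * (lamH d α : ℂ) *
    (fderiv ℝ (hermitePhiC α) x (EuclideanSpace.single j 1) + (x j : ℂ) * hermitePhiC α x)

/-- measure dμ_δ = t^{2δ+1} dt on (0,∞) -/
def muDelta (δ : ℝ) : Measure ℝ :=
  (volume.restrict (Set.Ioi (0:ℝ))).withDensity fun t => ENNReal.ofReal (t ^ (2 * δ + 1))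

/-- Muckenhoupt A_p^δ class on ℝ⁺ -/
def IsApWeight (δ p : ℝ) (w : ℝ → ℝ) : Prop :=
  Measurable w ∧ (∀ r > 0, 0 < w r) ∧
  ∃ A : ℝ≥0∞, A ≠ ∞ ∧ ∀ a b : ℝ, 0 ≤ a → a < b →
    ((muDelta δ (Set.Ioc a b))⁻¹ * ∫⁻ t in Set.Ioc a b, ENNReal.ofReal (w t) ∂(muDelta δ)) *
      ((muDelta δ (Set.Ioc a b))⁻¹ *
        ∫⁻ t in Set.Ioc a b, ENNReal.ofReal (w t ^ (-1 / (p - 1))) ∂(muDelta δ)) ^ (p - 1) ≤ A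

/-- weighted mixed L^{p,2} norm (p-th power omitted: this is the full expression to power 1/p) -/
def mixedNorm (d : ℕ) (p : ℝ) (w : ℝ → ℝ) (f : EuclideanSpace ℝ (Fin d) → ℂ) : ℝ≥0∞ :=
  (∫⁻ r in Set.Ioi (0:ℝ),
      (∫⁻ ω : Metric.sphere (0 : EuclideanSpace ℝ (Fin d)) 1,
          ENNReal.ofReal (‖f (r • (ω : EuclideanSpace ℝ (Fin d)))‖ ^ 2) ∂(sphereMeasure d)) ^ (p / 2)
        * ENNReal.ofReal (w r * r ^ (d - 1 : ℝ))) ^ (1 / p)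

/-! ### Gaussian-weighted polynomials lie in the span of the Hermite functions -/

theorem degree_physHermite (n : ℕ) : (physHermite n).degree = n := by
  induction n with
  | zero => simp [physHermite]
  | succ n ih =>
    have h0 : physHermite n ≠ 0 := fun h => by simp [h] at ih
    have h1 : (Polynomial.C 2 * Polynomial.X * physHermite n : Polynomial ℝ).degree =
        ((n + 1 : ℕ) : WithBot ℕ) := by
      rw [mul_assoc, Polynomial.degree_C_mul two_ne_zero, Polynomial.degree_mul, ih,
        Polynomial.degree_X, add_comm]
      norm_cast
    have h2 : (Polynomial.derivative (physHermite n)).degree <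
        (Polynomial.C 2 * Polynomial.X * physHermite n : Polynomial ℝ).degree := by
      rw [h1]
      refine (Polynomial.degree_derivative_lt h0).trans ?_
      rw [ih]
      exact_mod_cast Nat.lt_succ_self n
    rw [physHermite, Polynomial.degree_sub_eq_left_of_degree_lt h2, h1]

theorem span_physHermite : Submodule.span ℝ (Set.range physHermite) = ⊤ := by
  let S : Polynomial.Sequence ℝ := ⟨physHermite, degree_physHermite⟩
  exact S.span fun i => (Polynomial.leadingCoeff_ne_zero.2 (S.ne_zero i)).isUnit

theorem eval_mul_exp_mem_span_hermiteFun (q : Polynomial ℝ) :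
    (fun t : ℝ => q.eval t * Real.exp (-t ^ 2 / 2)) ∈
      Submodule.span ℝ (Set.range hermiteFun) := by
  have hq : q ∈ Submodule.span ℝ (Set.range physHermite) := by
    rw [span_physHermite]; trivial
  induction hq using Submodule.span_induction with
  | mem q hq =>
    obtain ⟨k, rfl⟩ := hq
    have hc : ((2 : ℝ) ^ k * (Nat.factorial k) * Real.sqrt Real.pi) ^ (-(1/2) : ℝ) ≠ 0 := by
      have := Real.pi_pos
      positivity
    have : (fun t : ℝ => (physHermite k).eval t * Real.exp (-t ^ 2 / 2)) =
        (((2 : ℝ) ^ k * (Nat.factorial k) * Real.sqrt Real.pi) ^ (-(1/2) : ℝ))⁻¹ •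
          hermiteFun k := by
      ext t
      simp only [Pi.smul_apply, smul_eq_mul, hermiteFun]
      rw [eq_inv_mul_iff_mul_eq₀ hc]
      exact (mul_assoc _ _ _).symm
    rw [this]
    exact Submodule.smul_mem _ _ (Submodule.subset_span ⟨k, rfl⟩)
  | zero => simp only [Polynomial.eval_zero, zero_mul]; exact Submodule.zero_mem _
  | add q r _ _ hq hr =>
    convert Submodule.add_mem _ hq hr using 1
    ext t; simp [add_mul]
  | smul a q _ hq =>
    convert Submodule.smul_mem _ a hq using 1
    ext t; simp [mul_assoc]

theorem prod_mem_span_hermitePhiC {d : ℕ} (u : Fin d → ℝ → ℝ)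
    (hu : ∀ i, u i ∈ Submodule.span ℝ (Set.range hermiteFun)) :
    (fun x : EuclideanSpace ℝ (Fin d) => ((∏ i, u i (x i) : ℝ) : ℂ)) ∈
      Submodule.span ℂ (Set.range fun α : Fin d → ℕ => hermitePhiC α) := by
  simp only [Finsupp.mem_span_range_iff_exists_finsupp] at hu
  choose c hc using hu
  have : (fun x : EuclideanSpace ℝ (Fin d) => ((∏ i, u i (x i) : ℝ) : ℂ)) =
      ∑ α ∈ Fintype.piFinset fun i => (c i).support,
        ((∏ i, c i (α i) : ℝ) : ℂ) • hermitePhiC α := by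
    ext x
    simp only [Finset.sum_apply, Pi.smul_apply, hermitePhiC, hermitePhi, smul_eq_mul]
    simp_rw [← Complex.ofReal_mul, ← Complex.ofReal_sum, ← Finset.prod_mul_distrib]
    rw [← Finset.prod_univ_sum (fun i => (c i).support)
      (fun i j => c i j * hermiteFun j (x i))]
    congr 1
    refine Finset.prod_congr rfl fun i _ => ?_
    rw [← hc i]
    simp [Finsupp.sum, Finset.sum_apply]
  rw [this]
  exact Submodule.sum_mem _ fun α _ =>
    Submodule.smul_mem _ _ (Submodule.subset_span ⟨α, rfl⟩)

/-- Evaluation of a complex polynomial at a real vector. -/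
def polyEval {d : ℕ} (P : MvPolynomial (Fin d) ℂ) (x : EuclideanSpace ℝ (Fin d)) : ℂ :=
  MvPolynomial.eval (fun i => (x i : ℂ)) P

theorem continuous_polyEval {d : ℕ} (P : MvPolynomial (Fin d) ℂ) :
    Continuous (polyEval P) := by
  unfold polyEval
  simp_rw [MvPolynomial.eval_eq']
  fun_prop

theorem polyEval_mul_exp_mem_span {d : ℕ} (P : MvPolynomial (Fin d) ℂ) :
    (fun x => polyEval P x * (Real.exp (-‖x‖ ^ 2 / 2) : ℂ)) ∈
      Submodule.span ℂ (Set.range fun α : Fin d → ℕ => hermitePhiC α) := by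
  have : (fun x => polyEval P x * (Real.exp (-‖x‖ ^ 2 / 2) : ℂ)) =
      ∑ m ∈ P.support, P.coeff m • fun x : EuclideanSpace ℝ (Fin d) =>
        ((∏ i, ((Polynomial.X ^ m i : Polynomial ℝ).eval (x i) *
          Real.exp (-x i ^ 2 / 2)) : ℝ) : ℂ) := by
    ext x
    simp only [polyEval, MvPolynomial.eval_eq', Finset.sum_apply, Pi.smul_apply, smul_eq_mul,
      Finset.sum_mul, Polynomial.eval_pow, Polynomial.eval_X, Finset.prod_mul_distrib,
      ← Real.exp_sum, EuclideanSpace.real_norm_sq_eq]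
    refine Finset.sum_congr rfl fun m _ => ?_
    rw [← Finset.sum_div, Finset.sum_neg_distrib]
    push_cast
    ring
  rw [this]
  exact Submodule.sum_mem _ fun m _ => Submodule.smul_mem _ _
    (prod_mem_span_hermitePhiC
      (fun i t => (Polynomial.X ^ m i : Polynomial ℝ).eval t * Real.exp (-t ^ 2 / 2))
      fun i => eval_mul_exp_mem_span_hermiteFun _)

/-! ### Polynomials are dense in `L^q` of a measure with exponential moments -/

open Filter Topology in
theorem tendsto_eLpNorm_sub_of_dominated {α : Type*} [MeasurableSpace α] {m : Measure α}
    {q : ℝ≥0∞} (hq0 : q ≠ 0) (hq : q ≠ ∞) {F : ℕ → α → ℂ} {f : α → ℂ} {g : α → ℝ}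
    (hg : MemLp g q m) (hF : ∀ n, AEStronglyMeasurable (F n) m)
    (hbound : ∀ n x, ‖F n x‖ ≤ g x)
    (hlim : ∀ x, Tendsto (fun n => F n x) atTop (𝓝 (f x))) :
    Tendsto (fun n => eLpNorm (f - F n) q m) atTop (𝓝 0) := by
  have hq' : 0 < q.toReal := ENNReal.toReal_pos hq0 hq
  have hf : AEStronglyMeasurable f m :=
    aestronglyMeasurable_of_tendsto_ae atTop hF (Eventually.of_forall hlim)
  have hfb : ∀ x, ‖f x‖ ≤ g x := fun x =>
    le_of_tendsto (hlim x).norm (Eventually.of_forall fun n => hbound n x)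
  simp_rw [eLpNorm_eq_lintegral_rpow_enorm_toReal hq0 hq]
  have h2 : MemLp ((2 : ℝ) • g) q m := hg.const_smul 2
  have key : Tendsto (fun n => ∫⁻ x, ‖(f - F n) x‖ₑ ^ q.toReal ∂m) atTop (𝓝 (∫⁻ _, 0 ∂m)) := by
    refine tendsto_lintegral_of_dominated_convergence'
      (fun x => ‖((2 : ℝ) • g) x‖ₑ ^ q.toReal) (fun n => ?_) (fun n => ?_) ?_ ?_
    · exact ((hf.sub (hF n)).enorm).pow_const _
    · refine Eventually.of_forall fun x => ?_
      refine ENNReal.rpow_le_rpow ?_ hq'.le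
      refine enorm_le_iff_norm_le.2 ?_
      have h1 := norm_sub_le (f x) (F n x)
      have h3 : ‖((2 : ℝ) • g) x‖ = 2 * |g x| := by simp
      rw [h3, Pi.sub_apply]
      linarith [hfb x, hbound n x, le_abs_self (g x)]
    · exact (lintegral_rpow_enorm_lt_top_of_eLpNorm_lt_top hq0 hq h2.2).ne
    · refine Eventually.of_forall fun x => ?_
      have h1 : Tendsto (fun n => ‖f x - F n x‖ₑ) atTop (𝓝 0) := by
        have := (tendsto_const_nhds (x := f x)).sub (hlim x)
        rw [sub_self] at this
        simpa using this.enorm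
      have := (ENNReal.continuous_rpow_const (y := q.toReal)).continuousAt.tendsto.comp h1
      simpa [Function.comp_def, ENNReal.zero_rpow_of_pos hq'] using this
  rw [lintegral_zero] at key
  have := (ENNReal.continuous_rpow_const (y := 1 / q.toReal)).continuousAt.tendsto.comp key
  simpa [Function.comp_def, ENNReal.zero_rpow_of_pos (inv_pos.2 hq')] using this

/-- `F` is in the `L^q(m)`-closure of the polynomials. -/
def PolyApprox {d : ℕ} (m : Measure (EuclideanSpace ℝ (Fin d))) (q : ℝ≥0∞)
    (F : EuclideanSpace ℝ (Fin d) → ℂ) : Prop :=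
  ∀ ε : ℝ≥0∞, ε ≠ 0 → ∃ P : MvPolynomial (Fin d) ℂ, eLpNorm (F - polyEval P) q m ≤ ε

section PolyApprox

variable {d : ℕ} {m : Measure (EuclideanSpace ℝ (Fin d))} {q : ℝ≥0∞}
  {F G : EuclideanSpace ℝ (Fin d) → ℂ}

theorem PolyApprox.of_forall_exists (hq : 1 ≤ q) (hF : AEStronglyMeasurable F m)
    (h : ∀ ε : ℝ≥0∞, ε ≠ 0 → ∃ G, AEStronglyMeasurable G m ∧ PolyApprox m q G ∧
      eLpNorm (F - G) q m ≤ ε) : PolyApprox m q F := by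
  intro ε hε
  have hε' : ε / 2 ≠ 0 := by simpa using hε
  obtain ⟨G, hGm, hG, hFG⟩ := h _ hε'
  obtain ⟨P, hP⟩ := hG _ hε'
  refine ⟨P, ?_⟩
  have : F - polyEval P = (F - G) + (G - polyEval P) := by simp
  rw [this, ← ENNReal.add_halves ε]
  exact (eLpNorm_add_le (hF.sub hGm)
    (hGm.sub (continuous_polyEval P).aestronglyMeasurable) hq).trans (add_le_add hFG hP)

open Filter Topology in
theorem PolyApprox.of_tendsto_of_dominated (hq : 1 ≤ q) (hq' : q ≠ ∞)
    {F : ℕ → EuclideanSpace ℝ (Fin d) → ℂ} {f : EuclideanSpace ℝ (Fin d) → ℂ}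
    {g : EuclideanSpace ℝ (Fin d) → ℝ} (hg : MemLp g q m)
    (hF : ∀ n, AEStronglyMeasurable (F n) m) (hFp : ∀ n, PolyApprox m q (F n))
    (hbound : ∀ n x, ‖F n x‖ ≤ g x)
    (hlim : ∀ x, Tendsto (fun n => F n x) atTop (𝓝 (f x))) : PolyApprox m q f := by
  refine PolyApprox.of_forall_exists hq
    (aestronglyMeasurable_of_tendsto_ae atTop hF (Eventually.of_forall hlim)) fun ε hε => ?_
  have h := tendsto_eLpNorm_sub_of_dominated (zero_lt_one.trans_le hq).ne' hq' hg hF hbound hlim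
  obtain ⟨n, hn⟩ := (h.eventually (gt_mem_nhds hε.bot_lt)).exists
  exact ⟨F n, hF n, hFp n, hn.le⟩

theorem polyApprox_polyEval (P : MvPolynomial (Fin d) ℂ) : PolyApprox m q (polyEval P) :=
  fun ε _ => ⟨P, by simp⟩

theorem PolyApprox.add (hq : 1 ≤ q) (hFm : AEStronglyMeasurable F m)
    (hGm : AEStronglyMeasurable G m) (hF : PolyApprox m q F) (hG : PolyApprox m q G) :
    PolyApprox m q (F + G) := by
  intro ε hε
  have hε' : ε / 2 ≠ 0 := by simpa using hε
  obtain ⟨P, hP⟩ := hF _ hε'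
  obtain ⟨Q, hQ⟩ := hG _ hε'
  refine ⟨P + Q, ?_⟩
  have : F + G - polyEval (P + Q) = (F - polyEval P) + (G - polyEval Q) := by
    ext x; simp [polyEval]; ring
  rw [this, ← ENNReal.add_halves ε]
  exact (eLpNorm_add_le (hFm.sub (continuous_polyEval P).aestronglyMeasurable)
    (hGm.sub (continuous_polyEval Q).aestronglyMeasurable) hq).trans (add_le_add hP hQ)

theorem PolyApprox.const_smul (a : ℂ) (hF : PolyApprox m q F) : PolyApprox m q (a • F) := by
  intro ε hε
  obtain ⟨P, hP⟩ := hF (ε / ‖a‖ₑ) (ENNReal.div_ne_zero.2 ⟨hε, enorm_ne_top⟩)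
  refine ⟨MvPolynomial.C a * P, ?_⟩
  have : a • F - polyEval (MvPolynomial.C a * P) = a • (F - polyEval P) := by
    ext x; simp [polyEval, mul_sub]
  rw [this, eLpNorm_const_smul]
  exact (mul_le_mul_right hP _).trans ENNReal.mul_div_le

open Filter Topology in
theorem polyApprox_exp (hq : 1 ≤ q) (hq' : q ≠ ∞)
    (hexp : ∀ c : ℝ, MemLp (fun x => Real.exp (c * ‖x‖)) q m) (ξ : Fin d → ℂ) :
    PolyApprox m q (fun x => Complex.exp (∑ i, ξ i * x i)) := by
  let P : ℕ → MvPolynomial (Fin d) ℂ := fun n =>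
    ∑ k ∈ Finset.range n, MvPolynomial.C ((k.factorial : ℂ)⁻¹) *
      (∑ i, MvPolynomial.C (ξ i) * MvPolynomial.X i) ^ k
  have hP : ∀ n x, polyEval (P n) x =
      ∑ k ∈ Finset.range n, (k.factorial : ℂ)⁻¹ * (∑ i, ξ i * x i) ^ k := by
    intro n x
    simp [P, polyEval]
  refine PolyApprox.of_tendsto_of_dominated hq hq' (F := fun n => polyEval (P n))
    (hexp (∑ i, ‖ξ i‖)) (fun n => (continuous_polyEval _).aestronglyMeasurable)
    (fun n => polyApprox_polyEval _) (fun n x => ?_) (fun x => ?_)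
  · have hz : ‖∑ i, ξ i * (x i : ℂ)‖ ≤ (∑ i, ‖ξ i‖) * ‖x‖ := by
      refine (norm_sum_le _ _).trans ?_
      rw [Finset.sum_mul]
      refine Finset.sum_le_sum fun i _ => ?_
      rw [norm_mul, Complex.norm_real]
      exact mul_le_mul_of_nonneg_left (PiLp.norm_apply_le x i) (norm_nonneg _)
    rw [hP]
    refine (norm_sum_le _ _).trans ?_
    refine le_trans ?_ (Real.exp_le_exp.2 hz)
    refine le_trans (le_of_eq ?_) (Real.sum_le_exp_of_nonneg (norm_nonneg _) n)
    refine Finset.sum_congr rfl fun k _ => ?_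
    rw [norm_mul, norm_pow, norm_inv, Complex.norm_natCast]
    ring
  · simp_rw [hP]
    rw [Complex.exp_eq_exp_ℂ]
    have := (NormedSpace.exp_series_hasSum_exp' (𝕂 := ℂ) (∑ i, ξ i * (x i : ℂ))).tendsto_sum_nat
    simpa using this

/-- The projection of `ℝ^d` onto the unit torus after rescaling by `L`. -/
def toTorus (L : ℝ) (x : EuclideanSpace ℝ (Fin d)) : UnitAddTorus (Fin d) :=
  fun i => ((x i / L : ℝ) : UnitAddCircle)

theorem continuous_toTorus (L : ℝ) : Continuous (toTorus (d := d) L) := by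
  refine continuous_pi fun i => ?_
  refine (AddCircle.continuous_mk' 1).comp ?_
  fun_prop

theorem polyApprox_comp_toTorus (hq : 1 ≤ q) (hq' : q ≠ ∞)
    (hexp : ∀ c : ℝ, MemLp (fun x => Real.exp (c * ‖x‖)) q m) (L : ℝ)
    (T : C(UnitAddTorus (Fin d), ℂ))
    (hT : T ∈ Submodule.span ℂ (Set.range (UnitAddTorus.mFourier (d := Fin d)))) :
    PolyApprox m q (fun x => T (toTorus L x)) := by
  have hm : ∀ S : C(UnitAddTorus (Fin d), ℂ),
      AEStronglyMeasurable (fun x => S (toTorus L x)) m := fun S =>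
    (S.continuous.comp (continuous_toTorus L)).aestronglyMeasurable
  induction hT using Submodule.span_induction with
  | mem T hT =>
    obtain ⟨n, rfl⟩ := hT
    convert polyApprox_exp hq hq' hexp
      (fun i => 2 * Real.pi * Complex.I * n i / L) using 2 with x
    simp only [UnitAddTorus.mFourier, ContinuousMap.coe_mk, toTorus, fourier_coe_apply,
      ← Complex.exp_sum]
    congr 1
    refine Finset.sum_congr rfl fun i _ => ?_
    push_cast
    ring
  | zero => exact fun ε _ => ⟨0, by simp [polyEval, Pi.sub_def]⟩
  | add S T _ _ hS hT => exact hS.add hq (hm S) (hm T) hT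
  | smul a S _ hS => exact hS.const_smul a

end PolyApprox

/-- A continuous function supported in a small ball is the restriction to a fundamental cube of a
continuous function on the torus. -/
theorem exists_torus_lift {d : ℕ} {h : EuclideanSpace ℝ (Fin d) → ℂ} (hc : Continuous h)
    {R L B : ℝ} (hR : 0 < R) (hRL : 2 * R < L) (hsupp : ∀ x, R ≤ ‖x‖ → h x = 0)
    (hB : ∀ x, ‖h x‖ ≤ B) :
    ∃ H : C(UnitAddTorus (Fin d), ℂ), ‖H‖ ≤ B ∧
      ∀ x, (∀ i, |x i| < L / 2) → H (toTorus L x) = h x := by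
  have hL : 0 < L := by linarith
  let rep : UnitAddCircle → ℝ := fun y => (AddCircle.equivIco 1 (-(1 / 2)) y : ℝ)
  have hrep : ∀ y, ((rep y : ℝ) : UnitAddCircle) = y := fun y =>
    (AddCircle.equivIco 1 (-(1 / 2))).symm_apply_apply y
  have hrep_abs : ∀ y, |rep y| ≤ 1 / 2 := fun y => by
    have := (AddCircle.equivIco 1 (-(1 / 2)) y).2
    rw [Set.mem_Ico] at this
    rw [abs_le]
    constructor <;> simp only [rep] <;> linarith
  have hrep_norm : ∀ y, |rep y| = ‖y‖ := fun y => by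
    conv_rhs => rw [← hrep y]
    refine ((AddCircle.norm_coe_eq_abs_iff 1 one_ne_zero).2 ?_).symm
    simpa using hrep_abs y
  let ψ : UnitAddTorus (Fin d) → EuclideanSpace ℝ (Fin d) := fun y =>
    WithLp.toLp 2 fun i => L * rep (y i)
  have hψ0 : ∀ y i, R / L ≤ ‖y i‖ → h (ψ y) = 0 := by
    intro y i hi
    refine hsupp _ ((?_ : R ≤ ‖(ψ y) i‖).trans (PiLp.norm_apply_le (ψ y) i))
    rw [div_le_iff₀ hL] at hi
    simp only [ψ, Real.norm_eq_abs, abs_mul, hrep_norm, abs_of_pos hL]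
    linarith
  have hcont : Continuous fun y => h (ψ y) := by
    rw [continuous_iff_continuousAt]
    intro y
    by_cases hy : ∃ i, R / L < ‖y i‖
    · obtain ⟨i, hi⟩ := hy
      have hev : ∀ᶠ z in nhds y, R / L < ‖z i‖ :=
        (continuous_norm.comp (continuous_apply i)).continuousAt.eventually (lt_mem_nhds hi)
      refine (continuousAt_const (y := (0 : ℂ))).congr ?_
      filter_upwards [hev] with z hz using (hψ0 z i hz.le).symm
    · push Not at hy
      refine hc.continuousAt.comp ?_
      refine (PiLp.continuous_toLp 2 _).continuousAt.comp ?_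
      refine continuousAt_pi.2 fun i => ?_
      refine continuousAt_const.mul ?_
      have hne : y i ≠ ((-(1 / 2) : ℝ) : UnitAddCircle) := by
        intro h1
        have h2 : ‖y i‖ = 1 / 2 := by
          rw [h1, (AddCircle.norm_coe_eq_abs_iff 1 one_ne_zero).2] <;> norm_num [abs_of_pos]
        have h3 := hy i
        rw [h2, le_div_iff₀ hL] at h3
        linarith
      have h4 : ContinuousAt rep (y i) :=
        continuousAt_subtype_val.comp (AddCircle.continuousAt_equivIco 1 (-(1 / 2)) hne)
      exact ContinuousAt.comp (f := fun z : UnitAddTorus (Fin d) => z i) h4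
        (continuous_apply i).continuousAt
  have hB0 : 0 ≤ B := (norm_nonneg _).trans (hB 0)
  refine ⟨⟨_, hcont⟩, (ContinuousMap.norm_le _ hB0).2 fun y => hB _, fun x hx => ?_⟩
  have : ψ (toTorus L x) = x := by
    ext i
    have h1 : rep ((x i / L : ℝ) : UnitAddCircle) = x i / L := by
      have h2 := abs_lt.1 (hx i)
      have h3 : x i / L ∈ Set.Ico (-(1 / 2) : ℝ) (-(1 / 2) + 1) := by
        rw [Set.mem_Ico, le_div_iff₀ hL, div_lt_iff₀ hL]
        constructor <;> linarith
      exact congrArg Subtype.val (AddCircle.equivIco_coe_eq h3)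
    simp only [ψ, toTorus, h1]
    field_simp
  change h (ψ (toTorus L x)) = h x
  rw [this]

open Filter Topology in
theorem polyApprox_of_continuous_of_compactSupport {d : ℕ}
    {m : Measure (EuclideanSpace ℝ (Fin d))} {q : ℝ≥0∞} (hq : 1 ≤ q) (hq' : q ≠ ∞)
    (hexp : ∀ c : ℝ, MemLp (fun x => Real.exp (c * ‖x‖)) q m)
    {h : EuclideanSpace ℝ (Fin d) → ℂ} (hc : Continuous h) (hs : HasCompactSupport h) :
    PolyApprox m q h := by
  obtain ⟨B, hB⟩ := hs.exists_bound_of_continuous hc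
  obtain ⟨R, hR, hsupp⟩ := hs.exists_pos_le_norm
  have key : ∀ n : ℕ, ∃ T : C(UnitAddTorus (Fin d), ℂ),
      T ∈ Submodule.span ℂ (Set.range (UnitAddTorus.mFourier (d := Fin d))) ∧ ‖T‖ ≤ B + 1 ∧
      ∀ x, (∀ i, |x i| < (2 * R + (n + 1)) / 2) →
        ‖T (toTorus (2 * R + (n + 1)) x) - h x‖ ≤ 1 / ((n : ℝ) + 1) := by
    intro n
    have hn : (0 : ℝ) < n + 1 := by positivity
    obtain ⟨H, hHB, hH⟩ := exists_torus_lift hc hR (L := 2 * R + (n + 1)) (by linarith) hsupp hB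
    have hcl : H ∈ closure (Submodule.span ℂ
        (Set.range (UnitAddTorus.mFourier (d := Fin d))) : Set C(UnitAddTorus (Fin d), ℂ)) := by
      rw [← Submodule.topologicalClosure_coe, UnitAddTorus.span_mFourier_closure_eq_top]
      trivial
    obtain ⟨T, hT, hdist⟩ := Metric.mem_closure_iff.1 hcl (1 / ((n : ℝ) + 1)) (by positivity)
    rw [dist_comm, dist_eq_norm] at hdist
    refine ⟨T, hT, ?_, fun x hx => ?_⟩
    · have h1 : 1 / ((n : ℝ) + 1) ≤ 1 := by
        rw [div_le_one hn]; linarith [(Nat.cast_nonneg n : (0 : ℝ) ≤ n)]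
      calc ‖T‖ = ‖(T - H) + H‖ := by rw [sub_add_cancel]
        _ ≤ ‖T - H‖ + ‖H‖ := norm_add_le _ _
        _ ≤ B + 1 := by linarith
    · rw [← hH x hx]
      exact ((T - H).norm_coe_le_norm _).trans hdist.le
  choose T hT hTB hTh using key
  refine PolyApprox.of_tendsto_of_dominated hq hq'
    (F := fun n x => T n (toTorus (2 * R + (n + 1)) x))
    (g := fun x => (B + 1) * Real.exp (0 * ‖x‖)) ((hexp 0).const_mul (B + 1))
    (fun n => ((T n).continuous.comp (continuous_toTorus _)).aestronglyMeasurable)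
    (fun n => polyApprox_comp_toTorus hq hq' hexp _ _ (hT n)) (fun n x => ?_) (fun x => ?_)
  · simpa using ((T n).norm_coe_le_norm _).trans (hTB n)
  · rw [tendsto_iff_norm_sub_tendsto_zero]
    obtain ⟨N, hN⟩ := exists_nat_gt (2 * ‖x‖)
    refine squeeze_zero' (Eventually.of_forall fun n => norm_nonneg _) ?_
      tendsto_one_div_add_atTop_nhds_zero_nat
    filter_upwards [eventually_ge_atTop N] with n hn
    refine hTh n x fun i => ?_
    have h1 : |x i| ≤ ‖x‖ := PiLp.norm_apply_le x i
    have h2 : (N : ℝ) ≤ n := by exact_mod_cast hn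
    linarith

/-- Polynomials are dense in `L^q(m)` if `m` has all exponential moments. -/
theorem PolyApprox.of_memLp {d : ℕ} {m : Measure (EuclideanSpace ℝ (Fin d))} [IsFiniteMeasure m]
    {q : ℝ≥0∞} (hq : 1 ≤ q) (hq' : q ≠ ∞)
    (hexp : ∀ c : ℝ, MemLp (fun x => Real.exp (c * ‖x‖)) q m)
    {F : EuclideanSpace ℝ (Fin d) → ℂ} (hF : MemLp F q m) : PolyApprox m q F := by
  refine PolyApprox.of_forall_exists hq hF.1 fun ε hε => ?_
  obtain ⟨g, hgs, hg, hgc, hgm⟩ := hF.exists_hasCompactSupport_eLpNorm_sub_le hq' hε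
  exact ⟨g, hgm.1, polyApprox_of_continuous_of_compactSupport hq hq' hexp hgc hgs, hg⟩

/-! ### Mixed norms over a product of finite measures -/

section MixedNorm

variable {α β : Type*} [MeasurableSpace α] [MeasurableSpace β]

/-- The mixed norm `L^p(ν; L²(σ))`. -/
def mixedLp (p : ℝ) (ν : Measure α) (σ : Measure β) (F : α → β → ℂ) : ℝ≥0∞ :=
  eLpNorm' (fun a => eLpNorm' (F a) 2 σ) p ν

variable {p : ℝ} {ν : Measure α} {σ : Measure β} {F G : α → β → ℂ}

theorem measurable_eLpNorm'_section [SFinite σ] (q : ℝ)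
    (hF : Measurable fun z : α × β => F z.1 z.2) : Measurable fun a => eLpNorm' (F a) q σ := by
  unfold eLpNorm'
  exact ((hF.enorm.pow_const q).lintegral_prod_right' (ν := σ)).pow_const _

theorem mixedLp_add_le [SFinite σ] (hp : 1 ≤ p) (hF : Measurable fun z : α × β => F z.1 z.2)
    (hG : Measurable fun z : α × β => G z.1 z.2) :
    mixedLp p ν σ (fun a b => F a b + G a b) ≤ mixedLp p ν σ F + mixedLp p ν σ G := by
  have hp0 : 0 ≤ p := zero_le_one.trans hp
  have h1 := ENNReal.lintegral_Lp_add_le (μ := ν) (p := p)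
    (measurable_eLpNorm'_section (σ := σ) 2 hF).aemeasurable
    (measurable_eLpNorm'_section (σ := σ) 2 hG).aemeasurable hp
  refine le_trans ?_ h1
  unfold mixedLp
  rw [eLpNorm']
  refine ENNReal.rpow_le_rpow (lintegral_mono fun a => ENNReal.rpow_le_rpow ?_ hp0)
    (by positivity)
  have hFa : Measurable (F a) := hF.comp measurable_prodMk_left
  have hGa : Measurable (G a) := hG.comp measurable_prodMk_left
  exact eLpNorm'_add_le hFa.aestronglyMeasurable hGa.aestronglyMeasurable one_le_two

theorem exists_mixedLp_le_mul_eLpNorm [IsFiniteMeasure ν] [IsFiniteMeasure σ] (hp : 1 ≤ p) :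
    ∃ C : ℝ≥0∞, C ≠ ∞ ∧ ∀ F : α → β → ℂ, Measurable (fun z : α × β => F z.1 z.2) →
      mixedLp p ν σ F ≤ C *
        eLpNorm (fun z : α × β => F z.1 z.2) (ENNReal.ofReal (p + 2)) (ν.prod σ) := by
  have hp0 : 0 < p := zero_lt_one.trans_le hp
  have hq0 : 0 < p + 2 := by linarith
  refine ⟨σ Set.univ ^ (1 / 2 - 1 / (p + 2)) * ν Set.univ ^ (1 / p - 1 / (p + 2)), ?_,
    fun F hF => ?_⟩
  · refine ENNReal.mul_ne_top
      (ENNReal.rpow_ne_top_of_nonneg (sub_nonneg.2 ?_) (measure_ne_top _ _))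
      (ENNReal.rpow_ne_top_of_nonneg (sub_nonneg.2 ?_) (measure_ne_top _ _)) <;>
    exact one_div_le_one_div_of_le (by linarith) (by linarith)
  · have hFa : ∀ a, Measurable (F a) := fun a => hF.comp measurable_prodMk_left
    have h1 : ∀ a, eLpNorm' (F a) 2 σ ≤
        eLpNorm' (F a) (p + 2) σ * σ Set.univ ^ (1 / 2 - 1 / (p + 2)) := fun a =>
      eLpNorm'_le_eLpNorm'_mul_rpow_measure_univ two_pos (by linarith)
        (hFa a).aestronglyMeasurable
    have h2 : mixedLp p ν σ F ≤ eLpNorm' (fun a => eLpNorm' (F a) 2 σ) (p + 2) ν *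
        ν Set.univ ^ (1 / p - 1 / (p + 2)) :=
      eLpNorm'_le_eLpNorm'_mul_rpow_measure_univ hp0 (by linarith)
        (measurable_eLpNorm'_section 2 hF).aestronglyMeasurable
    have h3 : eLpNorm' (fun a => eLpNorm' (F a) 2 σ) (p + 2) ν ≤
        σ Set.univ ^ (1 / 2 - 1 / (p + 2)) *
          eLpNorm (fun z : α × β => F z.1 z.2) (ENNReal.ofReal (p + 2)) (ν.prod σ) := by
      rw [eLpNorm_eq_lintegral_rpow_enorm_toReal (by simpa using hq0) ENNReal.ofReal_ne_top,
        ENNReal.toReal_ofReal hq0.le, lintegral_prod _ (hF.enorm.pow_const _).aemeasurable,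
        eLpNorm']
      set c := σ Set.univ ^ (1 / 2 - 1 / (p + 2))
      have h4 : ∫⁻ a, ‖eLpNorm' (F a) 2 σ‖ₑ ^ (p + 2) ∂ν ≤
          c ^ (p + 2) * ∫⁻ a, ∫⁻ b, ‖F a b‖ₑ ^ (p + 2) ∂σ ∂ν := by
        rw [← lintegral_const_mul _ (hF.enorm.pow_const _).lintegral_prod_right']
        refine lintegral_mono fun a => ?_
        refine (ENNReal.rpow_le_rpow (h1 a) hq0.le).trans ?_
        rw [ENNReal.mul_rpow_of_nonneg _ _ hq0.le, eLpNorm', ← ENNReal.rpow_mul,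
          one_div_mul_cancel hq0.ne', ENNReal.rpow_one, mul_comm]
      refine (ENNReal.rpow_le_rpow h4 (by positivity)).trans ?_
      rw [ENNReal.mul_rpow_of_nonneg _ _ (by positivity), ← ENNReal.rpow_mul,
        mul_one_div_cancel hq0.ne', ENNReal.rpow_one]
    calc _ ≤ _ := h2
      _ ≤ _ := mul_le_mul_left h3 _
      _ = _ := by ring

open Filter Topology in
theorem exists_mixedLp_truncation_lt [SFinite σ] (hp : 0 < p)
    (hF : Measurable fun z : α × β => F z.1 z.2) (hfin : mixedLp p ν σ F ≠ ∞) {ε : ℝ≥0∞}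
    (hε : ε ≠ 0) :
    ∃ n : ℕ, mixedLp p ν σ (fun a b => if ‖F a b‖ ≤ n then 0 else F a b) < ε := by
  let T : ℕ → α → β → ℂ := fun n a b => if ‖F a b‖ ≤ n then 0 else F a b
  have hT : ∀ n, Measurable fun z : α × β => T n z.1 z.2 := fun n =>
    Measurable.ite (measurableSet_le hF.norm measurable_const) measurable_const hF
  have hTle : ∀ n a b, ‖T n a b‖ₑ ≤ ‖F a b‖ₑ := fun n a b => by
    by_cases h : ‖F a b‖ ≤ n <;> simp [T, h]
  have hTlim : ∀ a b, Tendsto (fun n => ‖T n a b‖ₑ ^ (2 : ℝ)) atTop (𝓝 0) := fun a b => by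
    refine tendsto_const_nhds.congr' ?_
    obtain ⟨N, hN⟩ := exists_nat_gt ‖F a b‖
    filter_upwards [eventually_ge_atTop N] with n hn
    have h : ‖F a b‖ ≤ n := hN.le.trans (by exact_mod_cast hn)
    simp [T, h]
  have hfin' : ∫⁻ a, eLpNorm' (F a) 2 σ ^ p ∂ν ≠ ∞ := by
    intro h
    refine hfin ?_
    change (∫⁻ a, eLpNorm' (F a) 2 σ ^ p ∂ν) ^ (1 / p) = ∞
    rw [h, ENNReal.top_rpow_of_pos (by positivity)]
  have hae : ∀ᵐ a ∂ν, ∫⁻ b, ‖F a b‖ₑ ^ (2 : ℝ) ∂σ ≠ ∞ := by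
    filter_upwards [ae_lt_top ((measurable_eLpNorm'_section 2 hF).pow_const p) hfin'] with a ha h
    rw [eLpNorm', h, ENNReal.top_rpow_of_pos (by norm_num), ENNReal.top_rpow_of_pos hp] at ha
    exact ha.ne rfl
  have hin : ∀ᵐ a ∂ν, Tendsto (fun n => eLpNorm' (T n a) 2 σ ^ p) atTop (𝓝 0) := by
    filter_upwards [hae] with a ha
    have h1 : Tendsto (fun n => ∫⁻ b, ‖T n a b‖ₑ ^ (2 : ℝ) ∂σ) atTop (𝓝 (∫⁻ _, 0 ∂σ)) := by
      refine tendsto_lintegral_of_dominated_convergence (fun b => ‖F a b‖ₑ ^ (2 : ℝ))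
        (fun n => ?_) (fun n => ?_) ha (Eventually.of_forall fun b => hTlim a b)
      · exact ((hT n).comp measurable_prodMk_left).enorm.pow_const _
      · exact Eventually.of_forall fun b => ENNReal.rpow_le_rpow (hTle n a b) (by norm_num)
    rw [lintegral_zero] at h1
    have h2 := (ENNReal.continuous_rpow_const (y := 1 / 2 * p)).continuousAt.tendsto.comp h1
    rw [ENNReal.zero_rpow_of_pos (by positivity)] at h2
    refine h2.congr fun n => ?_
    rw [Function.comp_apply, ENNReal.rpow_mul, eLpNorm']
  have hout : Tendsto (fun n => ∫⁻ a, eLpNorm' (T n a) 2 σ ^ p ∂ν) atTop (𝓝 (∫⁻ _, 0 ∂ν)) := by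
    refine tendsto_lintegral_of_dominated_convergence (fun a => eLpNorm' (F a) 2 σ ^ p)
      (fun n => (measurable_eLpNorm'_section 2 (hT n)).pow_const p) (fun n => ?_) hfin' hin
    refine Eventually.of_forall fun a => ENNReal.rpow_le_rpow ?_ hp.le
    exact ENNReal.rpow_le_rpow (lintegral_mono fun b =>
      ENNReal.rpow_le_rpow (hTle n a b) (by norm_num)) (by norm_num)
  rw [lintegral_zero] at hout
  have h2 := (ENNReal.continuous_rpow_const (y := 1 / p)).continuousAt.tendsto.comp hout
  rw [ENNReal.zero_rpow_of_pos (by positivity)] at h2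
  exact (h2.eventually (gt_mem_nhds hε.bot_lt)).exists

end MixedNorm

/-! ### Exponential integrability of Muckenhoupt weights -/

theorem setLIntegral_muDelta (δ : ℝ) {a b : ℝ} (ha : 0 ≤ a) {g : ℝ → ℝ≥0∞} :
    ∫⁻ t in Set.Ioc a b, g t ∂(muDelta δ) =
      ∫⁻ t in Set.Ioc a b, ENNReal.ofReal (t ^ (2 * δ + 1)) * g t := by
  rw [muDelta, restrict_withDensity measurableSet_Ioc,
    Measure.restrict_restrict measurableSet_Ioc,
    Set.inter_eq_self_of_subset_left
      (show Set.Ioc a b ⊆ Set.Ioi 0 from fun t ht => ha.trans_lt ht.1),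
    lintegral_withDensity_eq_lintegral_mul_non_measurable _ (by fun_prop)
      (Filter.Eventually.of_forall fun _ => ENNReal.ofReal_lt_top)]
  rfl

theorem setLIntegral_muDelta_ne_zero (δ : ℝ) {b : ℝ} (hb : 0 < b) {g : ℝ → ℝ≥0∞}
    (hg : Measurable g) (hpos : ∀ t > 0, g t ≠ 0) :
    ∫⁻ t in Set.Ioc 0 b, g t ∂(muDelta δ) ≠ 0 := by
  rw [setLIntegral_muDelta δ le_rfl]
  have hm : Measurable fun t : ℝ => ENNReal.ofReal (t ^ (2 * δ + 1)) * g t := by fun_prop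
  intro h
  rw [setLIntegral_eq_zero_iff measurableSet_Ioc hm] at h
  have h2 : ∀ᵐ t : ℝ, t ∉ Set.Ioc 0 b := by
    filter_upwards [h] with t ht hmem
    refine mul_ne_zero ?_ (hpos t hmem.1) (ht hmem)
    simpa using Real.rpow_pos_of_pos hmem.1 _
  have h3 : volume (Set.Ioc 0 b) = 0 := by
    simpa using measure_eq_zero_iff_ae_notMem.2 h2
  simp at h3
  linarith

theorem muDelta_Ioc_le {δ : ℝ} (hδ : -1 ≤ 2 * δ) (n : ℕ) :
    muDelta δ (Set.Ioc 0 ((n : ℝ) + 1)) ≤ ((n : ℝ≥0∞) + 1) ^ (⌈2 * δ + 1⌉₊ + 1) := by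
  have hn : (1 : ℝ) ≤ n + 1 := by linarith [(Nat.cast_nonneg n : (0 : ℝ) ≤ n)]
  have hcast : ENNReal.ofReal ((n : ℝ) + 1) = (n : ℝ≥0∞) + 1 := by
    rw [ENNReal.ofReal_add (by positivity) zero_le_one]; simp
  have h := setLIntegral_muDelta δ (b := (n : ℝ) + 1) le_rfl (g := 1)
  simp only [Pi.one_apply, lintegral_one, Measure.restrict_apply_univ, mul_one] at h
  rw [h]
  calc _ ≤ ∫⁻ _ in Set.Ioc 0 ((n : ℝ) + 1),
        ENNReal.ofReal (((n : ℝ) + 1) ^ ⌈2 * δ + 1⌉₊) := by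
        refine setLIntegral_mono measurable_const fun t ht => ENNReal.ofReal_le_ofReal ?_
        rw [← Real.rpow_natCast]
        exact (Real.rpow_le_rpow ht.1.le ht.2 (by linarith)).trans
          (Real.rpow_le_rpow_of_exponent_le hn (Nat.le_ceil _))
    _ = _ := by
        rw [setLIntegral_const, Real.volume_Ioc, sub_zero, ENNReal.ofReal_pow (by positivity),
          hcast, pow_succ]

theorem IsApWeight.exists_setLIntegral_le {δ p : ℝ} {w : ℝ → ℝ} (hδ : -1 ≤ 2 * δ) (hp : 1 < p)
    (hw : IsApWeight δ p w) :
    ∃ K : ℝ≥0∞, K ≠ ∞ ∧ ∃ M : ℕ, ∀ n : ℕ,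
      ∫⁻ t in Set.Ioc 0 ((n : ℝ) + 1), ENNReal.ofReal (w t) ∂(muDelta δ) ≤
        K * ((n : ℝ≥0∞) + 1) ^ M := by
  obtain ⟨hwm, hwpos, A, hA, hAp⟩ := hw
  have hp1 : 0 < p - 1 := by linarith
  let S : ℝ → ℝ≥0∞ := fun b =>
    ∫⁻ t in Set.Ioc 0 b, ENNReal.ofReal (w t ^ (-1 / (p - 1))) ∂(muDelta δ)
  have hS1 : S 1 ^ (p - 1) ≠ 0 := by
    have h : S 1 ≠ 0 := by
      refine setLIntegral_muDelta_ne_zero δ one_pos (hwm.pow_const _).ennreal_ofReal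
        fun t ht => ?_
      simpa using Real.rpow_pos_of_pos (hwpos t ht) _
    rw [Ne, ENNReal.rpow_eq_zero_iff]
    rintro (⟨h', -⟩ | ⟨-, h'⟩)
    · exact h h'
    · linarith
  let k := ⌈2 * δ + 1⌉₊ + 1
  refine ⟨A / S 1 ^ (p - 1), ENNReal.div_ne_top hA hS1, k + k * ⌈p - 1⌉₊, fun n => ?_⟩
  set N : ℝ≥0∞ := (n : ℝ≥0∞) + 1 with hN
  have hNtop : N ≠ ∞ := by simp [hN]
  set μ := muDelta δ (Set.Ioc 0 ((n : ℝ) + 1)) with hμ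
  set W := ∫⁻ t in Set.Ioc 0 ((n : ℝ) + 1), ENNReal.ofReal (w t) ∂(muDelta δ)
  have hn0 : (0 : ℝ) < n + 1 := by positivity
  have hμN : μ ≤ N ^ k := muDelta_Ioc_le hδ n
  have hμtop : μ ≠ ∞ := (hμN.trans_lt (ENNReal.pow_lt_top hNtop.lt_top)).ne
  have hμ0 : μ ≠ 0 := by
    have h := setLIntegral_muDelta_ne_zero δ hn0 (g := 1) measurable_const (by simp)
    simpa only [Pi.one_apply, lintegral_one, Measure.restrict_apply_univ] using h
  have hS : S 1 ≤ S ((n : ℝ) + 1) :=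
    lintegral_mono_set (Set.Ioc_subset_Ioc_right (by simp))
  have h1 : W * S 1 ^ (p - 1) ≤ A * N ^ (k + k * ⌈p - 1⌉₊) := by
    calc W * S 1 ^ (p - 1) ≤ W * S ((n : ℝ) + 1) ^ (p - 1) := by gcongr
      _ = ((μ⁻¹ * W) * (μ⁻¹ * S ((n : ℝ) + 1)) ^ (p - 1)) * (μ * μ ^ (p - 1)) := by
          have e1 : W = μ * (μ⁻¹ * W) := by
            rw [← mul_assoc, ENNReal.mul_inv_cancel hμ0 hμtop, one_mul]
          have e2 : S ((n : ℝ) + 1) = μ * (μ⁻¹ * S ((n : ℝ) + 1)) := by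
            rw [← mul_assoc, ENNReal.mul_inv_cancel hμ0 hμtop, one_mul]
          conv_lhs => rw [e1, e2, ENNReal.mul_rpow_of_nonneg _ _ hp1.le]
          ring
      _ ≤ A * (N ^ k * (N ^ k) ^ ⌈p - 1⌉₊) := by
          refine mul_le_mul' (hAp 0 _ le_rfl hn0) (mul_le_mul' hμN ?_)
          refine (ENNReal.rpow_le_rpow hμN hp1.le).trans ?_
          rw [← ENNReal.rpow_natCast (N ^ k)]
          refine ENNReal.rpow_le_rpow_of_exponent_le (one_le_pow₀ ?_) (Nat.le_ceil _)
          simp [hN]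
      _ = _ := by rw [← pow_mul, ← pow_add]
  rw [← ENNReal.mul_div_right_comm]
  exact (ENNReal.le_div_iff_mul_le (Or.inl hS1)
    (Or.inr (ENNReal.mul_ne_top hA (ENNReal.pow_ne_top hNtop)))).2 h1

theorem IsApWeight.lintegral_exp_neg_lt_top {δ p : ℝ} {w : ℝ → ℝ} (hδ : -1 ≤ 2 * δ) (hp : 1 < p)
    (hw : IsApWeight δ p w) :
    ∫⁻ r in Set.Ioi (0 : ℝ), ENNReal.ofReal (Real.exp (-r)) *
      ENNReal.ofReal (w r * r ^ (2 * δ + 1)) < ∞ := by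
  obtain ⟨K, hK, M, hKM⟩ := hw.exists_setLIntegral_le hδ hp
  have hwpos := hw.2.1
  let g : ℝ → ℝ≥0∞ := fun r =>
    ENNReal.ofReal (Real.exp (-r)) * ENNReal.ofReal (w r * r ^ (2 * δ + 1))
  have hcover : Set.Ioi (0 : ℝ) ⊆ ⋃ n : ℕ, Set.Ioc (n : ℝ) (n + 1) := by
    intro r hr
    have hr : 0 < r := hr
    have h1 : 0 < ⌈r⌉₊ := Nat.ceil_pos.2 hr
    refine Set.mem_iUnion.2 ⟨⌈r⌉₊ - 1, ?_, ?_⟩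
    · rw [Nat.cast_sub h1]
      have := Nat.ceil_lt_add_one hr.le
      push_cast; linarith
    · rw [Nat.cast_sub h1]
      have := Nat.le_ceil r
      push_cast; linarith
  have hpiece : ∀ n : ℕ, ∫⁻ r in Set.Ioc (n : ℝ) (n + 1), g r ≤
      K * ENNReal.ofReal (((n : ℝ) + 1) ^ M * Real.exp (-n)) := by
    intro n
    have hcast : ENNReal.ofReal ((n : ℝ) + 1) = (n : ℝ≥0∞) + 1 := by
      rw [ENNReal.ofReal_add (by positivity) zero_le_one]; simp
    calc ∫⁻ r in Set.Ioc (n : ℝ) (n + 1), g r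
        ≤ ∫⁻ r in Set.Ioc (n : ℝ) (n + 1), ENNReal.ofReal (Real.exp (-n)) *
          (ENNReal.ofReal (r ^ (2 * δ + 1)) * ENNReal.ofReal (w r)) := by
          refine setLIntegral_mono' measurableSet_Ioc fun r hr => ?_
          have hr0 : 0 < r := (Nat.cast_nonneg n).trans_lt hr.1
          rw [← ENNReal.ofReal_mul (Real.rpow_nonneg hr0.le _), mul_comm (r ^ _)]
          exact mul_le_mul' (ENNReal.ofReal_le_ofReal
            (Real.exp_le_exp.2 (neg_le_neg hr.1.le))) le_rfl
      _ = ENNReal.ofReal (Real.exp (-n)) * ∫⁻ r in Set.Ioc (n : ℝ) (n + 1),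
          (ENNReal.ofReal (r ^ (2 * δ + 1)) * ENNReal.ofReal (w r)) :=
          lintegral_const_mul' _ _ ENNReal.ofReal_ne_top
      _ ≤ ENNReal.ofReal (Real.exp (-n)) * (K * ((n : ℝ≥0∞) + 1) ^ M) := by
          gcongr
          refine le_trans ?_ (hKM n)
          rw [setLIntegral_muDelta δ le_rfl]
          exact lintegral_mono_set (Set.Ioc_subset_Ioc_left (Nat.cast_nonneg n))
      _ = _ := by
          rw [ENNReal.ofReal_mul (by positivity), ENNReal.ofReal_pow (by positivity), hcast]
          ring
  have hsum : Summable fun n : ℕ => ((n : ℝ) + 1) ^ M * Real.exp (-n) := by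
    have h := ((summable_nat_add_iff 1).2
      (Real.summable_pow_mul_exp_neg_nat_mul M one_pos)).mul_left (Real.exp 1)
    refine h.congr fun n => ?_
    rw [mul_left_comm, ← Real.exp_add]
    push_cast
    ring_nf
  calc ∫⁻ r in Set.Ioi (0 : ℝ), g r
      ≤ ∫⁻ r in ⋃ n : ℕ, Set.Ioc (n : ℝ) (n + 1), g r := lintegral_mono_set hcover
    _ ≤ ∑' n : ℕ, ∫⁻ r in Set.Ioc (n : ℝ) (n + 1), g r := lintegral_iUnion_le _ _
    _ ≤ ∑' n : ℕ, K * ENNReal.ofReal (((n : ℝ) + 1) ^ M * Real.exp (-n)) :=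
        ENNReal.tsum_le_tsum hpiece
    _ < ∞ := by
        rw [ENNReal.tsum_mul_left, ← ENNReal.ofReal_tsum_of_nonneg (fun n => by positivity) hsum]
        exact ENNReal.mul_lt_top hK.lt_top ENNReal.ofReal_lt_top

/-- The radial weight measure multiplied by a Gaussian. -/
def gaussRadial (δ p : ℝ) (w : ℝ → ℝ) : Measure ℝ :=
  (volume.restrict (Set.Ioi (0 : ℝ))).withDensity fun r =>
    ENNReal.ofReal (Real.exp (-(p * r ^ 2 / 2))) * ENNReal.ofReal (w r * r ^ (2 * δ + 1))

theorem lintegral_gaussRadial {δ p : ℝ} {w : ℝ → ℝ} (hw : Measurable w) (g : ℝ → ℝ≥0∞) :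
    ∫⁻ r, g r ∂(gaussRadial δ p w) = ∫⁻ r in Set.Ioi (0 : ℝ),
      ENNReal.ofReal (Real.exp (-(p * r ^ 2 / 2))) * ENNReal.ofReal (w r * r ^ (2 * δ + 1)) *
        g r := by
  rw [gaussRadial, lintegral_withDensity_eq_lintegral_mul_non_measurable _ (by fun_prop)
      (Filter.Eventually.of_forall fun _ =>
        ENNReal.mul_lt_top ENNReal.ofReal_lt_top ENNReal.ofReal_lt_top)]
  rfl

theorem IsApWeight.lintegral_exp_gaussRadial_lt_top {δ p : ℝ} {w : ℝ → ℝ} (hδ : -1 ≤ 2 * δ)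
    (hp : 1 < p) (hw : IsApWeight δ p w) (c : ℝ) :
    ∫⁻ r, ENNReal.ofReal (Real.exp (c * |r|)) ∂(gaussRadial δ p w) < ∞ := by
  have hp0 : 0 < p := by linarith
  rw [lintegral_gaussRadial hw.1]
  calc _ ≤ ∫⁻ r in Set.Ioi (0 : ℝ), ENNReal.ofReal (Real.exp ((c + 1) ^ 2 / (2 * p))) *
        (ENNReal.ofReal (Real.exp (-r)) * ENNReal.ofReal (w r * r ^ (2 * δ + 1))) := by
        refine setLIntegral_mono' measurableSet_Ioi fun r hr => ?_
        rw [mul_right_comm, ← mul_assoc]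
        refine mul_le_mul' ?_ le_rfl
        rw [← ENNReal.ofReal_mul (Real.exp_nonneg _), ← ENNReal.ofReal_mul (Real.exp_nonneg _),
          ← Real.exp_add, ← Real.exp_add, abs_of_pos hr]
        refine ENNReal.ofReal_le_ofReal (Real.exp_le_exp.2 ?_)
        have h : (c + 1) ^ 2 / (2 * p) + -r - (-(p * r ^ 2 / 2) + c * r) =
            (c + 1 - p * r) ^ 2 / (2 * p) := by
          field_simp; ring
        have h2 : 0 ≤ (c + 1 - p * r) ^ 2 / (2 * p) := by positivity
        linarith
    _ < ∞ := by
        rw [lintegral_const_mul' _ _ ENNReal.ofReal_ne_top]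
        exact ENNReal.mul_lt_top ENNReal.ofReal_lt_top (hw.lintegral_exp_neg_lt_top hδ hp)

theorem IsApWeight.isFiniteMeasure_gaussRadial {δ p : ℝ} {w : ℝ → ℝ} (hδ : -1 ≤ 2 * δ)
    (hp : 1 < p) (hw : IsApWeight δ p w) : IsFiniteMeasure (gaussRadial δ p w) :=
  ⟨by simpa using hw.lintegral_exp_gaussRadial_lt_top hδ hp 0⟩

/-! ### Density of the Hermite functions -/

section Density

variable {d : ℕ} {p : ℝ} {w : ℝ → ℝ}

/-- Polar coordinates `(r, ω) ↦ r ω`. -/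
def polarMap (d : ℕ) (z : ℝ × Metric.sphere (0 : EuclideanSpace ℝ (Fin d)) 1) :
    EuclideanSpace ℝ (Fin d) :=
  z.1 • (z.2 : EuclideanSpace ℝ (Fin d))

theorem measurable_polarMap : Measurable (polarMap d) := by
  unfold polarMap
  fun_prop

theorem norm_polarMap (z : ℝ × Metric.sphere (0 : EuclideanSpace ℝ (Fin d)) 1) :
    ‖polarMap d z‖ = |z.1| := by
  simp [polarMap, norm_smul]

instance : IsFiniteMeasure (sphereMeasure d) := by
  unfold sphereMeasure; infer_instance

theorem mixedNorm_mul_gauss (hw : Measurable w) (hp : 0 < p)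
    (F : EuclideanSpace ℝ (Fin d) → ℂ) :
    mixedNorm d p w (fun x => F x * (Real.exp (-‖x‖ ^ 2 / 2) : ℂ)) =
      mixedLp p (gaussRadial ((d : ℝ) / 2 - 1) p w) (sphereMeasure d)
        (fun r ω => F (polarMap d (r, ω))) := by
  unfold mixedNorm mixedLp
  rw [eLpNorm', lintegral_gaussRadial hw]
  congr 1
  refine setLIntegral_congr_fun measurableSet_Ioi fun r hr => ?_
  have hr : 0 < r := hr
  have h1 : ∀ ω : Metric.sphere (0 : EuclideanSpace ℝ (Fin d)) 1,
      ENNReal.ofReal (‖F (r • (ω : EuclideanSpace ℝ (Fin d))) *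
        (Real.exp (-‖r • (ω : EuclideanSpace ℝ (Fin d))‖ ^ 2 / 2) : ℂ)‖ ^ 2) =
      ENNReal.ofReal (Real.exp (-r ^ 2)) * ‖F (polarMap d (r, ω))‖ₑ ^ (2 : ℝ) := by
    intro ω
    have hn : ‖r • (ω : EuclideanSpace ℝ (Fin d))‖ = r := by
      rw [norm_smul, norm_eq_of_mem_sphere, mul_one, Real.norm_of_nonneg hr.le]
    rw [hn, norm_mul, Complex.norm_real, Real.norm_of_nonneg (Real.exp_nonneg _), mul_pow,
      mul_comm, ENNReal.ofReal_mul (by positivity), ← Real.exp_nat_mul,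
      ENNReal.ofReal_pow (norm_nonneg _), ofReal_norm, ← ENNReal.rpow_natCast]
    congr 3
    push_cast
    ring
  have h2 : ENNReal.ofReal (Real.exp (-r ^ 2)) ^ (p / 2) =
      ENNReal.ofReal (Real.exp (-(p * r ^ 2 / 2))) := by
    rw [ENNReal.ofReal_rpow_of_pos (Real.exp_pos _), ← Real.exp_mul]
    congr 2
    ring
  have h3 : (2 * ((d : ℝ) / 2 - 1) + 1) = (d : ℝ) - 1 := by ring
  simp_rw [h1]
  rw [lintegral_const_mul' _ _ ENNReal.ofReal_ne_top, ENNReal.mul_rpow_of_nonneg _ _ (by positivity),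
    h2, h3, enorm_eq_self, eLpNorm', ← ENNReal.rpow_mul, one_div_mul_eq_div]
  ring

theorem memLp_exp_norm_map_polarMap {δ : ℝ} (hδ : -1 ≤ 2 * δ) (hp : 1 < p)
    (hw : IsApWeight δ p w) (c : ℝ) :
    MemLp (fun x => Real.exp (c * ‖x‖)) (ENNReal.ofReal (p + 2))
      (((gaussRadial δ p w).prod (sphereMeasure d)).map (polarMap d)) := by
  have hq : 0 < p + 2 := by linarith
  have hm : Measurable fun x : EuclideanSpace ℝ (Fin d) => Real.exp (c * ‖x‖) := by fun_prop
  have := hw.isFiniteMeasure_gaussRadial hδ hp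
  refine ⟨hm.aestronglyMeasurable, ?_⟩
  rw [eLpNorm_lt_top_iff_lintegral_rpow_enorm_lt_top (by simpa using hq) ENNReal.ofReal_ne_top,
    ENNReal.toReal_ofReal hq.le, lintegral_map (hm.enorm.pow_const _) measurable_polarMap]
  have hmp : Measurable fun z => ‖Real.exp (c * ‖polarMap d z‖)‖ₑ ^ (p + 2) :=
    (hm.comp measurable_polarMap).enorm.pow_const _
  rw [lintegral_prod _ hmp.aemeasurable]
  have h1 : ∀ (r : ℝ) (ω : Metric.sphere (0 : EuclideanSpace ℝ (Fin d)) 1),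
      ‖Real.exp (c * ‖polarMap d (r, ω)‖)‖ₑ ^ (p + 2) =
        ENNReal.ofReal (Real.exp ((c * (p + 2)) * |r|)) := by
    intro r ω
    rw [norm_polarMap, Real.enorm_eq_ofReal (Real.exp_nonneg _),
      ENNReal.ofReal_rpow_of_pos (Real.exp_pos _), ← Real.exp_mul]
    congr 2
    ring
  simp_rw [h1, lintegral_const]
  rw [lintegral_mul_const _ (by fun_prop)]
  exact ENNReal.mul_lt_top (hw.lintegral_exp_gaussRadial_lt_top hδ hp _) (measure_lt_top _ _)

end Density

theorem stmt16 (d : ℕ) (hd : 2 ≤ d) (p : ℝ) (hp : 1 < p) (w : ℝ → ℝ)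
    (hw : IsApWeight ((d : ℝ) / 2 - 1) p w)
    (f : EuclideanSpace ℝ (Fin d) → ℂ) (hfm : Measurable f)
    (hf : mixedNorm d p w f < ∞) (ε : ℝ) (hε : 0 < ε) :
    ∃ g ∈ Submodule.span ℂ (Set.range fun α : Fin d → ℕ => hermitePhiC α),
      mixedNorm d p w (f - g) < ENNReal.ofReal ε := by
  have hp0 : 0 < p := by linarith
  have hδ : -1 ≤ 2 * ((d : ℝ) / 2 - 1) := by
    have : (2 : ℝ) ≤ d := by exact_mod_cast hd
    linarith
  have := hw.isFiniteMeasure_gaussRadial hδ hp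
  set ν := gaussRadial ((d : ℝ) / 2 - 1) p w
  set q : ℝ≥0∞ := ENNReal.ofReal (p + 2)
  set m := (ν.prod (sphereMeasure d)).map (polarMap d)
  have hq : 1 ≤ q := ENNReal.one_le_ofReal.2 (by linarith)
  have hq' : q ≠ ∞ := ENNReal.ofReal_ne_top
  let G : EuclideanSpace ℝ (Fin d) → ℂ := fun x => f x * (Real.exp (‖x‖ ^ 2 / 2) : ℂ)
  have hG : Measurable G := hfm.mul (by fun_prop)
  have hfG : f = fun x => G x * (Real.exp (-‖x‖ ^ 2 / 2) : ℂ) := by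
    ext x
    rw [mul_assoc, ← Complex.ofReal_mul, ← Real.exp_add, neg_div, add_neg_cancel]
    simp
  have hGfin : mixedLp p ν (sphereMeasure d) (fun r ω => G (polarMap d (r, ω))) ≠ ∞ := by
    rw [← mixedNorm_mul_gauss hw.1 hp0, ← hfG]
    exact hf.ne
  have hε2 : ENNReal.ofReal ε / 2 ≠ 0 := by simpa using hε
  obtain ⟨n, hn⟩ := exists_mixedLp_truncation_lt hp0 (hG.comp measurable_polarMap) hGfin hε2
  let T : EuclideanSpace ℝ (Fin d) → ℂ := fun x => if ‖G x‖ ≤ n then 0 else G x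
  have hT : Measurable T :=
    Measurable.ite (measurableSet_le hG.norm measurable_const) measurable_const hG
  obtain ⟨C, hC, hCle⟩ := exists_mixedLp_le_mul_eLpNorm (ν := ν) (σ := sphereMeasure d) hp.le
  have hmem : MemLp (fun x => G x - T x) q m := by
    refine MemLp.of_bound (hG.sub hT).aestronglyMeasurable n
      (Filter.Eventually.of_forall fun x => ?_)
    by_cases h : ‖G x‖ ≤ n <;> simp [T, h]
  obtain ⟨P, hP⟩ := PolyApprox.of_memLp hq hq' (memLp_exp_norm_map_polarMap hδ hp hw) hmem
    (ENNReal.ofReal ε / 2 / C) (ENNReal.div_ne_zero.2 ⟨hε2, hC⟩)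
  have hPm : Measurable (polyEval P) := (continuous_polyEval P).measurable
  have hD : Measurable fun x => G x - T x - polyEval P x := (hG.sub hT).sub hPm
  have hP' : mixedLp p ν (sphereMeasure d) (fun r ω => G (polarMap d (r, ω)) -
      T (polarMap d (r, ω)) - polyEval P (polarMap d (r, ω))) ≤ ENNReal.ofReal ε / 2 := by
    refine (hCle _ (hD.comp measurable_polarMap)).trans ?_
    refine le_trans (mul_le_mul_right ?_ C) (ENNReal.mul_div_le (a := C))
    exact (eLpNorm_map_measure hD.aestronglyMeasurable
      measurable_polarMap.aemeasurable).symm.trans_le hP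
  refine ⟨_, polyEval_mul_exp_mem_span P, ?_⟩
  have hsub : f - (fun x => polyEval P x * (Real.exp (-‖x‖ ^ 2 / 2) : ℂ)) =
      fun x => (G x - polyEval P x) * (Real.exp (-‖x‖ ^ 2 / 2) : ℂ) := by
    conv_lhs => rw [hfG]
    ext x
    simp only [Pi.sub_apply, sub_mul]
  rw [hsub, mixedNorm_mul_gauss hw.1 hp0 fun x => G x - polyEval P x]
  have hsplit : (fun (r : ℝ) (ω : Metric.sphere (0 : EuclideanSpace ℝ (Fin d)) 1) =>
      G (polarMap d (r, ω)) - polyEval P (polarMap d (r, ω))) = fun r ω =>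
      T (polarMap d (r, ω)) + (G (polarMap d (r, ω)) - T (polarMap d (r, ω)) -
        polyEval P (polarMap d (r, ω))) := by
    ext r ω; ring
  rw [hsplit]
  refine (mixedLp_add_le hp.le (hT.comp measurable_polarMap)
    (hD.comp measurable_polarMap)).trans_lt ?_
  rw [← ENNReal.add_halves (ENNReal.ofReal ε)]
  exact ENNReal.add_lt_add_of_lt_of_le (hP'.trans_lt (by finiteness)).ne hn hP'

end
end
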